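/- arXiv:1602.04577 — 5 statements merged into one kernel-verified Lean document; each statement's English description precedes it below -/
import Mathlib

section
/- Let n ≥ 2 be an integer, let α ∈ (0, ∞), and let p ∈ 𝒫_n. If q ∈ [0, 1/n] satisfies H(v_n(q)) = H(p) and r ∈ [1/n, 1] satisfies H(w_n(r)) = H(p), then ‖w_n(r)‖_α ≤ ‖p‖_α ≤ ‖v_n(q)‖_α. -/
open Real

/-- Shannon entropy (natural log, with `0 * log 0 = 0` since `Real.log 0 = 0`). -/
noncomputable def shannonEntropy {n : ℕ} (p : Fin n → ℝ) : ℝ :=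
  -∑ i, p i * Real.log (p i)

/-- ℓ_α-norm of a vector (real power). -/
noncomputable def lNorm {n : ℕ} (α : ℝ) (p : Fin n → ℝ) : ℝ :=
  (∑ i, p i ^ α) ^ (1 / α)

/-- `p` is an `n`-ary probability vector. -/
def IsProbVec {n : ℕ} (p : Fin n → ℝ) : Prop :=
  (∀ i, 0 ≤ p i) ∧ ∑ i, p i = 1

/-- The vector `v_n(q)`: first entry `1 - (n-1)q`, the other `n-1` entries equal `q`. -/
noncomputable def vVec (n : ℕ) (q : ℝ) : Fin n → ℝ :=
  fun i => if (i : ℕ) = 0 then 1 - ((n : ℝ) - 1) * q else q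

/-- The vector `w_n(r)`: first `⌊1/r⌋` entries equal `r`, the next entry is
`1 - ⌊1/r⌋·r`, the remaining entries are `0`. -/
noncomputable def wVec (n : ℕ) (r : ℝ) : Fin n → ℝ :=
  fun i => if (i : ℕ) < ⌊1 / r⌋₊ then r
           else if (i : ℕ) = ⌊1 / r⌋₊ then 1 - (⌊1 / r⌋₊ : ℝ) * r
           else 0

open MeasureTheory

lemma aux_int (α : ℝ) (hα : 0 < α) (x : ℝ) (hx0 : 0 ≤ x) :
    IntervalIntegrable (fun t : ℝ => max (t - x) 0 * t ^ (α - 2)) volume 0 1 := by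
  have h := intervalIntegral.intervalIntegrable_rpow' (a := 0) (b := 1) (r := α - 1) (by linarith)
  refine h.mono_fun' ?_ ?_
  · exact (Measurable.mul (by fun_prop) (by fun_prop)).aestronglyMeasurable
  · refine (ae_restrict_iff' measurableSet_uIoc).2 (Filter.Eventually.of_forall fun t ht => ?_)
    rw [Set.uIoc_of_le zero_le_one] at ht
    have ht0 := ht.1
    have h1 : t ^ (α - 1) = t * t ^ (α - 2) := by
      have e1 : α - 1 = 1 + (α - 2) := by ring
      rw [e1, Real.rpow_add ht0, Real.rpow_one]
    have hp : 0 < t ^ (α - 2) := Real.rpow_pos_of_pos ht0 _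
    show ‖max (t - x) 0 * t ^ (α - 2)‖ ≤ t ^ (α - 1)
    rw [Real.norm_of_nonneg (mul_nonneg (le_max_right _ _) hp.le), h1]
    apply mul_le_mul_of_nonneg_right _ hp.le
    exact max_le (by linarith) ht0.le

lemma aux_split (α : ℝ) (hα : 0 < α) (x : ℝ) (hx0 : 0 ≤ x) (hx1 : x ≤ 1) :
    ∫ t in (0:ℝ)..1, max (t - x) 0 * t ^ (α - 2) = ∫ t in x..1, (t - x) * t ^ (α - 2) := by
  have h := aux_int α hα x hx0
  have ha : IntervalIntegrable (fun t : ℝ => max (t - x) 0 * t ^ (α - 2)) volume 0 x :=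
    h.mono_set (by rw [Set.uIcc_of_le hx0, Set.uIcc_of_le zero_le_one]
                   exact Set.Icc_subset_Icc le_rfl hx1)
  have hb : IntervalIntegrable (fun t : ℝ => max (t - x) 0 * t ^ (α - 2)) volume x 1 :=
    h.mono_set (by rw [Set.uIcc_of_le hx1, Set.uIcc_of_le zero_le_one]
                   exact Set.Icc_subset_Icc hx0 le_rfl)
  rw [← intervalIntegral.integral_add_adjacent_intervals ha hb]
  have e1 : ∫ t in (0:ℝ)..x, max (t - x) 0 * t ^ (α - 2) = ∫ t in (0:ℝ)..x, (0:ℝ) := by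
    apply intervalIntegral.integral_congr
    intro t ht
    rw [Set.uIcc_of_le hx0] at ht
    simp only
    rw [max_eq_right (by linarith [ht.2]), zero_mul]
  have e2 : ∫ t in x..1, max (t - x) 0 * t ^ (α - 2) = ∫ t in x..1, (t - x) * t ^ (α - 2) := by
    apply intervalIntegral.integral_congr
    intro t ht
    rw [Set.uIcc_of_le hx1] at ht
    simp only
    rw [max_eq_left (by linarith [ht.1])]
  rw [e1, e2]; simp

lemma aux_pow (α : ℝ) (hα : 0 < α) (x : ℝ) (hx0 : 0 ≤ x) (hx1 : x ≤ 1) :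
    α * (α - 1) * ∫ t in (0:ℝ)..1, max (t - x) 0 * t ^ (α - 2) = x ^ α - 1 - α * (x - 1) := by
  rw [aux_split α hα x hx0 hx1]
  rcases hx0.eq_or_lt with rfl | hx
  · have e : ∫ t in (0:ℝ)..1, (t - 0) * t ^ (α - 2) = ∫ t in (0:ℝ)..1, t ^ (α - 1) := by
      apply intervalIntegral.integral_congr_ae
      refine Filter.Eventually.of_forall fun t ht => ?_
      rw [Set.uIoc_of_le zero_le_one] at ht
      have : α - 1 = 1 + (α - 2) := by ring
      rw [this, Real.rpow_add ht.1, Real.rpow_one, sub_zero]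
    rw [e, integral_rpow (Or.inl (by linarith))]
    rw [Real.zero_rpow hα.ne']
    simp
    rw [Real.zero_rpow hα.ne']
    field_simp
    ring
  · rw [← intervalIntegral.integral_const_mul]
    have hd : ∀ t ∈ Set.uIcc x 1, HasDerivAt (fun t : ℝ => (α - 1) * t ^ α - α * x * t ^ (α - 1))
        (α * (α - 1) * ((t - x) * t ^ (α - 2))) t := by
      intro t ht
      rw [Set.uIcc_of_le hx1] at ht
      have ht0 : 0 < t := lt_of_lt_of_le hx ht.1
      have h1 := (Real.hasDerivAt_rpow_const (p := α) (Or.inl ht0.ne')).const_mul (α - 1)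
      have h2 := (Real.hasDerivAt_rpow_const (p := α - 1) (Or.inl ht0.ne')).const_mul (α * x)
      refine (h1.sub h2).congr_deriv ?_
      have e1 : α - 1 = 1 + (α - 2) := by ring
      have e2 : t ^ (α - 1) = t * t ^ (α - 2) := by
        rw [e1, Real.rpow_add ht0, Real.rpow_one]
      have e3 : α - 1 - 1 = α - 2 := by ring
      rw [e3, e2]; ring
    rw [intervalIntegral.integral_eq_sub_of_hasDerivAt hd]
    · have e2 : x ^ α = x * x ^ (α - 1) := by
        have e1 : α = 1 + (α - 1) := by ring
        nth_rw 1 [e1]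
        rw [Real.rpow_add hx, Real.rpow_one]
      simp only [Real.one_rpow]
      rw [e2]; ring
    · apply ContinuousOn.intervalIntegrable
      rw [Set.uIcc_of_le hx1]
      apply ContinuousOn.mul continuousOn_const
      apply ContinuousOn.mul (by fun_prop)
      apply ContinuousOn.rpow_const continuousOn_id
      intro t ht
      exact Or.inl (lt_of_lt_of_le hx ht.1).ne'

lemma aux_log (x : ℝ) (hx0 : 0 ≤ x) (hx1 : x ≤ 1) :
    ∫ t in (0:ℝ)..1, max (t - x) 0 * t ^ ((1:ℝ) - 2) = x * Real.log x + 1 - x := by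
  rw [aux_split 1 one_pos x hx0 hx1]
  rcases hx0.eq_or_lt with rfl | hx
  · have e : ∫ t in (0:ℝ)..1, (t - 0) * t ^ ((1:ℝ) - 2) = ∫ t in (0:ℝ)..1, (1:ℝ) := by
      apply intervalIntegral.integral_congr_ae
      refine Filter.Eventually.of_forall fun t ht => ?_
      rw [Set.uIoc_of_le zero_le_one] at ht
      have : (1:ℝ) - 2 = -1 := by norm_num
      rw [this, Real.rpow_neg_one, sub_zero, mul_inv_cancel₀ ht.1.ne']
    rw [e]; simp
  · have hd : ∀ t ∈ Set.uIcc x 1, HasDerivAt (fun t : ℝ => t - x * Real.log t)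
        ((t - x) * t ^ ((1:ℝ) - 2)) t := by
      intro t ht
      rw [Set.uIcc_of_le hx1] at ht
      have ht0 : 0 < t := lt_of_lt_of_le hx ht.1
      refine ((hasDerivAt_id t).sub ((Real.hasDerivAt_log ht0.ne').const_mul x)).congr_deriv ?_
      have : (1:ℝ) - 2 = -1 := by norm_num
      rw [this, Real.rpow_neg_one]
      field_simp
    rw [intervalIntegral.integral_eq_sub_of_hasDerivAt hd]
    · simp; ring
    · apply ContinuousOn.intervalIntegrable
      rw [Set.uIcc_of_le hx1]
      apply ContinuousOn.mul (by fun_prop)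
      apply ContinuousOn.rpow_const continuousOn_id
      intro t ht
      exact Or.inl (lt_of_lt_of_le hx ht.1).ne'

lemma aux_sign (α : ℝ) (t c : ℝ) (ht : 0 < t) (htc : t ≤ c) :
    (α - 1) * (t ^ (α - 1) - c ^ (α - 1)) ≤ 0 := by
  rcases le_total 1 α with h | h
  · have := Real.rpow_le_rpow ht.le htc (show 0 ≤ α - 1 by linarith)
    exact mul_nonpos_of_nonneg_of_nonpos (by linarith) (by linarith)
  · have := Real.rpow_le_rpow_of_nonpos ht htc (show α - 1 ≤ 0 by linarith)
    exact mul_nonpos_of_nonpos_of_nonneg (by linarith) (by linarith)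

lemma aux_main {n : ℕ} (α : ℝ) (hα : 0 < α) (p w : Fin n → ℝ) (hp : IsProbVec p)
    (hw : IsProbVec w) (hH : shannonEntropy w = shannonEntropy p)
    (hG : ∀ t₀ t₁ : ℝ, 0 < t₀ → t₀ < t₁ → t₁ ≤ 1 →
      ∑ i, max (t₀ - w i) 0 < ∑ i, max (t₀ - p i) 0 →
      ∑ i, max (t₁ - w i) 0 ≤ ∑ i, max (t₁ - p i) 0) :
    ∑ i, w i ^ α ≤ ∑ i, p i ^ α := by
  have hle : ∀ u : Fin n → ℝ, IsProbVec u → ∀ i, u i ≤ 1 := by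
    intro u hu i
    rw [← hu.2]
    exact Finset.single_le_sum (fun j _ => hu.1 j) (Finset.mem_univ i)
  set P : (Fin n → ℝ) → ℝ → ℝ := fun u t => ∑ i, max (t - u i) 0 with hP
  have hPint : ∀ β : ℝ, 0 < β → ∀ u : Fin n → ℝ, IsProbVec u →
      IntervalIntegrable (fun t => P u t * t ^ (β - 2)) volume 0 1 := by
    intro β hβ u hu
    simp only [hP, Finset.sum_mul]
    have := IntervalIntegrable.sum (μ := volume) (a := 0) (b := 1) Finset.univ
      (f := fun i (t : ℝ) => max (t - u i) 0 * t ^ (β - 2))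
      (fun i _ => aux_int β hβ (u i) (hu.1 i))
    have e : (fun t : ℝ => ∑ i, max (t - u i) 0 * t ^ (β - 2)) =
        ∑ i, fun t : ℝ => max (t - u i) 0 * t ^ (β - 2) := by
      ext t; simp
    rw [e]; exact this
  have hsum : ∀ β : ℝ, 0 < β → ∀ u : Fin n → ℝ, IsProbVec u →
      ∫ t in (0:ℝ)..1, P u t * t ^ (β - 2) =
        ∑ i, ∫ t in (0:ℝ)..1, max (t - u i) 0 * t ^ (β - 2) := by
    intro β hβ u hu
    simp only [hP, Finset.sum_mul]
    exact intervalIntegral.integral_finsetSum (fun i _ => aux_int β hβ (u i) (hu.1 i))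
  have hpow : ∀ u : Fin n → ℝ, IsProbVec u →
      α * (α - 1) * ∫ t in (0:ℝ)..1, P u t * t ^ (α - 2) = ∑ i, u i ^ α - n - α * (1 - n) := by
    intro u hu
    rw [hsum α hα u hu, Finset.mul_sum]
    simp_rw [fun i => aux_pow α hα (u i) (hu.1 i) (hle u hu i)]
    simp [Finset.sum_sub_distrib, ← Finset.mul_sum, hu.2]
  have hlog : ∀ u : Fin n → ℝ, IsProbVec u →
      ∫ t in (0:ℝ)..1, P u t * t ^ ((1:ℝ) - 2) = - shannonEntropy u + n - 1 := by
    intro u hu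
    rw [hsum 1 one_pos u hu]
    simp_rw [fun i => aux_log (u i) (hu.1 i) (hle u hu i)]
    simp [Finset.sum_sub_distrib, Finset.sum_add_distrib, hu.2, shannonEntropy]
  have hz : ∫ t in (0:ℝ)..1, (P p t - P w t) * t ^ ((1:ℝ) - 2) = 0 := by
    simp_rw [sub_mul]
    rw [intervalIntegral.integral_sub (hPint 1 one_pos p hp) (hPint 1 one_pos w hw),
      hlog p hp, hlog w hw, hH]
    ring
  have hzi : IntervalIntegrable (fun t => (P p t - P w t) * t ^ ((1:ℝ) - 2)) volume 0 1 := by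
    simp_rw [sub_mul]
    exact (hPint 1 one_pos p hp).sub (hPint 1 one_pos w hw)
  have hai : IntervalIntegrable (fun t => (P p t - P w t) * t ^ (α - 2)) volume 0 1 := by
    simp_rw [sub_mul]
    exact (hPint α hα p hp).sub (hPint α hα w hw)
  have ha : ∑ i, p i ^ α - ∑ i, w i ^ α =
      α * (α - 1) * ∫ t in (0:ℝ)..1, (P p t - P w t) * t ^ (α - 2) := by
    simp_rw [sub_mul]
    rw [intervalIntegral.integral_sub (hPint α hα p hp) (hPint α hα w hw), mul_sub,
      hpow p hp, hpow w hw]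
    ring
  have hpowt : ∀ t : ℝ, 0 < t → t ^ (α - 2) = t ^ (α - 1) * t ^ ((1:ℝ) - 2) := by
    intro t ht
    rw [← Real.rpow_add ht]
    congr 1; ring

  obtain ⟨c, hc0, hc1, hc2⟩ : ∃ c : ℝ, 0 ≤ c ∧ (∀ t, 0 < t → t < c → t ≤ 1 → P p t ≤ P w t) ∧
      (∀ t, 0 < t → c < t → t ≤ 1 → P w t ≤ P p t) := by
    by_cases hS : ∃ t : ℝ, 0 < t ∧ t ≤ 1 ∧ P w t < P p t
    · let S : Set ℝ := {t | 0 < t ∧ t ≤ 1 ∧ P w t < P p t}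
      have hb : BddBelow S := ⟨0, fun t ht => ht.1.le⟩
      refine ⟨sInf S, le_csInf hS fun t ht => ht.1.le, ?_, ?_⟩
      · intro t h0 h1 h2
        by_contra hcon
        exact absurd (csInf_le hb (show t ∈ S from ⟨h0, h2, not_le.1 hcon⟩)) (not_le.2 h1)
      · intro t h0 h1 h2
        obtain ⟨s, hs, hst⟩ := exists_lt_of_csInf_lt hS h1
        exact hG s t hs.1 hst h2 hs.2.2
    · push Not at hS
      exact ⟨1, zero_le_one, fun t h0 _ h1 => hS t h0 h1, fun t _ h1 h2 => absurd h2 (not_le.2 h1)⟩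
  have hfin : 0 ≤ ∑ i, p i ^ α - ∑ i, w i ^ α := by
    rcases hc0.eq_or_lt with rfl | hc
    · have hnn : ∀ t ∈ Set.Ioc (0:ℝ) 1, 0 ≤ (P p t - P w t) * t ^ ((1:ℝ) - 2) := fun t ht =>
        mul_nonneg (sub_nonneg.2 (hc2 t ht.1 ht.1 ht.2)) (Real.rpow_nonneg ht.1.le _)
      rw [intervalIntegral.integral_of_le zero_le_one] at hz
      have hzi' := (intervalIntegrable_iff_integrableOn_Ioc_of_le zero_le_one).1 hzi
      rw [integral_eq_zero_iff_of_nonneg_ae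
        ((ae_restrict_iff' measurableSet_Ioc).2 (Filter.Eventually.of_forall hnn)) hzi'] at hz
      have hz2 := (ae_restrict_iff' measurableSet_Ioc).1 hz
      have : ∫ t in (0:ℝ)..1, (P p t - P w t) * t ^ (α - 2) = ∫ t in (0:ℝ)..1, (0:ℝ) := by
        apply intervalIntegral.integral_congr_ae
        filter_upwards [hz2] with t h ht
        rw [Set.uIoc_of_le zero_le_one] at ht
        have h' := h ht
        simp only [Pi.zero_apply] at h'
        rw [hpowt t ht.1, mul_left_comm, h', mul_zero]
      rw [ha, this]; simp
    · have : ∑ i, p i ^ α - ∑ i, w i ^ α = ∫ t in (0:ℝ)..1,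
          (α * (α - 1) * ((P p t - P w t) * t ^ (α - 2)) -
            α * (α - 1) * c ^ (α - 1) * ((P p t - P w t) * t ^ ((1:ℝ) - 2))) := by
        rw [intervalIntegral.integral_sub (hai.const_mul _) (hzi.const_mul _),
          intervalIntegral.integral_const_mul, intervalIntegral.integral_const_mul, hz, ha]
        ring
      rw [this, intervalIntegral.integral_of_le zero_le_one]
      apply setIntegral_nonneg measurableSet_Ioc
      intro t ht
      rw [hpowt t ht.1]
      have e : α * (α - 1) * ((P p t - P w t) * (t ^ (α - 1) * t ^ ((1:ℝ) - 2))) -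
            α * (α - 1) * c ^ (α - 1) * ((P p t - P w t) * t ^ ((1:ℝ) - 2)) =
          (α * t ^ ((1:ℝ) - 2)) *
            (((α - 1) * (t ^ (α - 1) - c ^ (α - 1))) * (P p t - P w t)) := by ring
      rw [e]
      apply mul_nonneg (mul_nonneg hα.le (Real.rpow_nonneg ht.1.le _))
      rcases lt_trichotomy t c with h | h | h
      · have h1 := aux_sign α t c ht.1 h.le
        have h2 := hc1 t ht.1 h ht.2
        exact mul_nonneg_of_nonpos_of_nonpos h1 (by linarith)
      · rw [h]; simp
      · have h1 := aux_sign α c t hc h.le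
        have h2 := hc2 t ht.1 h ht.2
        exact mul_nonneg (by linarith) (by linarith)
  linarith

lemma lower_ge {n : ℕ} (u : Fin n → ℝ) (hu : ∑ i, u i = 1) (t : ℝ) :
    n * t - 1 ≤ ∑ i, max (t - u i) 0 := by
  have : ∑ i, (t - u i) = n * t - 1 := by simp [Finset.sum_sub_distrib, hu]
  rw [← this]
  exact Finset.sum_le_sum fun i _ => le_max_left _ _

lemma lower_eq {n : ℕ} (u : Fin n → ℝ) (hu : ∑ i, u i = 1) (t : ℝ) (h : ∀ i, u i ≤ t) :
    ∑ i, max (t - u i) 0 = n * t - 1 := by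
  have : ∑ i, (t - u i) = n * t - 1 := by simp [Finset.sum_sub_distrib, hu]
  rw [← this]
  exact Finset.sum_congr rfl fun i _ => max_eq_left (by linarith [h i])

lemma vVec_prob (n : ℕ) (hn : 2 ≤ n) (q : ℝ) (hq : q ∈ Set.Icc (0 : ℝ) (1 / (n : ℝ))) :
    IsProbVec (vVec n q) ∧ ∀ i, q ≤ vVec n q i := by
  have hn' : (2:ℝ) ≤ n := by exact_mod_cast hn
  have h1 : q * n ≤ 1 := by
    have := hq.2
    rwa [le_div_iff₀ (by linarith)] at this
  have h2 : ∀ i, q ≤ vVec n q i := by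
    intro i
    unfold vVec
    split_ifs
    · linarith
    · exact le_rfl
  refine ⟨⟨fun i => hq.1.trans (h2 i), ?_⟩, h2⟩
  obtain ⟨m, rfl⟩ : ∃ m, n = m + 1 := ⟨n - 1, by omega⟩
  rw [Fin.sum_univ_succ]
  simp [vVec]

lemma wVec_prob (n : ℕ) (hn : 2 ≤ n) (r : ℝ) (hr : r ∈ Set.Icc (1 / (n : ℝ)) 1) :
    IsProbVec (wVec n r) ∧ ∀ i, wVec n r i ≤ r := by
  have hn' : (2:ℝ) ≤ n := by exact_mod_cast hn
  have hr0 : 0 < r := lt_of_lt_of_le (by positivity) hr.1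
  have h1 : 1 ≤ r * n := by
    have := hr.1
    rwa [div_le_iff₀ (by linarith)] at this
  set k := ⌊1 / r⌋₊ with hk
  have hk1 : (k:ℝ) * r ≤ 1 := by
    have := Nat.floor_le (show 0 ≤ 1 / r by positivity)
    rwa [← hk, le_div_iff₀ hr0] at this
  have hk2 : 1 < ((k:ℝ) + 1) * r := by
    have := Nat.lt_floor_add_one (1 / r)
    rwa [← hk, div_lt_iff₀ hr0] at this
  have hkn : k ≤ n := by
    have : (k:ℝ) ≤ n := by
      by_contra hcon
      push Not at hcon
      nlinarith
    exact_mod_cast this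
  refine ⟨⟨?_, ?_⟩, ?_⟩
  · intro i
    unfold wVec
    rw [← hk]
    split_ifs <;> linarith
  · have e : ∀ i : Fin n, wVec n r i = (fun j : ℕ => (if j < k then r else 0) +
        (if j = k then 1 - (k:ℝ) * r else 0)) (i : ℕ) := by
      intro i
      unfold wVec
      rw [← hk]
      simp only
      split_ifs <;> first | omega | simp
    rw [Finset.sum_congr rfl fun i _ => e i, Fin.sum_univ_eq_sum_range (fun j : ℕ =>
      (if j < k then r else 0) + (if j = k then 1 - (k:ℝ) * r else 0)), Finset.sum_add_distrib,
      Finset.sum_ite_eq', ← Finset.sum_filter]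
    have e2 : (Finset.range n).filter (fun j => j < k) = Finset.range k := by
      ext j; simp; omega
    rw [e2]
    simp only [Finset.sum_const, Finset.card_range, nsmul_eq_mul, Finset.mem_range]
    split_ifs with h
    · ring
    · have : k = n := by omega
      rw [this] at hk1 ⊢
      linarith
  · intro i
    unfold wVec
    rw [← hk]
    split_ifs <;> linarith

lemma lip (a b x : ℝ) (h : a ≤ b) : max (b - x) 0 ≤ max (a - x) 0 + (b - a) := by
  rcases max_cases (a - x) 0 with h1 | h1 <;> rcases max_cases (b - x) 0 with h2 | h2 <;> linarith

lemma w_cross (n : ℕ) (hn : 2 ≤ n) (p : Fin n → ℝ) (hp : IsProbVec p)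
    (r : ℝ) (hr : r ∈ Set.Icc (1 / (n : ℝ)) 1) (t₀ t₁ : ℝ) (h0 : 0 < t₀) (h01 : t₀ < t₁)
    (h : ∑ i, max (t₀ - wVec n r i) 0 < ∑ i, max (t₀ - p i) 0) :
    ∑ i, max (t₁ - wVec n r i) 0 ≤ ∑ i, max (t₁ - p i) 0 := by
  obtain ⟨hw, hwr⟩ := wVec_prob n hn r hr
  rcases le_total r t₁ with h1 | h1
  · rw [lower_eq _ hw.2 t₁ fun i => (hwr i).trans h1]
    exact lower_ge p hp.2 t₁
  set k := ⌊1 / r⌋₊ with hk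
  set M := (Finset.univ.filter fun i : Fin n => p i < t₀).card with hM
  set A := (Finset.univ.filter fun i : Fin n => k ≤ (i:ℕ)).card with hA
  set B := (Finset.univ.filter fun i : Fin n => k < (i:ℕ)).card with hB
  have hAB : A ≤ B + 1 := by
    by_cases hkn : k < n
    · have : (Finset.univ.filter fun i : Fin n => k ≤ (i:ℕ)) ⊆
          insert ⟨k, hkn⟩ (Finset.univ.filter fun i : Fin n => k < (i:ℕ)) := by
        intro i hi
        simp only [Finset.mem_filter, Finset.mem_univ, true_and, Finset.mem_insert,
          Fin.ext_iff] at hi ⊢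
        omega
      exact (Finset.card_le_card this).trans (Finset.card_insert_le _ _)
    · have : (Finset.univ.filter fun i : Fin n => k ≤ (i:ℕ)) = ∅ := by
        apply Finset.filter_eq_empty_iff.2
        intro i _
        have := i.2
        omega
      rw [hA, this]; simp
  have hcard : ∀ (Q : Fin n → Prop) [DecidablePred Q] (x : ℝ),
      ((Finset.univ.filter Q).card : ℝ) * x = ∑ i, if Q i then x else 0 := by
    intro Q _ x
    rw [← Finset.sum_filter]; simp
  have hP0 : ∑ i, max (t₀ - p i) 0 ≤ M * t₀ := by
    rw [hM, hcard]
    apply Finset.sum_le_sum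
    intro i _
    split_ifs with hi
    · exact max_le (by linarith [hp.1 i]) h0.le
    · exact max_le (by linarith) le_rfl
  have hW0 : B * t₀ ≤ ∑ i, max (t₀ - wVec n r i) 0 := by
    rw [hB, hcard]
    apply Finset.sum_le_sum
    intro i _
    split_ifs with hi
    · have : wVec n r i = 0 := by
        unfold wVec
        rw [← hk, if_neg (by omega), if_neg (by omega)]
      rw [this, sub_zero]; exact le_max_left _ _
    · exact le_max_right _ _
  have hMB : B < M := by
    have : (B:ℝ) * t₀ < M * t₀ := by linarith
    exact_mod_cast lt_of_mul_lt_mul_right this h0.le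
  have hMA : (A:ℝ) ≤ M := by exact_mod_cast (by omega : A ≤ M)
  have hP1 : ∑ i, max (t₀ - p i) 0 + M * (t₁ - t₀) ≤ ∑ i, max (t₁ - p i) 0 := by
    rw [hM, hcard, ← Finset.sum_add_distrib]
    apply Finset.sum_le_sum
    intro i _
    split_ifs with hi
    · rw [max_eq_left (by linarith)]
      exact le_trans (by linarith) (le_max_left _ _)
    · rw [add_zero]
      exact max_le_max (by linarith) le_rfl
  have hW1 : ∑ i, max (t₁ - wVec n r i) 0 ≤ ∑ i, max (t₀ - wVec n r i) 0 + A * (t₁ - t₀) := by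
    rw [hA, hcard, ← Finset.sum_add_distrib]
    apply Finset.sum_le_sum
    intro i _
    split_ifs with hi
    · exact lip _ _ _ h01.le
    · have : wVec n r i = r := by
        unfold wVec
        rw [← hk, if_pos (by omega)]
      rw [this, add_zero]
      exact max_le (le_trans (by linarith) (le_max_right _ _)) (le_max_right _ _)
  nlinarith

lemma v_cross (n : ℕ) (hn : 2 ≤ n) (p : Fin n → ℝ) (hp : IsProbVec p)
    (q : ℝ) (hq : q ∈ Set.Icc (0 : ℝ) (1 / (n : ℝ))) (t₀ t₁ : ℝ) (h01 : t₀ < t₁)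
    (h : ∑ i, max (t₀ - p i) 0 < ∑ i, max (t₀ - vVec n q i) 0) :
    ∑ i, max (t₁ - p i) 0 ≤ ∑ i, max (t₁ - vVec n q i) 0 := by
  obtain ⟨hv, hvq⟩ := vVec_prob n hn q hq
  by_cases hall : ∀ i, p i ≤ t₁
  · rw [lower_eq p hp.2 t₁ hall]
    exact lower_ge _ hv.2 t₁
  push Not at hall
  obtain ⟨j, hj⟩ := hall
  have hq0 : q < t₀ := by
    by_contra hcon
    push Not at hcon
    have e : ∑ i, max (t₀ - vVec n q i) 0 = 0 :=
      Finset.sum_eq_zero fun i _ => max_eq_right (by linarith [hvq i])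
    rw [e] at h
    exact absurd (Finset.sum_nonneg fun i _ => le_max_right (t₀ - p i) 0) (not_le.2 h)
  let z : Fin n := ⟨0, by omega⟩
  have hs : ∀ j : Fin n, ∑ i : Fin n, (if i = j then 0 else (t₁ - t₀)) =
      (n - 1) * (t₁ - t₀) := by
    intro j
    have : ∀ i : Fin n, (if i = j then 0 else (t₁ - t₀)) =
        (t₁ - t₀) - (if i = j then (t₁ - t₀) else 0) := by
      intro i; split_ifs <;> ring
    rw [Finset.sum_congr rfl fun i _ => this i, Finset.sum_sub_distrib, Finset.sum_ite_eq']
    simp; ring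
  have hP : ∑ i, max (t₁ - p i) 0 ≤ ∑ i, max (t₀ - p i) 0 + (n - 1) * (t₁ - t₀) := by
    rw [← hs j, ← Finset.sum_add_distrib]
    apply Finset.sum_le_sum
    intro i _
    split_ifs with hi
    · rw [hi, add_zero]
      exact max_le (le_trans (by linarith) (le_max_right _ _)) (le_max_right _ _)
    · exact lip _ _ _ h01.le
  have hV : ∑ i, max (t₀ - vVec n q i) 0 + (n - 1) * (t₁ - t₀) ≤
      ∑ i, max (t₁ - vVec n q i) 0 := by
    rw [← hs z, ← Finset.sum_add_distrib]
    apply Finset.sum_le_sum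
    intro i _
    split_ifs with hi
    · rw [add_zero]
      exact max_le_max (by linarith) le_rfl
    · have : vVec n q i = q := by
        unfold vVec
        rw [if_neg]
        intro h'
        exact hi (Fin.ext h')
      rw [this, max_eq_left (by linarith)]
      exact le_trans (by linarith) (le_max_left _ _)
  linarith

theorem stmt0 (n : ℕ) (hn : 2 ≤ n) (α : ℝ) (hα : 0 < α)
    (p : Fin n → ℝ) (hp : IsProbVec p)
    (q : ℝ) (hq : q ∈ Set.Icc (0 : ℝ) (1 / (n : ℝ)))
    (hqH : shannonEntropy (vVec n q) = shannonEntropy p)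
    (r : ℝ) (hr : r ∈ Set.Icc (1 / (n : ℝ)) 1)
    (hrH : shannonEntropy (wVec n r) = shannonEntropy p) :
    lNorm α (wVec n r) ≤ lNorm α p ∧ lNorm α p ≤ lNorm α (vVec n q) := by
  have hw := (wVec_prob n hn r hr).1
  have hv := (vVec_prob n hn q hq).1
  have h1 := aux_main α hα p (wVec n r) hp hw hrH
    fun t₀ t₁ h0 h01 _ h => w_cross n hn p hp r hr t₀ t₁ h0 h01 h
  have h2 := aux_main α hα (vVec n q) p hv hp hqH.symm
    fun t₀ t₁ _ h01 _ h => v_cross n hn p hp q hq t₀ t₁ h01 h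
  refine ⟨?_, ?_⟩
  · exact Real.rpow_le_rpow (Finset.sum_nonneg fun i _ => Real.rpow_nonneg (hw.1 i) _) h1
      (by positivity)
  · exact Real.rpow_le_rpow (Finset.sum_nonneg fun i _ => Real.rpow_nonneg (hp.1 i) _) h2
      (by positivity)
end

section
/- Let n ≥ 2 be an integer, let α ∈ (0,1) ∪ (1,∞), let p ∈ 𝒫_n, and let q ∈ [0, 1/n] and r ∈ [1/n, 1] satisfy ‖v_n(q)‖_α = ‖p‖_α = ‖w_n(r)‖_α. If 0 < α < 1, then H(v_n(q)) ≤ H(p) ≤ H(w_n(r)); if α > 1, then H(w_n(r)) ≤ H(p) ≤ H(v_n(q)). -/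
open Real

theorem phi_sc (α : ℝ) (h0 : 0 < α) (h1 : α ≠ 1) :
    StrictConvexOn ℝ (Set.Ici 0) (fun x : ℝ => (α - 1) * x ^ α) := by
  rcases lt_or_gt_of_ne h1 with h | h
  · have := Real.strictConcaveOn_rpow h0 h
    refine ⟨this.1, fun x hx y hy hxy a b ha hb hab => ?_⟩
    have h3 := this.2 hx hy hxy ha hb hab
    simp only [smul_eq_mul] at h3 ⊢
    nlinarith
  · have := strictConvexOn_rpow h
    refine ⟨this.1, fun x hx y hy hxy a b ha hb hab => ?_⟩
    have h3 := this.2 hx hy hxy ha hb hab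
    simp only [smul_eq_mul] at h3 ⊢
    nlinarith

theorem phi_spread (α : ℝ) (h0 : 0 < α) (h1 : α ≠ 1) {z' z y y' : ℝ} (hz' : 0 ≤ z')
    (hz : z' < z) (hy : y < y') (hs : z' + y' = z + y) (hzy : z ≤ y) :
    (α - 1) * z ^ α + (α - 1) * y ^ α < (α - 1) * z' ^ α + (α - 1) * y' ^ α := by
  have H := phi_sc α h0 h1
  have hd : 0 < y' - z' := by linarith
  have hx1 : z' ∈ Set.Ici (0:ℝ) := hz'
  have hx2 : y' ∈ Set.Ici (0:ℝ) := by simp only [Set.mem_Ici]; linarith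
  have ha : 0 < (y' - z) / (y' - z') := div_pos (by linarith) hd
  have hb : 0 < (z - z') / (y' - z') := div_pos (by linarith) hd
  have hab : (y' - z) / (y' - z') + (z - z') / (y' - z') = 1 := by field_simp; ring
  have e1 := H.2 hx1 hx2 (by linarith) ha hb hab
  have e2 := H.2 hx1 hx2 (by linarith) hb ha (by linarith)
  simp only [smul_eq_mul] at e1 e2
  have i1 : (y' - z) / (y' - z') * z' + (z - z') / (y' - z') * y' = z := by field_simp; ring
  have i2 : (z - z') / (y' - z') * z' + (y' - z) / (y' - z') * y' = y := by
    have : y = z' + y' - z := by linarith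
    rw [this]; field_simp; ring
  rw [i1] at e1
  rw [i2] at e2
  have : (y' - z) / (y' - z') = 1 - (z - z') / (y' - z') := by linarith
  rw [this] at e1 e2
  nlinarith

theorem exp_pre {u1 u2 : ℝ} (h : u1 < u2) : ∃ b c : ℝ, ∀ u : ℝ,
    (u1 < u → u < u2 → 0 < u - b * exp u + c) ∧ (u < u1 → u - b * exp u + c < 0) ∧
    (u2 < u → u - b * exp u + c < 0) := by
  have hE : 0 < exp u2 - exp u1 := by
    have := exp_lt_exp.2 h; linarith
  refine ⟨(u2 - u1) / (exp u2 - exp u1), (u2 - u1) / (exp u2 - exp u1) * exp u1 - u1, fun u => ?_⟩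
  have key : u - (u2 - u1) / (exp u2 - exp u1) * exp u +
      ((u2 - u1) / (exp u2 - exp u1) * exp u1 - u1) =
      ((u - u1) * (exp u2 - exp u1) - (exp u - exp u1) * (u2 - u1)) / (exp u2 - exp u1) := by
    field_simp; ring
  rw [key]
  have sl : ∀ {x y z : ℝ}, x < y → y < z →
      (exp y - exp x) * (z - y) < (exp z - exp y) * (y - x) := by
    intro x y z hxy hyz
    have := strictConvexOn_exp.slope_strict_mono_adjacent (Set.mem_univ x) (Set.mem_univ z) hxy hyz
    rwa [div_lt_div_iff₀ (by linarith) (by linarith)] at this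
  refine ⟨fun a b => div_pos ?_ hE, fun a => div_neg_of_neg_of_pos ?_ hE,
    fun a => div_neg_of_neg_of_pos ?_ hE⟩
  · have := sl a b; nlinarith
  · have := sl a h; nlinarith
  · have := sl h a; nlinarith

theorem h_lem (α : ℝ) (h0 : 0 < α) (h1 : α ≠ 1) {t1 t2 : ℝ} (ht1 : 0 < t1) (ht : t1 < t2) :
    ∃ a b : ℝ, ∃ h : ℝ → ℝ,
      (∀ x, h x = (α - 1) * (x * log x) - a * x - b * ((α - 1) * x ^ α)) ∧
      StrictAntiOn h (Set.Icc 0 t1) ∧ StrictMonoOn h (Set.Icc t1 t2) ∧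
      StrictAntiOn h (Set.Ici t2) := by
  have hα1 : α - 1 ≠ 0 := sub_ne_zero.2 h1
  obtain ⟨b, c, hbc⟩ : ∃ b c : ℝ, ∀ t : ℝ, 0 < t →
      (t1 < t → t < t2 → 0 < (α - 1) * log t - b * t ^ (α - 1) + c) ∧
      (t < t1 → (α - 1) * log t - b * t ^ (α - 1) + c < 0) ∧
      (t2 < t → (α - 1) * log t - b * t ^ (α - 1) + c < 0) := by
    have hl := Real.log_lt_log ht1 ht
    have hrp : ∀ t : ℝ, 0 < t → t ^ (α - 1) = exp ((α - 1) * log t) := by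
      intro t h; rw [Real.rpow_def_of_pos h, mul_comm]
    rcases lt_or_gt_of_ne h1 with h | h
    · obtain ⟨b, c, H⟩ := exp_pre (u1 := (α - 1) * log t2) (u2 := (α - 1) * log t1) (by nlinarith)
      refine ⟨b, c, fun t htp => ?_⟩
      rw [hrp t htp]
      obtain ⟨H1, H2, H3⟩ := H ((α - 1) * log t)
      refine ⟨fun p q => H1 ?_ ?_, fun p => H3 ?_, fun p => H2 ?_⟩
      · have := Real.log_lt_log htp q; nlinarith
      · have := Real.log_lt_log ht1 p; nlinarith
      · have := Real.log_lt_log htp p; nlinarith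
      · have := Real.log_lt_log (ht1.trans ht) p; nlinarith
    · obtain ⟨b, c, H⟩ := exp_pre (u1 := (α - 1) * log t1) (u2 := (α - 1) * log t2) (by nlinarith)
      refine ⟨b, c, fun t htp => ?_⟩
      rw [hrp t htp]
      obtain ⟨H1, H2, H3⟩ := H ((α - 1) * log t)
      refine ⟨fun p q => H1 ?_ ?_, fun p => H2 ?_, fun p => H3 ?_⟩
      · have := Real.log_lt_log ht1 p; nlinarith
      · have := Real.log_lt_log htp q; nlinarith
      · have := Real.log_lt_log htp p; nlinarith
      · have := Real.log_lt_log (ht1.trans ht) p; nlinarith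
  set h : ℝ → ℝ := fun x => (α - 1) * (x * log x) - ((α - 1) - c) * x -
    (b / (α * (α - 1))) * ((α - 1) * x ^ α) with hdef
  have hc : Continuous h := by
    have e1 := Real.continuous_mul_log
    have e2 : Continuous fun x : ℝ => x ^ α := Real.continuous_rpow_const h0.le
    fun_prop
  have hd : ∀ t, 0 < t → HasDerivAt h ((α - 1) * log t - b * t ^ (α - 1) + c) t := by
    intro t htp
    have d1 := (Real.hasDerivAt_mul_log htp.ne').const_mul (α - 1)
    have d2 := (hasDerivAt_id t).const_mul ((α - 1) - c)
    have d3 := ((Real.hasDerivAt_rpow_const (x := t) (p := α) (Or.inl htp.ne')).const_mul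
      (α - 1)).const_mul (b / (α * (α - 1)))
    refine ((d1.sub d2).sub d3).congr_deriv ?_
    field_simp
    ring
  refine ⟨(α - 1) - c, b / (α * (α - 1)), h, fun x => rfl, ?_, ?_, ?_⟩
  · apply strictAntiOn_of_deriv_neg (convex_Icc _ _) hc.continuousOn
    intro x hx
    rw [interior_Icc] at hx
    rw [(hd x hx.1).deriv]
    exact (hbc x hx.1).2.1 hx.2
  · apply strictMonoOn_of_deriv_pos (convex_Icc _ _) hc.continuousOn
    intro x hx
    rw [interior_Icc] at hx
    rw [(hd x (ht1.trans hx.1)).deriv]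
    exact (hbc x (ht1.trans hx.1)).1 hx.1 hx.2
  · apply strictAntiOn_of_deriv_neg (convex_Ici _) hc.continuousOn
    intro x hx
    rw [interior_Ici] at hx
    have : 0 < x := (ht1.trans ht).trans hx
    rw [(hd x this).deriv]
    exact (hbc x this).2.2 hx

theorem g_lem (α : ℝ) (h0 : 0 < α) (h1 : α ≠ 1) (k : ℝ) (hk : 0 < k) :
    StrictAntiOn (fun r : ℝ => k * ((α - 1) * r ^ α) + (α - 1) * (1 - k * r) ^ α)
      (Set.Icc 0 (1 / (k + 1))) ∧
    StrictMonoOn (fun r : ℝ => k * ((α - 1) * r ^ α) + (α - 1) * (1 - k * r) ^ α)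
      (Set.Icc (1 / (k + 1)) (1 / k)) := by
  have hc : Continuous (fun r : ℝ => k * ((α - 1) * r ^ α) + (α - 1) * (1 - k * r) ^ α) := by
    have e2 : Continuous fun x : ℝ => x ^ α := Real.continuous_rpow_const h0.le
    have e3 : Continuous fun x : ℝ => (1 - k * x) ^ α := e2.comp (by fun_prop)
    fun_prop
  have hd : ∀ r, 0 < r → 0 < 1 - k * r →
      HasDerivAt (fun r : ℝ => k * ((α - 1) * r ^ α) + (α - 1) * (1 - k * r) ^ α)
        (k * α * ((α - 1) * (r ^ (α - 1) - (1 - k * r) ^ (α - 1)))) r := by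
    intro r hr hr2
    have d1 := ((Real.hasDerivAt_rpow_const (x := r) (p := α) (Or.inl hr.ne')).const_mul
      (α - 1)).const_mul k
    have d0 : HasDerivAt (fun r : ℝ => 1 - k * r) (-k) r := by
      simpa using ((hasDerivAt_id r).const_mul k).const_sub 1
    have d2 := (d0.rpow_const (p := α) (Or.inl hr2.ne')).const_mul (α - 1)
    refine (d1.add d2).congr_deriv ?_
    ring
  have sg : ∀ a b : ℝ, 0 < a → a < b → 0 < (α - 1) * (b ^ (α - 1) - a ^ (α - 1)) := by
    intro a b ha hab
    rcases lt_or_gt_of_ne h1 with h | h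
    · have := Real.rpow_lt_rpow_of_neg ha hab (z := α - 1) (by linarith)
      nlinarith
    · have := Real.rpow_lt_rpow ha.le hab (z := α - 1) (by linarith)
      nlinarith
  constructor
  · apply strictAntiOn_of_deriv_neg (convex_Icc _ _) hc.continuousOn
    intro x hx
    rw [interior_Icc] at hx
    have h2 := hx.2
    rw [lt_div_iff₀ (by linarith)] at h2
    have hx1 := hx.1
    rw [(hd x hx.1 (by nlinarith)).deriv]
    have := sg x (1 - k * x) hx.1 (by nlinarith)
    have h5 : 0 < k * α := by positivity
    nlinarith
  · apply strictMonoOn_of_deriv_pos (convex_Icc _ _) hc.continuousOn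
    intro x hx
    rw [interior_Icc] at hx
    have h2 := hx.2
    rw [lt_div_iff₀ (by linarith)] at h2
    have h3 := hx.1
    rw [div_lt_iff₀ (by linarith)] at h3
    have hx0 : 0 < x := lt_trans (by positivity) hx.1
    rw [(hd x hx0 (by nlinarith)).deriv]
    have := sg (1 - k * x) x (by nlinarith) (by nlinarith)
    have h5 : 0 < k * α := by positivity
    positivity

theorem triple (α : ℝ) (h0 : 0 < α) (h1 : α ≠ 1) {x y z : ℝ} (hxy : y < x) (hyz : z ≤ y)
    (hz : 0 < z) : ∃ x' y' z' : ℝ, 0 ≤ x' ∧ 0 ≤ y' ∧ 0 ≤ z' ∧ x' + y' + z' = x + y + z ∧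
      x' ^ α + y' ^ α + z' ^ α = x ^ α + y ^ α + z ^ α ∧
      (α - 1) * (x * log x) + (α - 1) * (y * log y) + (α - 1) * (z * log z) <
      (α - 1) * (x' * log x') + (α - 1) * (y' * log y') + (α - 1) * (z' * log z') := by
  have e2 : Continuous fun x : ℝ => x ^ α := Real.continuous_rpow_const h0.le
  have hα1 : α - 1 ≠ 0 := sub_ne_zero.2 h1
  obtain ⟨ε, hε, hεz, hεx, hD⟩ : ∃ ε : ℝ, 0 < ε ∧ ε < z ∧ ε < x - y ∧
      (α - 1) * ((x + y + ε) / 2) ^ α + (α - 1) * ((x + y + ε) / 2) ^ α + (α - 1) * (z - ε) ^ α <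
      (α - 1) * x ^ α + (α - 1) * y ^ α + (α - 1) * z ^ α := by
    have hcD : Continuous (fun ε : ℝ => (α - 1) * ((x + y + ε) / 2) ^ α +
        (α - 1) * ((x + y + ε) / 2) ^ α + (α - 1) * (z - ε) ^ α) := by
      have e3 : Continuous fun ε : ℝ => ((x + y + ε) / 2) ^ α := e2.comp (by fun_prop)
      have e4 : Continuous fun ε : ℝ => (z - ε) ^ α := e2.comp (by fun_prop)
      fun_prop
    have hD0 : (α - 1) * ((x + y + 0) / 2) ^ α +
        (α - 1) * ((x + y + 0) / 2) ^ α + (α - 1) * (z - 0) ^ α <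
        (α - 1) * x ^ α + (α - 1) * y ^ α + (α - 1) * z ^ α := by
      have := phi_spread α h0 h1 (z' := y) (z := (x + y) / 2) (y := (x + y) / 2) (y' := x)
        (by linarith) (by linarith) (by linarith) (by ring) le_rfl
      simp only [add_zero, sub_zero]
      linarith
    have ev := hcD.continuousAt.eventually (gt_mem_nhds hD0)
    have ev2 := ev.filter_mono (nhdsWithin_le_nhds (s := Set.Ioi (0:ℝ)))
    have ev3 : ∀ᶠ ε in nhdsWithin (0:ℝ) (Set.Ioi 0), ε ∈ Set.Ioo 0 (min z (x - y)) :=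
      Ioo_mem_nhdsGT (lt_min hz (by linarith))
    obtain ⟨ε, hε1, hε2⟩ := (ev2.and ev3).exists
    exact ⟨ε, hε2.1, hε2.2.trans_le (min_le_left _ _), hε2.2.trans_le (min_le_right _ _), hε1⟩
  have hU := phi_spread α h0 h1 (z' := z - ε) (z := z) (y := y) (y' := y + ε) (by linarith)
    (by linarith) (by linarith) (by ring) hyz
  have hcf : Continuous (fun t : ℝ => (α - 1) * t ^ α + (α - 1) * (x + y + ε - t) ^ α +
      (α - 1) * (z - ε) ^ α) := by
    have e3 : Continuous fun t : ℝ => (x + y + ε - t) ^ α := e2.comp (by fun_prop)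
    fun_prop
  have iv := intermediate_value_Icc (a := (x + y + ε) / 2) (b := x) (by linarith) hcf.continuousOn
  have q1 : x + y + ε - (x + y + ε) / 2 = (x + y + ε) / 2 := by ring
  have q2 : x + y + ε - x = y + ε := by ring
  obtain ⟨t, ht, hft⟩ := iv (show (α - 1) * x ^ α + (α - 1) * y ^ α + (α - 1) * z ^ α ∈ _ by
    simp only [q1, q2]
    constructor <;> linarith)
  simp only at hft
  have htx : t < x := by
    refine lt_of_le_of_ne ht.2 ?_
    rintro rfl
    rw [q2] at hft
    linarith
  have ht1 := ht.1
  refine ⟨t, x + y + ε - t, z - ε, by linarith, by linarith, by linarith, by ring, ?_, ?_⟩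
  · have : (α - 1) * (t ^ α + (x + y + ε - t) ^ α + (z - ε) ^ α) =
      (α - 1) * (x ^ α + y ^ α + z ^ α) := by linarith
    exact mul_left_cancel₀ hα1 this
  · obtain ⟨a, b, h, hh, ha1, hm, ha2⟩ := h_lem α h0 h1 (t1 := y) (t2 := t) (by linarith)
      (by linarith)
    have i1 := ha1 (a := z - ε) (b := z) ⟨by linarith, by linarith⟩ ⟨hz.le, hyz⟩ (by linarith)
    have i2 := hm (a := y) (b := x + y + ε - t) ⟨le_rfl, by linarith⟩ ⟨by linarith, by linarith⟩
      (by linarith)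
    have i3 := ha2 (a := t) (b := x) (by simp) htx.le htx
    simp only [hh] at i1 i2 i3
    have hft' := congrArg (fun s => b * s) hft
    simp only [mul_add] at hft'
    linarith

/-- power-sum/entropy functional of `w` -/
noncomputable def Wsum (f : ℝ → ℝ) (r : ℝ) : ℝ :=
  (⌊1 / r⌋₊ : ℝ) * f r + f (1 - (⌊1 / r⌋₊ : ℝ) * r)

theorem Wmono (α : ℝ) (h0 : 0 < α) (h1 : α ≠ 1) {r r' : ℝ} (hr : 0 < r) (hrr : r < r')
    (hr1 : r' ≤ 1) :
    Wsum (fun x => (α - 1) * x ^ α) r < Wsum (fun x => (α - 1) * x ^ α) r' := by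
  unfold Wsum
  have fl : ∀ s : ℝ, 0 < s → s ≤ 1 → 1 ≤ ⌊1 / s⌋₊ ∧ 1 / ((⌊1 / s⌋₊ : ℝ) + 1) < s ∧
      s ≤ 1 / (⌊1 / s⌋₊ : ℝ) := by
    intro s hs hs1
    have a1 : 1 ≤ ⌊1 / s⌋₊ := Nat.le_floor (by rw [Nat.cast_one, le_div_iff₀ hs]; linarith)
    have a1' : (0:ℝ) < (⌊1 / s⌋₊ : ℝ) := by exact_mod_cast a1
    have a2 := Nat.lt_floor_add_one (1 / s)
    have a3 := Nat.floor_le (a := 1 / s) (by positivity)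
    refine ⟨a1, ?_, ?_⟩
    · rw [div_lt_iff₀ (by positivity)]; rw [div_lt_iff₀ hs] at a2; linarith
    · rw [le_div_iff₀ a1']; rw [le_div_iff₀ hs] at a3; linarith
  have hr' : 0 < r' := hr.trans hrr
  obtain ⟨k1, k2, k3⟩ := fl r hr (by linarith)
  obtain ⟨l1, l2, l3⟩ := fl r' hr' hr1
  have hkl : ⌊1 / r'⌋₊ ≤ ⌊1 / r⌋₊ := Nat.floor_mono (by
    apply one_div_le_one_div_of_le hr hrr.le)
  generalize ⌊1 / r⌋₊ = k at *
  generalize ⌊1 / r'⌋₊ = l at *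
  have k1' : (1:ℝ) ≤ k := by exact_mod_cast k1
  have l1' : (1:ℝ) ≤ l := by exact_mod_cast l1
  have gk := (g_lem α h0 h1 k (by linarith)).2
  have gl := (g_lem α h0 h1 l (by linarith)).2
  rcases hkl.eq_or_lt with h | h
  · subst h
    exact gk ⟨k2.le, k3⟩ ⟨l2.le, l3⟩ hrr
  · have hlk : (l:ℝ) + 1 ≤ k := by exact_mod_cast h
    have mk := gk.monotoneOn ⟨k2.le, k3⟩
      (⟨one_div_le_one_div_of_le (by linarith) (by linarith), le_rfl⟩ : (1 / (k:ℝ)) ∈ Set.Icc (1 / ((k:ℝ) + 1)) (1 / (k:ℝ))) k3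
    have ml := gl (⟨le_rfl, one_div_le_one_div_of_le (by linarith) (by linarith)⟩ :
      (1 / ((l:ℝ) + 1)) ∈ Set.Icc (1 / ((l:ℝ) + 1)) (1 / (l:ℝ))) ⟨l2.le, l3⟩ l2
    simp only at mk ml
    have z1 : 1 - (k:ℝ) * (1 / k) = 0 := by
      have : (k:ℝ) ≠ 0 := by linarith
      field_simp; ring
    have z2 : 1 - (l:ℝ) * (1 / (l + 1)) = 1 / (l + 1) := by
      have : (l:ℝ) + 1 ≠ 0 := by linarith
      field_simp; ring
    rw [z1, Real.zero_rpow h0.ne'] at mk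
    rw [z2] at ml
    have pw : ∀ m : ℝ, 0 < m → m * (1 / m) ^ α = m ^ (1 - α) := by
      intro m hm
      rw [one_div, Real.inv_rpow hm.le, Real.rpow_sub hm, Real.rpow_one]; rfl
    have cmp : (α - 1) * (k:ℝ) ^ (1 - α) ≤ (α - 1) * ((l:ℝ) + 1) ^ (1 - α) := by
      rcases lt_or_gt_of_ne h1 with h | h
      · have := Real.rpow_le_rpow (z := 1 - α) (by linarith) hlk (by linarith)
        nlinarith
      · have := Real.rpow_le_rpow_of_nonpos (z := 1 - α) (by linarith) hlk (by linarith)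
        nlinarith
    rw [← pw _ (by linarith), ← pw _ (by linarith)] at cmp
    linarith

theorem wVec_sum (n : ℕ) (hn : 2 ≤ n) (r : ℝ) (hr : r ∈ Set.Icc (1 / (n : ℝ)) 1) (f : ℝ → ℝ)
    (hf : f 0 = 0) : ∑ i, f (wVec n r i) = Wsum f r := by
  have hn0 : (0:ℝ) < n := by positivity
  have hr0 : 0 < r := lt_of_lt_of_le (by positivity) hr.1
  have hle : ⌊1 / r⌋₊ ≤ n := by
    apply Nat.floor_le_of_le
    rw [div_le_iff₀ hr0]
    have := hr.1
    rw [div_le_iff₀ hn0] at this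
    linarith
  have hk : (⌊1 / r⌋₊ : ℝ) = n → 1 - (⌊1 / r⌋₊ : ℝ) * r = 0 := by
    intro h
    have h1 := Nat.floor_le (a := 1 / r) (by positivity)
    rw [h, le_div_iff₀ hr0] at h1
    have := hr.1
    rw [div_le_iff₀ hn0] at this
    rw [h]; linarith
  unfold Wsum wVec
  generalize ⌊1 / r⌋₊ = k at *
  rw [Fin.sum_univ_eq_sum_range (fun i => f (if i < k then r else if i = k then 1 - (k:ℝ) * r else 0)) n]
  obtain ⟨m, rfl⟩ := Nat.exists_eq_add_of_le hle
  rw [Finset.sum_range_add]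
  have s1 : ∑ x ∈ Finset.range k, f (if x < k then r else if x = k then 1 - (k:ℝ) * r else 0)
      = k * f r := by
    rw [Finset.sum_congr rfl (g := fun _ => f r)]
    · simp
    · intro x hx
      rw [if_pos (Finset.mem_range.1 hx)]
  rw [s1]
  congr 1
  rcases m with _ | m
  · rw [hk (by simp)]; simp [hf]
  · rw [Finset.sum_range_succ']
    simp [hf]

theorem wform (n : ℕ) (p : Fin n → ℝ) (hp : IsProbVec p)
    (ht : ∀ i j l : Fin n, j ≠ l → p j < p i → p l ≤ p j → ¬ 0 < p l) :
    ∃ r, 0 < r ∧ r ≤ 1 ∧ ∀ f : ℝ → ℝ, f 0 = 0 → ∑ i, f (p i) = Wsum f r := by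
  classical
  have hne : Nonempty (Fin n) := by
    by_contra h
    rw [not_nonempty_iff] at h
    have := hp.2
    simp at this
  obtain ⟨i0, hi0⟩ := Finite.exists_max p
  have hr0 : 0 < p i0 := by
    by_contra h
    have : ∑ i, p i ≤ 0 := Finset.sum_nonpos fun i _ => (hi0 i).trans (not_lt.1 h)
    linarith [hp.2]
  have hr1 : p i0 ≤ 1 := by
    rw [← hp.2]; exact Finset.single_le_sum (fun i _ => hp.1 i) (Finset.mem_univ i0)
  obtain ⟨s, hs0, hs1, hs⟩ : ∃ s : ℝ, 0 ≤ s ∧ s < p i0 ∧ ∀ f : ℝ → ℝ, f 0 = 0 →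
      ∑ i, f (p i) = ((Finset.univ.filter fun i => p i = p i0).card : ℝ) * f (p i0) + f s := by
    have split : ∀ f : ℝ → ℝ, ∑ i, f (p i) =
        ((Finset.univ.filter fun i => p i = p i0).card : ℝ) * f (p i0) +
        ∑ i ∈ Finset.univ.filter (fun i => ¬ p i = p i0), f (p i) := by
      intro f
      rw [← Finset.sum_filter_add_sum_filter_not Finset.univ (fun i => p i = p i0)]
      congr 1
      rw [Finset.sum_congr rfl (g := fun _ => f (p i0))]
      · simp
      · intro x hx; rw [(Finset.mem_filter.1 hx).2]
    by_cases hex : ∃ j, 0 < p j ∧ p j ≠ p i0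
    · obtain ⟨j, hj0, hj1⟩ := hex
      refine ⟨p j, hj0.le, lt_of_le_of_ne (hi0 j) hj1, fun f hf => ?_⟩
      rw [split f]
      congr 1
      apply Finset.sum_eq_single j
      · intro b hb hbj
        have hb1 := lt_of_le_of_ne (hi0 b) (Finset.mem_filter.1 hb).2
        have hj2 := lt_of_le_of_ne (hi0 j) hj1
        have : p b = 0 := by
          by_contra hb0
          have hb0 := lt_of_le_of_ne (hp.1 b) (Ne.symm hb0)
          rcases le_total (p b) (p j) with h | h
          · exact ht i0 j b hbj.symm hj2 h hb0
          · exact ht i0 b j hbj hb1 h hj0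
        rw [this, hf]
      · intro h; exact (h (Finset.mem_filter.2 ⟨Finset.mem_univ _, hj1⟩)).elim
    · push Not at hex
      refine ⟨0, le_rfl, hr0, fun f hf => ?_⟩
      rw [split f, hf]
      congr 1
      apply Finset.sum_eq_zero
      intro b hb
      have : p b = 0 := by
        by_contra hb0
        exact (Finset.mem_filter.1 hb).2 (hex b (lt_of_le_of_ne (hp.1 b) (Ne.symm hb0)))
      rw [this, hf]
  refine ⟨p i0, hr0, hr1, fun f hf => ?_⟩
  have hid := hs id rfl
  simp only [id] at hid
  rw [hp.2] at hid
  generalize (Finset.univ.filter fun i => p i = p i0).card = k at *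
  have hfl : ⌊1 / p i0⌋₊ = k := by
    rw [Nat.floor_eq_iff (by positivity)]
    constructor
    · rw [le_div_iff₀ hr0]; linarith
    · rw [div_lt_iff₀ hr0]; linarith
  rw [hs f hf, Wsum, hfl]
  congr 2
  linarith

theorem w_part (n : ℕ) (hn : 2 ≤ n) (α : ℝ) (h0 : 0 < α) (h1 : α ≠ 1)
    (p : Fin n → ℝ) (hp : IsProbVec p) (r : ℝ) (hr : r ∈ Set.Icc (1 / (n : ℝ)) 1)
    (hS : ∑ i, wVec n r i ^ α = ∑ i, p i ^ α) :
    ∑ i, (α - 1) * (p i * log (p i)) ≤ ∑ i, (α - 1) * (wVec n r i * log (wVec n r i)) := by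
  classical
  have hr0 : 0 < r := lt_of_lt_of_le (by positivity) hr.1
  set K : Set (Fin n → ℝ) := {x | (∀ i, 0 ≤ x i) ∧ ∑ i, x i = 1 ∧ ∑ i, x i ^ α = ∑ i, p i ^ α}
    with hK
  have e2 : Continuous fun x : ℝ => x ^ α := Real.continuous_rpow_const h0.le
  have hclosed : IsClosed K := by
    have c1 : IsClosed {x : Fin n → ℝ | ∀ i, 0 ≤ x i} := by
      simp only [Set.ofPred_forall]
      exact isClosed_iInter fun i => isClosed_le continuous_const (continuous_apply i)
    have c2 : IsClosed {x : Fin n → ℝ | ∑ i, x i = 1} :=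
      isClosed_eq (by fun_prop) continuous_const
    have c3 : IsClosed {x : Fin n → ℝ | ∑ i, x i ^ α = ∑ i, p i ^ α} :=
      isClosed_eq (continuous_finsetSum _ fun i _ => e2.comp (continuous_apply i))
        continuous_const
    exact c1.inter (c2.inter c3)
  have hcomp : IsCompact K := by
    refine (isCompact_Icc (a := (0 : Fin n → ℝ)) (b := 1)).of_isClosed_subset hclosed ?_
    rintro x ⟨hx0, hx1, -⟩
    refine ⟨hx0, fun i => ?_⟩
    show x i ≤ 1
    rw [← hx1]; exact Finset.single_le_sum (fun i _ => hx0 i) (Finset.mem_univ i)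
  have hcont : Continuous fun x : Fin n → ℝ => ∑ i, (α - 1) * (x i * log (x i)) :=
    continuous_finsetSum _ fun i _ =>
      (Real.continuous_mul_log.comp (continuous_apply i)).const_mul (α - 1)
  obtain ⟨x, ⟨hx0, hx1, hxS⟩, hmax⟩ := hcomp.exists_isMaxOn ⟨p, hp.1, hp.2, rfl⟩ hcont.continuousOn
  have hpx := hmax (show p ∈ K from ⟨hp.1, hp.2, rfl⟩)
  simp only [Set.mem_ofPred_eq] at hpx
  refine hpx.trans (le_of_eq ?_)
  obtain ⟨r', hr'0, hr'1, hf⟩ := wform n x ⟨hx0, hx1⟩ (by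
    intro i j l hjl hij hlj hl
    have hil : i ≠ l := by rintro rfl; linarith
    have hijn : i ≠ j := by rintro rfl; exact lt_irrefl _ hij
    obtain ⟨a, b, c, ha, hb, hc, s1, s2, s3⟩ := triple α h0 h1 hij hlj hl
    set y : Fin n → ℝ := fun t => if t = i then a else if t = j then b else if t = l then c else x t
      with hy
    have yi : y i = a := by simp [hy]
    have yj : y j = b := by simp [hy, hijn.symm]
    have yl : y l = c := by simp [hy, hil.symm, hjl.symm]
    have yt : ∀ t, t ≠ i → t ≠ j → t ≠ l → y t = x t := by
      intro t h1 h2 h3; simp [hy, h1, h2, h3]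
    have sp : ∀ (g : Fin n → ℝ), ∑ t, g t = g i + g j + g l +
        ∑ t ∈ ((Finset.univ.erase i).erase j).erase l, g t := by
      intro g
      rw [← Finset.add_sum_erase Finset.univ g (Finset.mem_univ i),
        ← Finset.add_sum_erase _ g (show j ∈ Finset.univ.erase i by simp [hijn.symm]),
        ← Finset.add_sum_erase _ g (show l ∈ (Finset.univ.erase i).erase j by
          simp [hil.symm, hjl.symm])]
      ring
    have rest : ∀ f : ℝ → ℝ, ∑ t ∈ ((Finset.univ.erase i).erase j).erase l, f (y t) =
        ∑ t ∈ ((Finset.univ.erase i).erase j).erase l, f (x t) := by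
      intro f
      refine Finset.sum_congr rfl fun t ht => ?_
      simp only [Finset.mem_erase, Finset.mem_univ, and_true] at ht
      rw [yt t ht.2.2 ht.2.1 ht.1]
    have dif : ∀ f : ℝ → ℝ, ∑ t, f (y t) = ∑ t, f (x t) + (f a + f b + f c) -
        (f (x i) + f (x j) + f (x l)) := by
      intro f
      rw [sp fun t => f (y t), sp fun t => f (x t), rest f, yi, yj, yl]; ring
    have hyK : y ∈ K := by
      refine ⟨fun t => ?_, ?_, ?_⟩
      · simp only [hy]
        split_ifs <;> first | assumption | exact hx0 t
      · have := dif id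
        simp only [id] at this
        linarith
      · have := dif fun t => t ^ α
        linarith
    have h3 := hmax hyK
    simp only [Set.mem_ofPred_eq] at h3
    rw [dif fun t => (α - 1) * (t * log t)] at h3
    simp only at h3
    linarith)
  have hphi0 : (α - 1) * (0:ℝ) ^ α = 0 := by rw [Real.zero_rpow h0.ne', mul_zero]
  have hx := hf (fun t => (α - 1) * t ^ α) hphi0
  have hw := wVec_sum n hn r hr (fun t => (α - 1) * t ^ α) hphi0
  have hWeq : Wsum (fun t => (α - 1) * t ^ α) r = Wsum (fun t => (α - 1) * t ^ α) r' := by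
    rw [← hx, ← hw]
    rw [← Finset.mul_sum, ← Finset.mul_sum, hS, hxS]
  have hrr : r = r' := by
    rcases lt_trichotomy r r' with h | h | h
    · exact absurd hWeq (Wmono α h0 h1 hr0 h hr'1).ne
    · exact h
    · exact absurd hWeq (Wmono α h0 h1 hr'0 h hr.2).ne'
  rw [hf (fun t => (α - 1) * (t * log t)) (by simp),
    wVec_sum n hn r hr (fun t => (α - 1) * (t * log t)) (by simp), hrr]

theorem vVec_sum (n : ℕ) (hn : 2 ≤ n) (q : ℝ) (f : ℝ → ℝ) :
    ∑ i, f (vVec n q i) = ((n:ℝ) - 1) * f q + f (1 - ((n:ℝ) - 1) * q) := by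
  obtain ⟨m, rfl⟩ : ∃ m, n = m + 1 := ⟨n - 1, by omega⟩
  rw [Fin.sum_univ_succ]
  simp [vVec]
  ring

theorem v_part (n : ℕ) (hn : 2 ≤ n) (α : ℝ) (h0 : 0 < α) (h1 : α ≠ 1)
    (p : Fin n → ℝ) (hp : IsProbVec p) (q : ℝ) (hq : q ∈ Set.Icc 0 (1 / (n : ℝ)))
    (hS : ∑ i, vVec n q i ^ α = ∑ i, p i ^ α) :
    ∑ i, (α - 1) * (vVec n q i * log (vVec n q i)) ≤ ∑ i, (α - 1) * (p i * log (p i)) := by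
  classical
  have hα1 : α - 1 ≠ 0 := sub_ne_zero.2 h1
  have hn2 : (2:ℝ) ≤ n := by exact_mod_cast hn
  have hp1 : ∀ i, p i ≤ 1 := fun i => by
    rw [← hp.2]; exact Finset.single_le_sum (fun i _ => hp.1 i) (Finset.mem_univ i)
  rw [vVec_sum n hn q fun t => (α - 1) * (t * log t)]
  rw [vVec_sum n hn q fun t => t ^ α] at hS
  try simp only at hS ⊢
  rcases hq.1.eq_or_lt with hq0 | hq0
  · -- degenerate case
    subst hq0
    simp only [mul_zero, sub_zero, Real.zero_rpow h0.ne', Real.one_rpow, zero_add, zero_mul,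
      Real.log_one] at hS ⊢
    have nn : ∀ i ∈ Finset.univ, 0 ≤ (α - 1) * (p i - p i ^ α) := by
      intro i _
      rcases (hp.1 i).eq_or_lt with h | h
      · rw [← h, Real.zero_rpow h0.ne']; simp
      · rcases lt_or_gt_of_ne h1 with h' | h'
        · have := Real.rpow_le_rpow_of_exponent_ge h (hp1 i) h'.le
          rw [Real.rpow_one] at this
          nlinarith
        · have := Real.rpow_le_rpow_of_exponent_ge h (hp1 i) h'.le
          rw [Real.rpow_one] at this
          nlinarith
    have z : ∑ i, (α - 1) * (p i - p i ^ α) = 0 := by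
      rw [← Finset.mul_sum, Finset.sum_sub_distrib, hp.2, ← hS]; ring
    rw [Finset.sum_eq_zero_iff_of_nonneg nn] at z
    apply Finset.sum_nonneg
    intro i hi
    have hz := z i hi
    rcases (hp.1 i).eq_or_lt with h | h
    · rw [← h]; simp
    · rcases (hp1 i).eq_or_lt with h' | h'
      · rw [h']; simp
      · exfalso
        have : p i = p i ^ α := by
          have := (mul_eq_zero.1 hz).resolve_left hα1
          linarith
        rcases lt_or_gt_of_ne h1 with h2 | h2
        · have := Real.rpow_lt_rpow_of_exponent_gt h h' h2
          rw [Real.rpow_one] at this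
          linarith
        · have := Real.rpow_lt_rpow_of_exponent_gt h h' h2
          rw [Real.rpow_one] at this
          linarith
  have hne : Nonempty (Fin n) := ⟨⟨0, by omega⟩⟩
  obtain ⟨i0, hi0⟩ := Finite.exists_max p
  have hM : 1 / (n:ℝ) ≤ p i0 := by
    rw [div_le_iff₀ (by linarith)]
    have : ∑ i, p i ≤ ∑ _i : Fin n, p i0 := Finset.sum_le_sum fun i _ => hi0 i
    rw [hp.2] at this
    simp at this
    linarith
  have hcard : ((Finset.univ.erase i0).card : ℝ) = (n:ℝ) - 1 := by
    rw [Finset.card_erase_of_mem (Finset.mem_univ _), Finset.card_fin]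
    rw [Nat.cast_sub (by omega)]; simp
  have hsum : ∑ i ∈ Finset.univ.erase i0, p i = 1 - p i0 := by
    have := Finset.add_sum_erase Finset.univ p (Finset.mem_univ i0)
    rw [hp.2] at this
    linarith
  have hk : (0:ℝ) < (n:ℝ) - 1 := by linarith
  have hjen : ((n:ℝ) - 1) * ((α - 1) * ((1 - p i0) / ((n:ℝ) - 1)) ^ α) ≤
      ∑ i ∈ Finset.univ.erase i0, (α - 1) * p i ^ α := by
    have := (phi_sc α h0 h1).convexOn.map_sum_le (t := Finset.univ.erase i0)
      (w := fun _ => 1 / ((n:ℝ) - 1)) (p := p) (fun i _ => by positivity)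
      (by simp only [Finset.sum_const, nsmul_eq_mul, hcard]; field_simp) (fun i _ => hp.1 i)
    simp only [smul_eq_mul] at this
    rw [← Finset.mul_sum, ← Finset.mul_sum, hsum, one_div_mul_eq_div, one_div_mul_eq_div,
      le_div_iff₀ hk] at this
    linarith
  have hq2 := hq.2
  have hMV : p i0 ≤ 1 - ((n:ℝ) - 1) * q := by
    by_contra hcon
    push Not at hcon
    have g := (g_lem α h0 h1 ((n:ℝ) - 1) hk).1
    rw [sub_add_cancel] at g
    have hlt : (1 - p i0) / ((n:ℝ) - 1) < q := by rw [div_lt_iff₀ hk]; linarith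
    have := g (a := (1 - p i0) / ((n:ℝ) - 1)) (b := q)
      ⟨div_nonneg (by linarith [hp1 i0]) hk.le, by linarith⟩ hq hlt
    simp only at this
    rw [mul_div_cancel₀ _ hk.ne', sub_sub_cancel] at this
    have e := Finset.add_sum_erase Finset.univ (fun i => (α - 1) * p i ^ α) (Finset.mem_univ i0)
    rw [← Finset.mul_sum Finset.univ, ← hS] at e
    linarith
  rcases hq2.eq_or_lt with hqe | hqlt
  · -- uniform case
    have hall : ∀ i, p i ≤ 1 / (n:ℝ) := by
      intro i
      refine (hi0 i).trans (hMV.trans (le_of_eq ?_))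
      rw [hqe]; field_simp; ring
    have heq : ∀ i ∈ Finset.univ, p i = 1 / (n:ℝ) := by
      rw [← Finset.sum_eq_sum_iff_of_le fun i _ => hall i, hp.2]
      simp
      field_simp
    rw [Finset.sum_congr rfl (g := fun _ : Fin n => (α - 1) * (1 / (n:ℝ) * log (1 / (n:ℝ))))
      fun i hi => by rw [heq i hi]]
    have : 1 - ((n:ℝ) - 1) * q = 1 / n := by rw [hqe]; field_simp; ring
    rw [this, hqe]
    simp only [Finset.sum_const, Finset.card_univ, Fintype.card_fin, nsmul_eq_mul]
    apply le_of_eq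
    ring
  · obtain ⟨a, b, h, hh, ha1, hm, ha2⟩ := h_lem α h0 h1 hq0 (hqlt.trans_le hM)
    have hqM := (hqlt.trans_le hM).le
    have l1 : ∀ i ∈ Finset.univ.erase i0, h q ≤ h (p i) := by
      intro i _
      rcases le_total (p i) q with hh' | hh'
      · exact ha1.antitoneOn ⟨hp.1 i, hh'⟩ ⟨hq0.le, le_rfl⟩ hh'
      · exact hm.monotoneOn ⟨le_rfl, hqM⟩ ⟨hh', hi0 i⟩ hh'
    have l2 : h (1 - ((n:ℝ) - 1) * q) ≤ h (p i0) :=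
      ha2.antitoneOn (by simp) hMV hMV
    have l3 := Finset.card_nsmul_le_sum _ _ _ l1
    rw [nsmul_eq_mul, hcard] at l3
    have l4 : ((n:ℝ) - 1) * h q + h (1 - ((n:ℝ) - 1) * q) ≤ ∑ i, h (p i) := by
      rw [← Finset.add_sum_erase Finset.univ (fun i => h (p i)) (Finset.mem_univ i0)]
      linarith
    simp only [hh] at l4
    rw [Finset.sum_sub_distrib, Finset.sum_sub_distrib, ← Finset.mul_sum _ p, ← Finset.mul_sum _ _ b,
      ← Finset.mul_sum _ (fun i => p i ^ α), ← hS, hp.2] at l4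
    linarith

theorem lNorm_inj {n : ℕ} (α : ℝ) (h0 : 0 < α) (x y : Fin n → ℝ) (hx : ∀ i, 0 ≤ x i)
    (hy : ∀ i, 0 ≤ y i) (h : lNorm α x = lNorm α y) : ∑ i, x i ^ α = ∑ i, y i ^ α := by
  unfold lNorm at h
  have a : 0 ≤ ∑ i, x i ^ α := Finset.sum_nonneg fun i _ => Real.rpow_nonneg (hx i) _
  have b : 0 ≤ ∑ i, y i ^ α := Finset.sum_nonneg fun i _ => Real.rpow_nonneg (hy i) _
  exact (Real.rpow_left_inj a b (by positivity)).1 h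

theorem stmt1 (n : ℕ) (hn : 2 ≤ n) (α : ℝ) (hα : α ∈ Set.Ioo (0 : ℝ) 1 ∪ Set.Ioi 1)
    (p : Fin n → ℝ) (hp : IsProbVec p)
    (q : ℝ) (hq : q ∈ Set.Icc (0 : ℝ) (1 / (n : ℝ)))
    (r : ℝ) (hr : r ∈ Set.Icc (1 / (n : ℝ)) 1)
    (hqN : lNorm α (vVec n q) = lNorm α p)
    (hrN : lNorm α (wVec n r) = lNorm α p) :
    (α < 1 →
      shannonEntropy (vVec n q) ≤ shannonEntropy p ∧
        shannonEntropy p ≤ shannonEntropy (wVec n r)) ∧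
    (1 < α →
      shannonEntropy (wVec n r) ≤ shannonEntropy p ∧
        shannonEntropy p ≤ shannonEntropy (vVec n q)) := by
  have hn2 : (2:ℝ) ≤ n := by exact_mod_cast hn
  have h0 : 0 < α := by
    rcases hα with h | h
    · exact h.1
    · exact lt_trans one_pos h
  have h1 : α ≠ 1 := by
    rcases hα with h | h
    · exact h.2.ne
    · exact (show (1:ℝ) < α from h).ne'
  have hr0 : 0 < r := lt_of_lt_of_le (by positivity) hr.1
  have hv : ∀ i, 0 ≤ vVec n q i := by
    intro i
    have h2 := hq.2
    rw [le_div_iff₀ (by linarith)] at h2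
    have := hq.1
    unfold vVec
    split_ifs
    · nlinarith
    · exact this
  have hw : ∀ i, 0 ≤ wVec n r i := by
    intro i
    have h2 := Nat.floor_le (a := 1 / r) (by positivity)
    rw [le_div_iff₀ hr0] at h2
    unfold wVec
    split_ifs
    · exact hr0.le
    · linarith
    · exact le_rfl
  have V := v_part n hn α h0 h1 p hp q hq (lNorm_inj α h0 _ _ hv hp.1 hqN)
  have W := w_part n hn α h0 h1 p hp r hr (lNorm_inj α h0 _ _ hw hp.1 hrN)
  simp only [← Finset.mul_sum] at V W
  unfold shannonEntropy
  refine ⟨fun h => ⟨?_, ?_⟩, fun h => ⟨?_, ?_⟩⟩ <;> nlinarith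
end

section
/- Let n ≥ 3 be an integer and let α ∈ [1/2, 1) ∪ (1, ∞). Then there exists a unique χ_n(α) ∈ (ln n − (1 − 2/n)·ln(n−1), ln n) such that every function F : ℝ → ℝ satisfying F(H_{v_n}(p)) = ‖v_n(p)‖_α for all p ∈ [0, 1/n] is strictly concave on [0, χ_n(α)] and strictly convex on [χ_n(α), ln n]. Moreover, the map α ↦ χ_n(α) is strictly increasing on [1/2, 1) ∪ (1, ∞), χ_n(α) → ln 2 + (1/2)·ln(n−1) as α → 1, and χ_n(α) → ln n as α → ∞. -/
open Real

noncomputable def phiF (y : ℝ) : ℝ := Real.exp y - 1 - y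

noncomputable def psiF (y : ℝ) : ℝ := Real.log (phiF y / phiF (-y))

lemma phiF_pos {y : ℝ} (hy : y ≠ 0) : 0 < phiF y := by
  have := Real.add_one_lt_exp hy
  unfold phiF; linarith

lemma sinh_ineq {u : ℝ} (hu : 0 < u) : Real.sinh u < u * Real.cosh u := by
  have hm : StrictMonoOn (fun u : ℝ => u * Real.cosh u - Real.sinh u) (Set.Ici 0) := by
    apply strictMonoOn_of_deriv_pos (convex_Ici 0)
    · fun_prop
    · intro x hx
      rw [interior_Ici] at hx
      have hx : 0 < x := hx
      have : HasDerivAt (fun u : ℝ => u * Real.cosh u - Real.sinh u)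
          (1 * Real.cosh x + x * Real.sinh x - Real.cosh x) x :=
        ((hasDerivAt_id x).mul (Real.hasDerivAt_cosh x)).sub (Real.hasDerivAt_sinh x)
      rw [this.deriv]
      have := mul_pos hx (Real.sinh_pos_iff.2 hx)
      linarith
  have := hm (Set.mem_Ici.2 le_rfl) (Set.mem_Ici.2 hu.le) hu
  simp at this
  exact this

lemma exp_ineq1 {y : ℝ} (hy : 0 < y) :
    0 < 4 - 2 * Real.exp y - 2 * Real.exp (-y) + y * (Real.exp y - Real.exp (-y)) := by
  have h1 := sinh_ineq (half_pos hy)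
  have h2 : 0 < Real.sinh (y / 2) := Real.sinh_pos_iff.2 (half_pos hy)
  have h3 := mul_pos h2 (sub_pos.2 h1)
  rw [Real.sinh_eq, Real.cosh_eq] at h3
  have e1 : Real.exp y = Real.exp (y / 2) ^ 2 := by rw [← Real.exp_nat_mul]; congr 1; push_cast; ring
  have e2 : Real.exp (-y) = Real.exp (-(y / 2)) ^ 2 := by
    rw [← Real.exp_nat_mul]; congr 1; push_cast; ring
  have e3 : Real.exp (y / 2) * Real.exp (-(y / 2)) = 1 := by rw [← Real.exp_add]; simp
  rw [e1, e2]
  nlinarith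

lemma exp_ineq2 {y : ℝ} (hy : 0 < y) :
    0 < Real.exp y + Real.exp (-y) - 2 - y ^ 2 := by
  have h1 : y / 2 < Real.sinh (y / 2) := Real.self_lt_sinh_iff.2 (half_pos hy)
  rw [Real.sinh_eq] at h1
  have e1 : Real.exp y = Real.exp (y / 2) ^ 2 := by rw [← Real.exp_nat_mul]; congr 1; push_cast; ring
  have e2 : Real.exp (-y) = Real.exp (-(y / 2)) ^ 2 := by
    rw [← Real.exp_nat_mul]; congr 1; push_cast; ring
  have e3 : Real.exp (y / 2) * Real.exp (-(y / 2)) = 1 := by rw [← Real.exp_add]; simp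
  rw [e1, e2]
  nlinarith

lemma hasDerivAt_phiF (y : ℝ) : HasDerivAt phiF (Real.exp y - 1) y := by
  have := ((Real.hasDerivAt_exp y).sub_const 1).sub (hasDerivAt_id y)
  exact this

lemma hasDerivAt_phiF_neg (y : ℝ) :
    HasDerivAt (fun y => phiF (-y)) (1 - Real.exp (-y)) y := by
  have := (hasDerivAt_phiF (-y)).comp y (hasDerivAt_neg y)
  exact this.congr_deriv (by ring)

lemma hasDerivAt_psiF {y : ℝ} (hy : 0 < y) :
    HasDerivAt psiF ((Real.exp y - 1) / phiF y - (1 - Real.exp (-y)) / phiF (-y)) y := by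
  have h1 := phiF_pos hy.ne'
  have h2 := phiF_pos (neg_ne_zero.2 hy.ne')
  have := ((hasDerivAt_phiF y).div (hasDerivAt_phiF_neg y) h2.ne').log (div_pos h1 h2).ne'
  refine HasDerivAt.congr_deriv (f := psiF) this ?_
  simp only [Pi.div_apply]
  field_simp

lemma psiF_deriv_pos {y : ℝ} (hy : 0 < y) :
    0 < (Real.exp y - 1) / phiF y - (1 - Real.exp (-y)) / phiF (-y) := by
  have h1 := phiF_pos hy.ne'
  have h2 := phiF_pos (neg_ne_zero.2 hy.ne')
  have e3 : Real.exp y * Real.exp (-y) = 1 := by rw [← Real.exp_add]; simp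
  rw [sub_pos, div_lt_div_iff₀ h2 h1]
  have := exp_ineq1 hy
  unfold phiF
  nlinarith

lemma psiF_deriv_lt {y : ℝ} (hy : 0 < y) :
    (Real.exp y - 1) / phiF y - (1 - Real.exp (-y)) / phiF (-y) < 1 := by
  have h1 := phiF_pos hy.ne'
  have h2 := phiF_pos (neg_ne_zero.2 hy.ne')
  have e3 : Real.exp y * Real.exp (-y) = 1 := by rw [← Real.exp_add]; simp
  rw [div_sub_div _ _ h1.ne' h2.ne', div_lt_one (mul_pos h1 h2)]
  have := exp_ineq2 hy
  unfold phiF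
  nlinarith

lemma psiF_neg (y : ℝ) : psiF (-y) = -psiF y := by
  unfold psiF
  rw [neg_neg, ← Real.log_inv, inv_div]

lemma psiF_zero : psiF 0 = 0 := by simp [psiF, phiF]

lemma psiF_pos {y : ℝ} (hy : 0 < y) : 0 < psiF y := by
  have h1 := phiF_pos hy.ne'
  have h2 := phiF_pos (neg_ne_zero.2 hy.ne')
  apply Real.log_pos
  rw [one_lt_div h2]
  have h3 : y < Real.sinh y := Real.self_lt_sinh_iff.2 hy
  rw [Real.sinh_eq] at h3
  unfold phiF
  linarith

lemma psiF_lt {y : ℝ} (hy : 0 < y) : psiF y < y := by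
  have h1 := phiF_pos hy.ne'
  have h2 := phiF_pos (neg_ne_zero.2 hy.ne')
  unfold psiF
  rw [Real.log_lt_iff_lt_exp (div_pos h1 h2), div_lt_iff₀ h2]
  have e3 : Real.exp y * Real.exp (-y) = 1 := by rw [← Real.exp_add]; simp
  have h1 := sinh_ineq (half_pos hy)
  rw [Real.sinh_eq, Real.cosh_eq] at h1
  have e1 : Real.exp y = Real.exp (y / 2) ^ 2 := by rw [← Real.exp_nat_mul]; congr 1; push_cast; ring
  have e3' : Real.exp (y / 2) * Real.exp (-(y / 2)) = 1 := by rw [← Real.exp_add]; simp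
  have h5 := mul_lt_mul_of_pos_left h1 (Real.exp_pos (y / 2))
  unfold phiF
  nlinarith

lemma strictMonoOn_Ici_of {f : ℝ → ℝ} (h0 : f 0 = 0) (hp : ∀ y, 0 < y → 0 < f y)
    (hm : StrictMonoOn f (Set.Ioi 0)) : StrictMonoOn f (Set.Ici 0) := by
  intro a ha b hb hab
  rcases eq_or_lt_of_le (Set.mem_Ici.1 ha) with h | h
  · subst h; rw [h0]; exact hp b hab
  · exact hm h (h.trans hab) hab

lemma psiF_strictMono : StrictMono psiF := by
  apply strictMono_of_odd_strictMonoOn_nonneg psiF_neg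
  apply strictMonoOn_Ici_of psiF_zero (fun y => psiF_pos)
  apply strictMonoOn_of_deriv_pos (convex_Ioi 0)
  · intro x hx
    exact (hasDerivAt_psiF hx).continuousAt.continuousWithinAt
  · intro x hx
    rw [interior_Ioi] at hx
    rw [(hasDerivAt_psiF hx).deriv]
    exact psiF_deriv_pos hx

lemma sub_psiF_strictMono : StrictMono (fun y => y - psiF y) := by
  apply strictMono_of_odd_strictMonoOn_nonneg (fun y => by rw [psiF_neg]; ring)
  apply strictMonoOn_Ici_of (by simp [psiF_zero]) (fun y hy => sub_pos.2 (psiF_lt hy))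
  have key : ∀ x : ℝ, 0 < x → HasDerivAt (fun y => y - psiF y) _ x := fun x hx =>
    (hasDerivAt_id x).sub (hasDerivAt_psiF hx)
  apply strictMonoOn_of_deriv_pos (convex_Ioi 0)
  · intro x hx
    exact (key x hx).continuousAt.continuousWithinAt
  · intro x hx
    rw [interior_Ioi] at hx
    rw [(key x hx).deriv]
    exact sub_pos.2 (psiF_deriv_lt hx)

lemma psiF_abs_sub (a b : ℝ) : |psiF a - psiF b| ≤ |a - b| := by
  rcases le_total a b with h | h
  · have h1 := psiF_strictMono.monotone h
    have h2 := sub_psiF_strictMono.monotone h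
    rw [abs_sub_comm, abs_sub_comm a b, abs_of_nonneg, abs_of_nonneg] <;> linarith
  · have h1 := psiF_strictMono.monotone h
    have h2 := sub_psiF_strictMono.monotone h
    rw [abs_of_nonneg, abs_of_nonneg] <;> linarith

lemma psiF_continuous : Continuous psiF := by
  have : LipschitzWith 1 psiF := LipschitzWith.of_dist_le_mul fun a b => by
    simpa [Real.dist_eq] using psiF_abs_sub a b
  exact this.continuous

lemma psiF_ge {y : ℝ} (hy : 0 < y) : Real.log (y / 2) ≤ psiF y := by
  have h1 := phiF_pos hy.ne'
  have h2 := phiF_pos (neg_ne_zero.2 hy.ne')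
  apply Real.log_le_log (by positivity)
  rw [le_div_iff₀ h2]
  have h3 := Real.quadratic_le_exp_of_nonneg hy.le
  have h4 : Real.exp (-y) < 1 := by simpa using hy
  unfold phiF
  nlinarith

/-- the function whose level `log m` determines the inflection point -/
lemma LF_strictMono {b : ℝ} (hb : -(1 / 2) ≤ b) : StrictMono (fun x => x + psiF (b * x)) := by
  intro x y hxy
  simp only
  rcases le_total 0 b with h | h
  · have := psiF_strictMono.monotone (mul_le_mul_of_nonneg_left hxy.le h)
    linarith
  · have := sub_psiF_strictMono.monotone (mul_le_mul_of_nonpos_left hxy.le h)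
    nlinarith

lemma exists_root {m b : ℝ} (hm : 2 ≤ m) (hb : -(1 / 2) ≤ b) :
    ∃ x, 0 < x ∧ x < 2 * Real.log m ∧ x + psiF (b * x) = Real.log m := by
  have hl : 0 < Real.log m := Real.log_pos (by linarith)
  have hc : Continuous (fun x => x + psiF (b * x)) :=
    continuous_id.add (psiF_continuous.comp (continuous_const.mul continuous_id))
  have h0 : (0:ℝ) + psiF (b * 0) < Real.log m := by simpa [psiF_zero] using hl
  have h1 : Real.log m < 2 * Real.log m + psiF (b * (2 * Real.log m)) := by
    have h2 := psiF_strictMono.monotone (show -Real.log m ≤ b * (2 * Real.log m) by nlinarith)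
    rw [psiF_neg] at h2
    have h3 := psiF_lt hl
    linarith
  obtain ⟨x, hx, hx'⟩ := intermediate_value_Ioo (by linarith : (0:ℝ) ≤ 2 * Real.log m)
    hc.continuousOn ⟨h0, h1⟩
  exact ⟨x, hx.1, hx.2, hx'⟩

lemma param_concave {H N H' G F : ℝ → ℝ} {a b : ℝ} (hab : a ≤ b)
    (hHc : ContinuousOn H (Set.Icc a b)) (hNc : ContinuousOn N (Set.Icc a b))
    (hH : StrictMonoOn H (Set.Icc a b))
    (hdH : ∀ x ∈ Set.Ioo a b, HasDerivAt H (H' x) x)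
    (hH' : ∀ x ∈ Set.Ioo a b, 0 < H' x)
    (hdN : ∀ x ∈ Set.Ioo a b, HasDerivAt N (G x * H' x) x)
    (hG : StrictAntiOn G (Set.Ioo a b))
    (hF : ∀ p ∈ Set.Icc a b, F (H p) = N p) :
    StrictConcaveOn ℝ (Set.Icc (H a) (H b)) F := by
  have hsl : ∀ p ∈ Set.Icc a b, ∀ q ∈ Set.Icc a b, p < q →
      ∃ c ∈ Set.Ioo p q, (N q - N p) / (H q - H p) = G c := by
    intro p hp q hq hpq
    have hsub : Set.Icc p q ⊆ Set.Icc a b := Set.Icc_subset_Icc hp.1 hq.2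
    have hsub' : Set.Ioo p q ⊆ Set.Ioo a b := Set.Ioo_subset_Ioo hp.1 hq.2
    obtain ⟨c, hc, he⟩ := exists_ratio_hasDerivAt_eq_ratio_slope N (fun x => G x * H' x) hpq
      (hNc.mono hsub) (fun x hx => hdN x (hsub' hx)) H H' (hHc.mono hsub)
      (fun x hx => hdH x (hsub' hx))
    refine ⟨c, hc, ?_⟩
    have h1 : 0 < H q - H p := sub_pos.2 (hH hp hq hpq)
    have h2 := hH' c (hsub' hc)
    rw [div_eq_iff h1.ne']
    apply mul_right_cancel₀ h2.ne'
    linarith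
  have hsurj : ∀ x ∈ Set.Icc (H a) (H b), ∃ p ∈ Set.Icc a b, H p = x :=
    fun x hx => intermediate_value_Icc hab hHc hx
  apply strictConcaveOn_of_slope_strict_anti_adjacent (convex_Icc _ _)
  intro x y z hx hz hxy hyz
  obtain ⟨p, hp, rfl⟩ := hsurj x hx
  obtain ⟨q, hq, rfl⟩ := hsurj y ⟨hx.1.trans hxy.le, hyz.le.trans hz.2⟩
  obtain ⟨r, hr, rfl⟩ := hsurj z hz
  have hpq := (hH.lt_iff_lt hp hq).1 hxy
  have hqr := (hH.lt_iff_lt hq hr).1 hyz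
  rw [hF p hp, hF q hq, hF r hr]
  obtain ⟨c, hc, hce⟩ := hsl p hp q hq hpq
  obtain ⟨d, hd, hde⟩ := hsl q hq r hr hqr
  rw [hce, hde]
  exact hG ⟨hp.1.trans_lt hc.1, hc.2.trans_le hq.2⟩ ⟨hq.1.trans_lt hd.1, hd.2.trans_le hr.2⟩
    (hc.2.trans hd.1)

lemma param_convex {H N H' G F : ℝ → ℝ} {a b : ℝ} (hab : a ≤ b)
    (hHc : ContinuousOn H (Set.Icc a b)) (hNc : ContinuousOn N (Set.Icc a b))
    (hH : StrictMonoOn H (Set.Icc a b))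
    (hdH : ∀ x ∈ Set.Ioo a b, HasDerivAt H (H' x) x)
    (hH' : ∀ x ∈ Set.Ioo a b, 0 < H' x)
    (hdN : ∀ x ∈ Set.Ioo a b, HasDerivAt N (G x * H' x) x)
    (hG : StrictMonoOn G (Set.Ioo a b))
    (hF : ∀ p ∈ Set.Icc a b, F (H p) = N p) :
    StrictConvexOn ℝ (Set.Icc (H a) (H b)) F := by
  rw [← neg_strictConcaveOn_iff]
  apply param_concave (N := fun x => -N x) (G := fun x => -G x) hab hHc hNc.neg hH hdH hH'
  · intro x hx
    exact (hdN x hx).neg.congr_deriv (by ring)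
  · exact fun x hx y hy hxy => neg_lt_neg (hG hx hy hxy)
  · intro p hp
    simp [hF p hp]

noncomputable def gF (m b x : ℝ) : ℝ :=
  (Real.exp ((1 + b) * x) + m) ^ (-b / (1 + b)) * ((1 - Real.exp (b * x)) / x)

noncomputable def HF (m p : ℝ) : ℝ := Real.negMulLog (1 - m * p) + m * Real.negMulLog p

noncomputable def NF (m b p : ℝ) : ℝ :=
  ((1 - m * p) ^ (1 + b) + m * p ^ (1 + b)) ^ (1 / (1 + b))

noncomputable def XF (m p : ℝ) : ℝ := Real.log (1 - m * p) - Real.log p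

lemma hasDerivAt_gF {m b x : ℝ} (hm : 0 < m) (hb : 0 < 1 + b) (hx : 0 < x) :
    HasDerivAt (gF m b) ((Real.exp ((1 + b) * x) + m) ^ (-b / (1 + b) - 1) / x ^ 2 *
      Real.exp (b * x) * (Real.exp x * phiF (b * x) - m * phiF (-(b * x)))) x := by
  have hS : 0 < Real.exp ((1 + b) * x) + m := by positivity
  have h1 : HasDerivAt (fun x => Real.exp ((1 + b) * x) + m)
      (Real.exp ((1 + b) * x) * ((1 + b) * 1)) x :=
    (((hasDerivAt_id x).const_mul (1 + b)).exp).add_const m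
  have h2 : HasDerivAt (fun x => 1 - Real.exp (b * x)) (-(Real.exp (b * x) * (b * 1))) x :=
    (((hasDerivAt_id x).const_mul b).exp).const_sub 1
  have h3 := (h1.rpow_const (p := -b / (1 + b)) (Or.inl hS.ne')).mul
    (h2.div (hasDerivAt_id x) hx.ne')
  refine HasDerivAt.congr_deriv (f := gF m b) h3 ?_
  have e1 : (Real.exp ((1 + b) * x) + m) ^ (-b / (1 + b)) =
      (Real.exp ((1 + b) * x) + m) ^ (-b / (1 + b) - 1) * (Real.exp ((1 + b) * x) + m) := by
    rw [Real.rpow_sub_one hS.ne']; field_simp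
  simp only [Pi.div_apply, id]
  rw [e1]
  generalize (Real.exp ((1 + b) * x) + m) ^ (-b / (1 + b) - 1) = T
  have e2 : Real.exp ((1 + b) * x) = Real.exp x * Real.exp (b * x) := by
    rw [← Real.exp_add]; congr 1; ring
  have e3 : Real.exp (-(b * x)) = (Real.exp (b * x))⁻¹ := Real.exp_neg _
  unfold phiF
  rw [e2, e3]
  have := (Real.exp_pos (b * x)).ne'
  field_simp
  ring

lemma K_pos_iff {m b x : ℝ} (hm : 2 ≤ m) (hb : b ≠ 0) (hx : 0 < x) :
    0 < Real.exp x * phiF (b * x) - m * phiF (-(b * x)) ↔ Real.log m < x + psiF (b * x) := by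
  have hbx : b * x ≠ 0 := mul_ne_zero hb hx.ne'
  have h1 := phiF_pos hbx
  have h2 := phiF_pos (neg_ne_zero.2 hbx)
  have : x + psiF (b * x) = Real.log (Real.exp x * (phiF (b * x) / phiF (-(b * x)))) := by
    rw [Real.log_mul (Real.exp_pos x).ne' (div_pos h1 h2).ne', Real.log_exp]; rfl
  rw [this, Real.log_lt_log_iff (by linarith) (by positivity), sub_pos, ← mul_div_assoc,
    lt_div_iff₀ h2]

lemma K_neg_iff {m b x : ℝ} (hm : 2 ≤ m) (hb : b ≠ 0) (hx : 0 < x) :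
    Real.exp x * phiF (b * x) - m * phiF (-(b * x)) < 0 ↔ x + psiF (b * x) < Real.log m := by
  have hbx : b * x ≠ 0 := mul_ne_zero hb hx.ne'
  have h1 := phiF_pos hbx
  have h2 := phiF_pos (neg_ne_zero.2 hbx)
  have : x + psiF (b * x) = Real.log (Real.exp x * (phiF (b * x) / phiF (-(b * x)))) := by
    rw [Real.log_mul (Real.exp_pos x).ne' (div_pos h1 h2).ne', Real.log_exp]; rfl
  rw [this, Real.log_lt_log_iff (by positivity) (by linarith), sub_neg, ← mul_div_assoc,
    div_lt_iff₀ h2]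

lemma gF_mono {m b s : ℝ} (hm : 2 ≤ m) (hb : b ≠ 0) (hb' : -(1 / 2) ≤ b) (hs : 0 < s)
    (hr : s + psiF (b * s) = Real.log m) : StrictMonoOn (gF m b) (Set.Ici s) := by
  have key : ∀ x ∈ Set.Ici s, HasDerivAt (gF m b) _ x := fun x hx =>
    hasDerivAt_gF (by linarith : 0 < m) (by linarith) (hs.trans_le hx)
  apply strictMonoOn_of_deriv_pos (convex_Ici s)
  · exact fun x hx => (key x hx).continuousAt.continuousWithinAt
  · intro x hx
    rw [interior_Ici] at hx
    have hsx : s < x := hx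
    have hx0 : 0 < x := hs.trans hsx
    rw [(key x hsx.le).deriv]
    have := (K_pos_iff hm hb hx0).2 (by rw [← hr]; exact LF_strictMono hb' hsx)
    have hm0 : 0 < m := by linarith
    positivity

lemma gF_anti {m b s : ℝ} (hm : 2 ≤ m) (hb : b ≠ 0) (hb' : -(1 / 2) ≤ b)
    (hr : s + psiF (b * s) = Real.log m) : StrictAntiOn (gF m b) (Set.Ioc 0 s) := by
  have key : ∀ x ∈ Set.Ioc 0 s, HasDerivAt (gF m b) _ x := fun x hx =>
    hasDerivAt_gF (by linarith : 0 < m) (by linarith) hx.1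
  apply strictAntiOn_of_deriv_neg (convex_Ioc 0 s)
  · exact fun x hx => (key x hx).continuousAt.continuousWithinAt
  · intro x hx
    rw [interior_Ioc] at hx
    rw [(key x ⟨hx.1, hx.2.le⟩).deriv]
    have := (K_neg_iff hm hb hx.1).2 (by rw [← hr]; exact LF_strictMono hb' hx.2)
    have hm0 : 0 < m := by linarith
    have hx0 := hx.1
    apply mul_neg_of_pos_of_neg _ this
    positivity

lemma XF_pos {m p : ℝ} (hm : 0 < m) (hp : p ∈ Set.Ioo 0 (1 / (m + 1))) :
    p < 1 - m * p := by
  have := hp.2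
  rw [lt_div_iff₀ (by linarith)] at this
  linarith

lemma hasDerivAt_HF {m p : ℝ} (hm : 0 < m) (hp : p ∈ Set.Ioo 0 (1 / (m + 1))) :
    HasDerivAt (HF m) (m * XF m p) p := by
  have h0 := hp.1
  have h1 := XF_pos hm hp
  have h2 : HasDerivAt (fun p => 1 - m * p) (-(m * 1)) p :=
    ((hasDerivAt_id p).const_mul m).const_sub 1
  have h3 := ((Real.hasDerivAt_negMulLog (x := 1 - m * p) (by linarith)).comp p h2).add
    ((Real.hasDerivAt_negMulLog h0.ne').const_mul m)
  refine HasDerivAt.congr_deriv (f := HF m) h3 ?_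
  unfold XF
  ring

lemma XF_pos' {m p : ℝ} (hm : 0 < m) (hp : p ∈ Set.Ioo 0 (1 / (m + 1))) :
    0 < XF m p := sub_pos.2 (Real.log_lt_log hp.1 (XF_pos hm hp))

lemma hasDerivAt_NF {m b p : ℝ} (hm : 0 < m) (hb : 0 < 1 + b) (hp : p ∈ Set.Ioo 0 (1 / (m + 1))) :
    HasDerivAt (NF m b) (gF m b (XF m p) * (m * XF m p)) p := by
  have h0 := hp.1
  have h1 := XF_pos hm hp
  have hX := XF_pos' hm hp
  have ha : 0 < 1 - m * p := h0.trans h1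
  have h2 : HasDerivAt (fun p => 1 - m * p) (-(m * 1)) p :=
    ((hasDerivAt_id p).const_mul m).const_sub 1
  have hS : 0 < (1 - m * p) ^ (1 + b) + m * p ^ (1 + b) := by positivity
  have h3 := ((h2.rpow_const (p := 1 + b) (Or.inl ha.ne')).add
    (((hasDerivAt_id p).rpow_const (p := 1 + b) (Or.inl h0.ne')).const_mul m)).rpow_const
    (p := 1 / (1 + b)) (Or.inl hS.ne')
  refine HasDerivAt.congr_deriv (f := NF m b) h3 ?_
  simp only [Pi.add_apply, id]
  have e1 : Real.exp ((1 + b) * XF m p) + m =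
      ((1 - m * p) ^ (1 + b) + m * p ^ (1 + b)) / p ^ (1 + b) := by
    have : Real.exp ((1 + b) * XF m p) = (1 - m * p) ^ (1 + b) / p ^ (1 + b) := by
      rw [Real.rpow_def_of_pos ha, Real.rpow_def_of_pos h0, ← Real.exp_sub]
      unfold XF; congr 1; ring
    have hpp : 0 < p ^ (1 + b) := by positivity
    rw [this]; field_simp
  have e2 : Real.exp (b * XF m p) = (1 - m * p) ^ b / p ^ b := by
    rw [Real.rpow_def_of_pos ha, Real.rpow_def_of_pos h0, ← Real.exp_sub]
    unfold XF; congr 1; ring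
  have e3 : (p ^ (1 + b)) ^ (-b / (1 + b)) = (p ^ b)⁻¹ := by
    rw [← Real.rpow_mul h0.le, ← Real.rpow_neg h0.le]; congr 1; field_simp
  unfold gF
  rw [e1, e2, Real.div_rpow hS.le (by positivity), e3]
  have e4 : 1 / (1 + b) - 1 = -b / (1 + b) := by field_simp; ring
  have e5 : 1 + b - 1 = b := by ring
  rw [e4, e5]
  generalize ((1 - m * p) ^ (1 + b) + m * p ^ (1 + b)) ^ (-b / (1 + b)) = T
  have hpb : 0 < p ^ b := by positivity
  field_simp
  ring

lemma HF_continuous (m : ℝ) : Continuous (HF m) := by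
  unfold HF
  fun_prop

lemma HF_strictMonoOn {m : ℝ} (hm : 0 < m) : StrictMonoOn (HF m) (Set.Icc 0 (1 / (m + 1))) := by
  apply strictMonoOn_of_deriv_pos (convex_Icc _ _) (HF_continuous m).continuousOn
  intro x hx
  rw [interior_Icc] at hx
  rw [(hasDerivAt_HF hm hx).deriv]
  exact mul_pos hm (XF_pos' hm hx)

lemma NF_continuousOn {m b : ℝ} (hb : 0 < 1 + b) :
    Continuous (NF m b) := by
  unfold NF
  have h : 0 ≤ 1 / (1 + b) := by positivity
  refine Continuous.rpow_const ?_ (fun _ => Or.inr h)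
  exact ((continuous_const.sub (continuous_const.mul continuous_id)).rpow_const
    (fun _ => Or.inr hb.le)).add (continuous_const.mul
      (continuous_id.rpow_const (fun _ => Or.inr hb.le)))

lemma XF_strictAnti {m p q : ℝ} (hm : 0 < m) (hp : 0 < p) (hpq : p < q)
    (hq : q ≤ 1 / (m + 1)) : XF m q < XF m p := by
  rw [le_div_iff₀ (by linarith)] at hq
  unfold XF
  have h1 := Real.log_lt_log hp hpq
  have h2 : Real.log (1 - m * q) < Real.log (1 - m * p) :=
    Real.log_lt_log (by nlinarith) (by nlinarith)
  linarith

lemma XF_at {m s : ℝ} (hm : 0 < m) : XF m (1 / (m + Real.exp s)) = s := by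
  have := Real.exp_pos s
  have h1 : 1 - m * (1 / (m + Real.exp s)) = Real.exp s / (m + Real.exp s) := by
    field_simp; ring
  unfold XF
  rw [h1, ← Real.log_div (by positivity) (by positivity)]
  have : Real.exp s / (m + Real.exp s) / (1 / (m + Real.exp s)) = Real.exp s := by
    field_simp
  rw [this, Real.log_exp]

lemma main_shape {m b s : ℝ} {F : ℝ → ℝ} (hm : 2 ≤ m) (hb : b ≠ 0) (hb' : -(1 / 2) ≤ b)
    (hs : 0 < s) (hr : s + psiF (b * s) = Real.log m)
    (hF : ∀ p ∈ Set.Icc 0 (1 / (m + 1)), F (HF m p) = NF m b p) :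
    StrictConcaveOn ℝ (Set.Icc (HF m 0) (HF m (1 / (m + Real.exp s)))) F ∧
    StrictConvexOn ℝ (Set.Icc (HF m (1 / (m + Real.exp s))) (HF m (1 / (m + 1)))) F := by
  have hm0 : 0 < m := by linarith
  have hb1 : 0 < 1 + b := by linarith
  have hX := XF_at (s := s) hm0
  have hq0 : 0 < 1 / (m + Real.exp s) := by positivity
  have hq1 : 1 / (m + Real.exp s) < 1 / (m + 1) := by
    have : 1 < Real.exp s := Real.one_lt_exp_iff.2 hs
    apply one_div_lt_one_div_of_lt <;> linarith
  generalize 1 / (m + Real.exp s) = q at *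
  have hs1 : Set.Icc 0 q ⊆ Set.Icc 0 (1 / (m + 1)) := Set.Icc_subset_Icc le_rfl hq1.le
  have hs2 : Set.Icc q (1 / (m + 1)) ⊆ Set.Icc 0 (1 / (m + 1)) := Set.Icc_subset_Icc hq0.le le_rfl
  have hs3 : Set.Ioo 0 q ⊆ Set.Ioo 0 (1 / (m + 1)) := Set.Ioo_subset_Ioo le_rfl hq1.le
  have hs4 : Set.Ioo q (1 / (m + 1)) ⊆ Set.Ioo 0 (1 / (m + 1)) := Set.Ioo_subset_Ioo hq0.le le_rfl
  constructor
  · apply param_concave (H' := fun p => m * XF m p) (G := fun p => gF m b (XF m p)) hq0.le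
      (HF_continuous m).continuousOn (NF_continuousOn hb1).continuousOn
      ((HF_strictMonoOn hm0).mono hs1)
      (fun x hx => hasDerivAt_HF hm0 (hs3 hx))
      (fun x hx => mul_pos hm0 (XF_pos' hm0 (hs3 hx)))
      (fun x hx => hasDerivAt_NF hm0 hb1 (hs3 hx)) _ (fun p hp => hF p (hs1 hp))
    intro x hx y hy hxy
    have h1 := XF_strictAnti hm0 hx.1 hxy (hy.2.le.trans hq1.le)
    have h2 := XF_strictAnti hm0 hy.1 hy.2 hq1.le
    rw [hX] at h2
    exact gF_mono hm hb hb' hs hr (Set.mem_Ici.2 h2.le) (Set.mem_Ici.2 (h2.trans h1).le) h1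
  · apply param_convex (H' := fun p => m * XF m p) (G := fun p => gF m b (XF m p)) hq1.le
      (HF_continuous m).continuousOn (NF_continuousOn hb1).continuousOn
      ((HF_strictMonoOn hm0).mono hs2)
      (fun x hx => hasDerivAt_HF hm0 (hs4 hx))
      (fun x hx => mul_pos hm0 (XF_pos' hm0 (hs4 hx)))
      (fun x hx => hasDerivAt_NF hm0 hb1 (hs4 hx)) _ (fun p hp => hF p (hs2 hp))
    intro x hx y hy hxy
    have h1 := XF_strictAnti hm0 (hs4 hx).1 hxy hy.2.le
    have h2 := XF_strictAnti hm0 hq0 hx.1 hx.2.le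
    have h3 := XF_pos' hm0 (hs4 hy)
    rw [hX] at h2
    exact gF_anti hm hb hb' hr ⟨h3, (h1.trans h2).le⟩ ⟨h3.trans h1, h2.le⟩ h1

lemma shannonEntropy_vVec (n : ℕ) (hn : 3 ≤ n) (p : ℝ) :
    shannonEntropy (vVec n p) = HF ((n : ℝ) - 1) p := by
  obtain ⟨k, rfl⟩ : ∃ k, n = k + 1 := ⟨n - 1, by omega⟩
  unfold shannonEntropy vVec HF Real.negMulLog
  rw [Fin.sum_univ_succ]
  simp
  ring

lemma lNorm_vVec (n : ℕ) (hn : 3 ≤ n) (α p : ℝ) :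
    lNorm α (vVec n p) = NF ((n : ℝ) - 1) (α - 1) p := by
  obtain ⟨k, rfl⟩ : ∃ k, n = k + 1 := ⟨n - 1, by omega⟩
  unfold lNorm vVec NF
  rw [Fin.sum_univ_succ]
  simp

lemma HF_zero (m : ℝ) : HF m 0 = 0 := by simp [HF]

lemma HF_exp {m : ℝ} (hm : 0 < m) (s : ℝ) : HF m (1 / (m + Real.exp s)) =
    Real.log (m + Real.exp s) - s * Real.exp s / (m + Real.exp s) := by
  have := Real.exp_pos s
  have h1 : 1 - m * (1 / (m + Real.exp s)) = Real.exp s / (m + Real.exp s) := by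
    field_simp; ring
  unfold HF Real.negMulLog
  rw [h1, Real.log_div (by positivity) (by positivity), Real.log_exp, one_div, Real.log_inv]
  field_simp
  ring

lemma HF_one {m : ℝ} (hm : 0 < m) : HF m (1 / (m + 1)) = Real.log (m + 1) := by
  have := HF_exp hm 0
  simpa using this

lemma HF_exp_anti {m s t : ℝ} (hm : 0 < m) (hs : 0 ≤ s) (hst : s < t) :
    HF m (1 / (m + Real.exp t)) < HF m (1 / (m + Real.exp s)) := by
  have h1 : 1 ≤ Real.exp s := Real.one_le_exp hs
  have h2 : Real.exp s < Real.exp t := Real.exp_lt_exp.2 hst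
  apply HF_strictMonoOn hm
  · exact ⟨by positivity, one_div_le_one_div_of_le (by linarith) (by linarith)⟩
  · exact ⟨by positivity, one_div_le_one_div_of_le (by linarith) (by linarith)⟩
  · exact one_div_lt_one_div_of_lt (by linarith) (by linarith)

lemma HF_exp_continuous {m : ℝ} (hm : 0 < m) :
    Continuous (fun s => HF m (1 / (m + Real.exp s))) := by
  apply (HF_continuous m).comp
  apply Continuous.div continuous_const (continuous_const.add Real.continuous_exp)
  intro s
  exact (add_pos hm (Real.exp_pos s)).ne'

lemma not_both {F : ℝ → ℝ} {a b : ℝ} (hab : a < b) (h1 : StrictConcaveOn ℝ (Set.Icc a b) F)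
    (h2 : StrictConvexOn ℝ (Set.Icc a b) F) : False := by
  have ha : a ∈ Set.Icc a b := ⟨le_rfl, hab.le⟩
  have hb : b ∈ Set.Icc a b := ⟨hab.le, le_rfl⟩
  have e1 := h1.2 ha hb hab.ne (by norm_num : (0:ℝ) < 1 / 2) (by norm_num : (0:ℝ) < 1 / 2)
    (by norm_num)
  have e2 := h2.2 ha hb hab.ne (by norm_num : (0:ℝ) < 1 / 2) (by norm_num : (0:ℝ) < 1 / 2)
    (by norm_num)
  exact lt_asymm e1 e2

theorem stmt5 (n : ℕ) (hn : 3 ≤ n) :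
    ∃ χ : ℝ → ℝ,
      (∀ α ∈ Set.Ico (1 / 2 : ℝ) 1 ∪ Set.Ioi 1,
        χ α ∈ Set.Ioo (Real.log n - (1 - 2 / (n : ℝ)) * Real.log ((n : ℝ) - 1)) (Real.log n) ∧
        (∀ F : ℝ → ℝ,
          (∀ p ∈ Set.Icc (0 : ℝ) (1 / (n : ℝ)),
            F (shannonEntropy (vVec n p)) = lNorm α (vVec n p)) →
          StrictConcaveOn ℝ (Set.Icc 0 (χ α)) F ∧
            StrictConvexOn ℝ (Set.Icc (χ α) (Real.log n)) F) ∧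
        (∀ c : ℝ,
          c ∈ Set.Ioo (Real.log n - (1 - 2 / (n : ℝ)) * Real.log ((n : ℝ) - 1)) (Real.log n) →
          (∀ F : ℝ → ℝ,
            (∀ p ∈ Set.Icc (0 : ℝ) (1 / (n : ℝ)),
              F (shannonEntropy (vVec n p)) = lNorm α (vVec n p)) →
            StrictConcaveOn ℝ (Set.Icc 0 c) F ∧
              StrictConvexOn ℝ (Set.Icc c (Real.log n)) F) →
          c = χ α)) ∧
      StrictMonoOn χ (Set.Ico (1 / 2 : ℝ) 1 ∪ Set.Ioi 1) ∧
      Filter.Tendsto χ (nhdsWithin 1 (Set.Ico (1 / 2 : ℝ) 1 ∪ Set.Ioi 1))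
        (nhds (Real.log 2 + Real.log ((n : ℝ) - 1) / 2)) ∧
      Filter.Tendsto χ Filter.atTop (nhds (Real.log n)) := by
  simp only [shannonEntropy_vVec n hn, lNorm_vVec n hn]
  have hn3 : (3 : ℝ) ≤ n := by exact_mod_cast hn
  obtain ⟨m, hm⟩ : ∃ m : ℝ, (n : ℝ) - 1 = m := ⟨_, rfl⟩
  have hnm : (n : ℝ) = m + 1 := by linarith
  rw [hm, hnm]
  have hm2 : 2 ≤ m := by linarith
  have hm0 : 0 < m := by linarith
  have hl : 0 < Real.log m := Real.log_pos (by linarith)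
  clear hm hnm hn3
  have hex : ∀ b : ℝ, ∃ x, -(1 / 2) ≤ b →
      0 < x ∧ x < 2 * Real.log m ∧ x + psiF (b * x) = Real.log m := by
    intro b
    by_cases h : -(1 / 2) ≤ b
    · obtain ⟨x, hx⟩ := exists_root hm2 h
      exact ⟨x, fun _ => hx⟩
    · exact ⟨0, fun h' => absurd h' h⟩
  choose s hs using hex
  have hbα : ∀ α ∈ Set.Ico (1 / 2 : ℝ) 1 ∪ Set.Ioi 1, α - 1 ≠ 0 ∧ -(1 / 2) ≤ α - 1 := by
    rintro α (h | h)
    · exact ⟨by linarith [h.2], by linarith [h.1]⟩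
    · have h : 1 < α := h
      exact ⟨by linarith, by linarith⟩
  have hlow : Real.log (m + 1) - (1 - 2 / (m + 1)) * Real.log m =
      HF m (1 / (m + Real.exp (2 * Real.log m))) := by
    have e : Real.exp (2 * Real.log m) = m ^ 2 := by
      rw [mul_comm, Real.exp_mul, Real.exp_log hm0]; norm_cast
    rw [HF_exp hm0, e, show m + m ^ 2 = m * (m + 1) by ring,
      Real.log_mul (by positivity) (by positivity)]
    field_simp
    ring
  have hup : Real.log (m + 1) = HF m (1 / (m + Real.exp 0)) := by
    rw [Real.exp_zero, HF_one hm0]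
  refine ⟨fun α => HF m (1 / (m + Real.exp (s (α - 1)))), ?_, ?_, ?_, ?_⟩
  · intro α hα
    obtain ⟨hb, hb'⟩ := hbα α hα
    obtain ⟨h1, h2, h3⟩ := hs (α - 1) hb'
    have hmem : HF m (1 / (m + Real.exp (s (α - 1)))) ∈
        Set.Ioo (Real.log (m + 1) - (1 - 2 / (m + 1)) * Real.log m) (Real.log (m + 1)) := by
      constructor
      · rw [hlow]; exact HF_exp_anti hm0 h1.le h2
      · rw [hup]; exact HF_exp_anti hm0 le_rfl h1
    have hshape : ∀ F : ℝ → ℝ, (∀ p ∈ Set.Icc (0 : ℝ) (1 / (m + 1)),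
        F (HF m p) = NF m (α - 1) p) →
        StrictConcaveOn ℝ (Set.Icc 0 (HF m (1 / (m + Real.exp (s (α - 1)))))) F ∧
          StrictConvexOn ℝ (Set.Icc (HF m (1 / (m + Real.exp (s (α - 1))))) (Real.log (m + 1))) F := by
      intro F hF
      have := main_shape hm2 hb hb' h1 h3 hF
      rwa [HF_zero, HF_one hm0] at this
    refine ⟨hmem, hshape, ?_⟩
    intro c hc hcF
    obtain ⟨F, hinv⟩ : ∃ F : ℝ → ℝ, ∀ p ∈ Set.Icc (0 : ℝ) (1 / (m + 1)),
        F (HF m p) = NF m (α - 1) p := by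
      refine ⟨fun y => NF m (α - 1)
        (Function.invFunOn (HF m) (Set.Icc 0 (1 / (m + 1))) y), fun p hp => ?_⟩
      beta_reduce
      rw [(HF_strictMonoOn hm0).injOn.leftInvOn_invFunOn hp]
    obtain ⟨a1, a2⟩ := hshape _ hinv
    obtain ⟨b1, b2⟩ := hcF _ hinv
    have hlow0 : 0 < Real.log (m + 1) - (1 - 2 / (m + 1)) * Real.log m := by
      have e1 : Real.log m < Real.log (m + 1) := Real.log_lt_log hm0 (by linarith)
      have e2 : 0 < 2 / (m + 1) * Real.log m := by positivity
      nlinarith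
    rcases lt_trichotomy c (HF m (1 / (m + Real.exp (s (α - 1))))) with h | h | h
    · exact (not_both h
        (a1.subset (Set.Icc_subset_Icc (hlow0.trans hc.1).le le_rfl) (convex_Icc _ _))
        (b2.subset (Set.Icc_subset_Icc le_rfl hmem.2.le) (convex_Icc _ _))).elim
    · exact h
    · exact (not_both h
        (b1.subset (Set.Icc_subset_Icc (hlow0.trans hmem.1).le le_rfl) (convex_Icc _ _))
        (a2.subset (Set.Icc_subset_Icc le_rfl hc.2.le) (convex_Icc _ _))).elim
  · intro α hα β hβ hab
    obtain ⟨h1, h2, h3⟩ := hs (α - 1) (hbα α hα).2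
    obtain ⟨g1, g2, g3⟩ := hs (β - 1) (hbα β hβ).2
    apply HF_exp_anti hm0 g1.le
    have hLm := LF_strictMono (hbα β hβ).2
    rw [← hLm.lt_iff_lt]
    rw [g3, ← h3]
    have := psiF_strictMono (mul_lt_mul_of_pos_right (sub_lt_sub_right hab 1) h1)
    linarith
  · have hval : Real.log 2 + Real.log m / 2 = HF m (1 / (m + Real.exp (Real.log m))) := by
      rw [HF_exp hm0, Real.exp_log hm0, ← two_mul, Real.log_mul (by norm_num) hm0.ne']
      field_simp
      ring
    rw [hval]
    apply ((HF_exp_continuous hm0).tendsto (Real.log m)).comp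
    rw [tendsto_iff_dist_tendsto_zero]
    refine squeeze_zero' (g := fun α => |α - 1| * (2 * Real.log m))
      (Filter.Eventually.of_forall fun _ => dist_nonneg) ?_ ?_
    · filter_upwards [self_mem_nhdsWithin] with α hα
      obtain ⟨h1, h2, h3⟩ := hs (α - 1) (hbα α hα).2
      have e := psiF_abs_sub 0 ((α - 1) * s (α - 1))
      rw [psiF_zero, zero_sub, zero_sub, abs_neg, abs_neg, abs_mul, abs_of_pos h1] at e
      rw [Real.dist_eq, abs_sub_comm]
      have : Real.log m - s (α - 1) = psiF ((α - 1) * s (α - 1)) := by linarith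
      rw [this]
      exact e.trans (mul_le_mul_of_nonneg_left h2.le (abs_nonneg _))
    · have hc : Continuous (fun α : ℝ => |α - 1| * (2 * Real.log m)) := by fun_prop
      have := (hc.tendsto 1).mono_left
        (nhdsWithin_le_nhds (s := Set.Ico (1 / 2 : ℝ) 1 ∪ Set.Ioi 1))
      simpa using this
  · rw [hup]
    apply ((HF_exp_continuous hm0).tendsto 0).comp
    refine squeeze_zero' (g := fun α : ℝ => 2 * m / (α - 1)) ?_ ?_ ?_
    · filter_upwards [Filter.eventually_gt_atTop 1] with α hα
      exact (hs (α - 1) (by linarith)).1.le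
    · filter_upwards [Filter.eventually_gt_atTop 1] with α hα
      obtain ⟨h1, h2, h3⟩ := hs (α - 1) (by linarith)
      have hb : 0 < α - 1 := by linarith
      have hy : 0 < (α - 1) * s (α - 1) := mul_pos hb h1
      have e := psiF_ge hy
      have e2 : Real.log ((α - 1) * s (α - 1) / 2) < Real.log m := by linarith
      have e3 := (Real.log_lt_log_iff (by positivity) hm0).1 e2
      rw [le_div_iff₀ hb]
      linarith
    · exact Filter.Tendsto.div_atTop tendsto_const_nhds
        (Filter.tendsto_atTop_add_const_right _ (-1) Filter.tendsto_id)
end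

section
/- Let n ≥ 3 be an integer and let α ∈ [1/2, 1) ∪ (1, ∞). Then there exists a unique p* ∈ (0, 1/n) satisfying the tangency equation (ln n − H_{v_n}(p*))·D_{n,α}(p*) = n^{1/α−1} − ‖v_n(p*)‖_α. Moreover, with this p*, the function L_max^α : [0, ln n] → ℝ is strictly increasing on [0, ln n] if α ∈ [1/2, 1), strictly decreasing on [0, ln n] if α > 1, and concave on [0, ln n]. -/
open Real

/-- `H_{v_n}(p) = H(v_n(p))`. -/
noncomputable def Hv (n : ℕ) (p : ℝ) : ℝ := shannonEntropy (vVec n p)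

/-- The derivative of `‖v_n(p)‖_α` with respect to `H_{v_n}(p)`. -/
noncomputable def Dva (n : ℕ) (α p : ℝ) : ℝ :=
  (((n : ℝ) - 1) * p ^ α + (1 - ((n : ℝ) - 1) * p) ^ α) ^ (1 / α - 1) *
    ((p ^ (α - 1) - (1 - ((n : ℝ) - 1) * p) ^ (α - 1)) /
      (Real.log (1 - ((n : ℝ) - 1) * p) - Real.log p))

/-- The tangency equation `(ln n − H_{v_n}(p))·D_{n,α}(p) = n^{1/α−1} − ‖v_n(p)‖_α`. -/
def TangencyEq (n : ℕ) (α p : ℝ) : Prop :=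
  (Real.log n - Hv n p) * Dva n α p = (n : ℝ) ^ (1 / α - 1) - lNorm α (vVec n p)


/-- Single sign change from negative to positive on `(0,∞)`, and eventually at least one. -/
def SgnCh (f : ℝ → ℝ) : Prop :=
  (∃ s0 : ℝ, 0 < s0 ∧ (∀ s, 0 < s → s < s0 → f s < 0) ∧ (∀ s, s0 < s → 0 < f s)) ∧
    ∃ S : ℝ, 0 < S ∧ ∀ s, S ≤ s → 1 ≤ f s

theorem SgnCh.of_deriv {f f' : ℝ → ℝ} (hd : ∀ s, HasDerivAt f (f' s) s) (h0 : f 0 = 0)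
    (h : SgnCh f') : SgnCh f := by
  obtain ⟨⟨s1, hs1, hneg, hpos⟩, S, hS, hlarge⟩ := h
  have hc : Continuous f := continuous_iff_continuousAt.2 fun s => (hd s).continuousAt
  have hbig : ∀ s, S ≤ s → f S + (s - S) ≤ f s := by
    intro s hs
    have := (convex_Ici S).mul_sub_le_image_sub_of_le_deriv (f := f) (C := 1) hc.continuousOn
      (fun x _ => (hd x).differentiableAt.differentiableWithinAt)
      (fun x hx => by
        rw [(hd x).deriv]; rw [interior_Ici] at hx; exact hlarge x hx.le) S Set.self_mem_Ici s hs hs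
    linarith
  have hlargeF : ∃ S : ℝ, 0 < S ∧ ∀ s, S ≤ s → 1 ≤ f s := by
    refine ⟨S + |1 - f S|, by positivity, fun s hs => ?_⟩
    have h1 := abs_nonneg (1 - f S)
    have h2 := le_abs_self (1 - f S)
    have := hbig s (by linarith)
    linarith
  refine ⟨?_, hlargeF⟩
  obtain ⟨T, hT, hTl⟩ := hlargeF
  have hanti : StrictAntiOn f (Set.Icc 0 s1) :=
    strictAntiOn_of_deriv_neg (convex_Icc _ _) hc.continuousOn fun x hx => by
      rw [interior_Icc] at hx; rw [(hd x).deriv]; exact hneg x hx.1 hx.2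
  have hmono : StrictMonoOn f (Set.Ici s1) :=
    strictMonoOn_of_deriv_pos (convex_Ici _) hc.continuousOn fun x hx => by
      rw [interior_Ici] at hx; rw [(hd x).deriv]; exact hpos x hx
  have hneg1 : ∀ s, 0 < s → s ≤ s1 → f s < 0 := fun s h1 h2 => by
    rw [← h0]; exact hanti ⟨le_rfl, hs1.le⟩ ⟨h1.le, h2⟩ h1
  have hTs : s1 < T := by
    by_contra hcon
    have := hneg1 T hT (not_lt.1 hcon)
    linarith [hTl T le_rfl]
  obtain ⟨s0, hs0, hz⟩ := intermediate_value_Icc hTs.le hc.continuousOn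
    (show (0 : ℝ) ∈ Set.Icc (f s1) (f T) from
      ⟨(hneg1 s1 hs1 le_rfl).le, by linarith [hTl T le_rfl]⟩)
  refine ⟨s0, by linarith [hs0.1], fun s h1 h2 => ?_, fun s h1 => ?_⟩
  · rcases le_or_gt s s1 with h | h
    · exact hneg1 s h1 h
    · rw [← hz]; exact hmono h.le hs0.1 h2
  · rw [← hz]; exact hmono hs0.1 (hs0.1.trans h1.le) h1

noncomputable def Kf (m α s : ℝ) : ℝ :=
  2 * (1 - α) + (1 - α) * s - 1 - m * (1 - α) ^ 2 * exp (-(α * s)) + α ^ 2 * exp (-((1 - α) * s))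

noncomputable def Gf (m α s : ℝ) : ℝ :=
  (1 - α) * s * (exp s + m) - m * exp ((1 - α) * s) + m - exp s + exp (α * s)

noncomputable def Gf1 (m α s : ℝ) : ℝ :=
  (1 - α) * (exp s + m) + (1 - α) * s * exp s - m * (1 - α) * exp ((1 - α) * s) - exp s
    + α * exp (α * s)

theorem hasDerivAt_exp_c (c s : ℝ) : HasDerivAt (fun s => exp (c * s)) (c * exp (c * s)) s := by
  have := ((hasDerivAt_id s).const_mul c).exp
  simpa [mul_comm] using this

theorem Kf_sgn {m α : ℝ} (hm : 1 < m) (hα : 0 < α) (hα1 : α ≠ 1) : SgnCh (Kf m α) := by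
  have hb : 1 - α ≠ 0 := sub_ne_zero.2 hα1.symm
  set δ := (1 - α) ^ 2 * (1 + α) with hδ
  have hδ0 : 0 < δ := by positivity
  have hd : ∀ s, HasDerivAt (Kf m α) ((1 - α) + α * m * (1 - α) ^ 2 * exp (-(α * s))
      - α ^ 2 * (1 - α) * exp (-((1 - α) * s))) s := by
    intro s
    have h1 := hasDerivAt_exp_c (-α) s
    have h2 := hasDerivAt_exp_c (-(1 - α)) s
    have h3 := ((((hasDerivAt_id s).const_mul (1 - α)).const_add (2 * (1 - α))).sub_const 1)
    have := (h3.sub (h1.const_mul (m * (1 - α) ^ 2))).add (h2.const_mul (α ^ 2))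
    simp only [neg_mul] at this
    refine HasDerivAt.congr_deriv (f := Kf m α) this ?_
    ring
  have hge : ∀ s, 0 < s → δ ≤ (1 - α) + α * m * (1 - α) ^ 2 * exp (-(α * s))
      - α ^ 2 * (1 - α) * exp (-((1 - α) * s)) := by
    intro s hs
    have h1 : 0 ≤ α * m * (1 - α) ^ 2 * exp (-(α * s)) := by positivity
    have h2 : 0 ≤ (1 - α) * (1 - exp (-((1 - α) * s))) := by
      rcases lt_or_gt_of_ne hb with h | h
      · have : 1 ≤ exp (-((1 - α) * s)) := one_le_exp (by nlinarith)
        nlinarith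
      · have : exp (-((1 - α) * s)) ≤ 1 := exp_le_one_iff.2 (by nlinarith)
        nlinarith
    have h3 := mul_nonneg (sq_nonneg α) h2
    rw [hδ]; nlinarith
  have hc : Continuous (Kf m α) := continuous_iff_continuousAt.2 fun s => (hd s).continuousAt
  have h0 : Kf m α 0 < 0 := by
    have : 0 < (m - 1) * (1 - α) ^ 2 := mul_pos (by linarith) (by positivity)
    simp only [Kf, mul_zero, neg_zero, exp_zero]; nlinarith
  have hmono : StrictMonoOn (Kf m α) (Set.Ici 0) :=
    strictMonoOn_of_deriv_pos (convex_Ici _) hc.continuousOn fun x hx => by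
      rw [interior_Ici] at hx; rw [(hd x).deriv]; exact hδ0.trans_le (hge x hx)
  have hbig : ∀ s, 0 ≤ s → Kf m α 0 + δ * s ≤ Kf m α s := by
    intro s hs
    have := (convex_Ici (0:ℝ)).mul_sub_le_image_sub_of_le_deriv (f := Kf m α) (C := δ) hc.continuousOn
      (fun x _ => (hd x).differentiableAt.differentiableWithinAt)
      (fun x hx => by
        rw [(hd x).deriv]; rw [interior_Ici] at hx; exact hge x hx) 0 Set.self_mem_Ici s hs hs
    linarith
  have hl : ∃ S : ℝ, 0 < S ∧ ∀ s, S ≤ s → 1 ≤ Kf m α s := by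
    refine ⟨(1 - Kf m α 0) / δ, div_pos (by linarith) hδ0, fun s hs => ?_⟩
    have hs0 : 0 < (1 - Kf m α 0) / δ := div_pos (by linarith) hδ0
    have := hbig s (hs0.le.trans hs)
    rw [div_le_iff₀ hδ0] at hs
    linarith
  refine ⟨?_, hl⟩
  obtain ⟨T, hT, hTl⟩ := hl
  obtain ⟨s0, hs0, hz⟩ := intermediate_value_Icc hT.le hc.continuousOn
    (show (0 : ℝ) ∈ Set.Icc (Kf m α 0) (Kf m α T) from ⟨h0.le, by linarith [hTl T le_rfl]⟩)
  have hs00 : 0 < s0 := lt_of_le_of_ne hs0.1 (by rintro rfl; linarith)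
  exact ⟨s0, hs00, fun s h1 h2 => by rw [← hz]; exact hmono h1.le hs00.le h2,
    fun s h1 => by rw [← hz]; exact hmono hs00.le (hs00.trans h1).le h1⟩

theorem Gf_sgn {m α : ℝ} (hm : 1 < m) (hα : 0 < α) (hα1 : α ≠ 1) : SgnCh (Gf m α) := by
  have hK2 : SgnCh (fun s => exp s * Kf m α s) := by
    obtain ⟨⟨s0, hs0, h1, h2⟩, S, hS, h3⟩ := Kf_sgn hm hα hα1
    refine ⟨⟨s0, hs0, fun s a b => mul_neg_of_pos_of_neg (exp_pos _) (h1 s a b),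
      fun s a => mul_pos (exp_pos _) (h2 s a)⟩, S, hS, fun s hs => ?_⟩
    have := h3 s hs
    have := one_le_exp (hS.le.trans hs)
    nlinarith
  have e0 : ∀ s, exp s = exp ((1 - α) * s) * exp (α * s) := fun s => by
    rw [← exp_add]; congr 1; ring
  have e1 : ∀ s, exp s * exp (-(α * s)) = exp ((1 - α) * s) := fun s => by
    rw [← exp_add]; congr 1; ring
  have e2 : ∀ s, exp s * exp (-((1 - α) * s)) = exp (α * s) := fun s => by
    rw [← exp_add]; congr 1; ring
  have hG1 : SgnCh (Gf1 m α) := by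
    refine SgnCh.of_deriv (fun s => ?_) ?_ hK2
    · have ha := hasDerivAt_exp_c α s
      have hb := hasDerivAt_exp_c (1 - α) s
      have he := Real.hasDerivAt_exp s
      have := ((((he.add_const m).const_mul (1 - α)).add
        (((hasDerivAt_id s).const_mul (1 - α)).mul he)).sub
          (hb.const_mul (m * (1 - α)))).sub he |>.add (ha.const_mul α)
      refine HasDerivAt.congr_deriv (f := Gf1 m α) this ?_
      simp only [Kf, id]
      linear_combination (m * (1 - α) ^ 2) * e1 s - α ^ 2 * e2 s
    · simp only [Gf1, mul_zero, exp_zero]; ring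
  refine SgnCh.of_deriv (fun s => ?_) ?_ hG1
  · have ha := hasDerivAt_exp_c α s
    have hb := hasDerivAt_exp_c (1 - α) s
    have he := Real.hasDerivAt_exp s
    have := (((((hasDerivAt_id s).const_mul (1 - α)).mul (he.add_const m)).sub
          (hb.const_mul m)).add_const m).sub he |>.add ha
    refine HasDerivAt.congr_deriv (f := Gf m α) this ?_
    simp only [Gf1, id]
    ring
  · simp [Gf]

noncomputable def Ef (m α s : ℝ) : ℝ :=
  (m + exp (α * s)) ^ (1 / α - 1) * ((1 - exp (-(1 - α) * s)) / s)

theorem Ef_deriv {m α s : ℝ} (hm : 1 < m) (hα : 0 < α) (hs : 0 < s) :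
    HasDerivAt (Ef m α) ((m + exp (α * s)) ^ (1 / α - 1 - 1) / s ^ 2 * exp (-(1 - α) * s)
      * Gf m α s) s := by
  have hpos : 0 < m + exp (α * s) := by positivity
  have ha := ((hasDerivAt_exp_c α s).const_add m).rpow_const (p := 1 / α - 1) (Or.inl hpos.ne')
  have hb := ((hasDerivAt_exp_c (-(1 - α)) s).const_sub 1).div (hasDerivAt_id s) hs.ne'
  have := ha.mul hb
  refine HasDerivAt.congr_deriv (f := Ef m α) this ?_
  have e : (m + exp (α * s)) ^ (1 / α - 1) = (m + exp (α * s)) ^ (1 / α - 1 - 1) * (m + exp (α * s)) := by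
    conv_rhs => rw [Real.rpow_sub_one hpos.ne' (1 / α - 1)]
    field_simp
  rw [e]
  have e1 : exp (α * s) = exp (-(1 - α) * s) * exp s := by rw [← exp_add]; congr 1; ring
  have e2 : exp ((1 - α) * s) = (exp (-(1 - α) * s))⁻¹ := by rw [← exp_neg]; congr 1; ring
  simp only [Gf, id, Pi.div_apply]
  rw [e1, e2]
  generalize (m + exp (-(1 - α) * s) * exp s) ^ (1 / α - 1 - 1) = X
  have hy := exp_pos (-(1 - α) * s)
  generalize exp (-(1 - α) * s) = Y at *
  generalize exp s = Z
  field_simp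
  ring

/-- `Ef` decreases and then increases. -/
theorem Ef_mono {m α : ℝ} (hm : 1 < m) (hα : 0 < α) (hα1 : α ≠ 1) :
    ∃ s0 : ℝ, 0 < s0 ∧ StrictAntiOn (Ef m α) (Set.Ioc 0 s0) ∧ StrictMonoOn (Ef m α) (Set.Ici s0) := by
  obtain ⟨⟨s0, hs0, h1, h2⟩, -⟩ := Gf_sgn hm hα hα1
  refine ⟨s0, hs0, ?_, ?_⟩
  · refine strictAntiOn_of_deriv_neg (convex_Ioc _ _) (fun x hx =>
      (Ef_deriv hm hα hx.1).continuousAt.continuousWithinAt) fun x hx => ?_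
    rw [interior_Ioc] at hx
    rw [(Ef_deriv hm hα hx.1).deriv]
    have := hx.1
    exact mul_neg_of_pos_of_neg (by positivity) (h1 x hx.1 hx.2)
  · refine strictMonoOn_of_deriv_pos (convex_Ici _) (fun x hx =>
      (Ef_deriv hm hα (hs0.trans_le hx)).continuousAt.continuousWithinAt) fun x hx => ?_
    rw [interior_Ici] at hx
    have hx0 : 0 < x := hs0.trans hx
    rw [(Ef_deriv hm hα hx0).deriv]
    exact mul_pos (by positivity) (h2 x hx)

/-- Abstract setting: `N` is a function of `H` through the parameter `p ∈ [0,b]` with slope `D`. -/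
structure Setup (b : ℝ) (H N D : ℝ → ℝ) : Prop where
  hb : 0 < b
  cH : Continuous H
  cN : Continuous N
  der : ∀ p ∈ Set.Ioo 0 b, ∃ h' : ℝ, 0 < h' ∧ HasDerivAt H h' p ∧ HasDerivAt N (h' * D p) p

namespace Setup

variable {b : ℝ} {H N D : ℝ → ℝ}

theorem tan_lt (S : Setup b H N D) {p q c : ℝ} (hp : 0 ≤ p) (hpq : p < q) (hq : q ≤ b)
    (h : ∀ x ∈ Set.Ioo p q, D x < c) : N q - N p < c * (H q - H p) := by
  have := strictAntiOn_of_deriv_neg (f := fun x => N x - c * H x) (convex_Icc p q)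
    (S.cN.sub (continuous_const.mul S.cH)).continuousOn (fun x hx => by
      rw [interior_Icc] at hx
      obtain ⟨h', h0, h1, h2⟩ := S.der x ⟨hp.trans_lt hx.1, hx.2.trans_le hq⟩
      have h3 : HasDerivAt (fun x => N x - c * H x) (h' * D x - c * h') x := h2.sub (h1.const_mul c)
      rw [h3.deriv]
      have := h x hx
      nlinarith)
  have := this (Set.left_mem_Icc.2 hpq.le) (Set.right_mem_Icc.2 hpq.le) hpq
  simp only at this
  linarith

theorem tan_gt (S : Setup b H N D) {p q c : ℝ} (hp : 0 ≤ p) (hpq : p < q) (hq : q ≤ b)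
    (h : ∀ x ∈ Set.Ioo p q, c < D x) : c * (H q - H p) < N q - N p := by
  have := strictMonoOn_of_deriv_pos (f := fun x => N x - c * H x) (convex_Icc p q)
    (S.cN.sub (continuous_const.mul S.cH)).continuousOn (fun x hx => by
      rw [interior_Icc] at hx
      obtain ⟨h', h0, h1, h2⟩ := S.der x ⟨hp.trans_lt hx.1, hx.2.trans_le hq⟩
      have h3 : HasDerivAt (fun x => N x - c * H x) (h' * D x - c * h') x := h2.sub (h1.const_mul c)
      rw [h3.deriv]
      have := h x hx
      nlinarith)
  have := this (Set.left_mem_Icc.2 hpq.le) (Set.right_mem_Icc.2 hpq.le) hpq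
  simp only at this
  linarith

theorem H_mono (S : Setup b H N D) : StrictMonoOn H (Set.Icc 0 b) :=
  strictMonoOn_of_deriv_pos (convex_Icc _ _) S.cH.continuousOn fun x hx => by
    rw [interior_Icc] at hx
    obtain ⟨h', h0, h1, -⟩ := S.der x hx
    rw [h1.deriv]; exact h0

theorem H_surj (S : Setup b H N D) {h : ℝ} (hh : h ∈ Set.Icc (H 0) (H b)) :
    ∃ p ∈ Set.Icc 0 b, H p = h := by
  obtain ⟨p, hp, e⟩ := intermediate_value_Icc S.hb.le S.cH.continuousOn hh
  exact ⟨p, hp, e⟩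

theorem root_lt (S : Setup b H N D) {p0 : ℝ} (hp0 : p0 ∈ Set.Ioo 0 b)
    (hm : StrictMonoOn D (Set.Ico p0 b)) {p : ℝ} (hp : p ∈ Set.Ioo 0 b)
    (ht : (H b - H p) * D p = N b - N p) : p < p0 := by
  by_contra hcon
  have h := not_lt.1 hcon
  have := S.tan_gt (c := D p) hp.1.le hp.2 le_rfl (fun x hx =>
    hm ⟨h, hp.2⟩ ⟨h.trans hx.1.le, hx.2⟩ hx.1)
  linarith

theorem exists_unique (S : Setup b H N D) {p0 : ℝ} (hp0 : p0 ∈ Set.Ioo 0 b)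
    (ha : StrictAntiOn D (Set.Ioc 0 p0))
    (hm : StrictMonoOn D (Set.Ico p0 b)) (hc : ContinuousOn D (Set.Ioo 0 b))
    (hpos : ∃ p ∈ Set.Ioo 0 b, N b - N p < (H b - H p) * D p) :
    ∃! p, p ∈ Set.Ioo 0 b ∧ (H b - H p) * D p = N b - N p := by
  set φ : ℝ → ℝ := fun p => (H b - H p) * D p - (N b - N p) with hφ
  have hanti : StrictAntiOn φ (Set.Ioc 0 p0) := by
    intro p hp q hq hpq
    have h1 := S.tan_lt (c := D p) hp.1.le hpq (hq.2.trans hp0.2.le) (fun x hx =>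
      ha hp ⟨hp.1.trans hx.1, hx.2.le.trans hq.2⟩ hx.1)
    have h2 := ha hp hq hpq
    have h3 : H q < H b := S.H_mono ⟨hq.1.le, hq.2.trans hp0.2.le⟩ ⟨S.hb.le, le_rfl⟩
      (hq.2.trans_lt hp0.2)
    simp only [hφ]
    nlinarith
  have hneg : ∀ p, p0 ≤ p → p < b → φ p < 0 := by
    intro p h1 h2
    have := S.tan_gt (c := D p) (hp0.1.le.trans h1) h2 le_rfl (fun x hx =>
      hm ⟨h1, h2⟩ ⟨h1.trans hx.1.le, hx.2⟩ hx.1)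
    simp only [hφ]; linarith
  obtain ⟨a, ha0, hφa⟩ := hpos
  have hφa' : 0 < φ a := by simp only [hφ]; linarith
  have hap : a < p0 := by
    by_contra hcon
    linarith [hneg a (not_lt.1 hcon) ha0.2]
  have hcφ : ContinuousOn φ (Set.Icc a p0) :=
    ((continuous_const.sub S.cH).continuousOn.mul (hc.mono fun x hx =>
      ⟨ha0.1.trans_le hx.1, hx.2.trans_lt hp0.2⟩)).sub (continuous_const.sub S.cN).continuousOn
  obtain ⟨r, hr, hr0⟩ := intermediate_value_Icc' hap.le hcφ
    (show (0:ℝ) ∈ Set.Icc (φ p0) (φ a) from ⟨(hneg p0 le_rfl hp0.2).le, hφa'.le⟩)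
  have hrI : r ∈ Set.Ioo 0 b := ⟨ha0.1.trans_le hr.1, hr.2.trans_lt hp0.2⟩
  refine ⟨r, ⟨hrI, by simp only [hφ] at hr0; linarith⟩, ?_⟩
  rintro q ⟨hq, hqt⟩
  have hq0 : φ q = 0 := by simp only [hφ]; linarith
  have hqp := S.root_lt hp0 hm hq hqt
  exact hanti.injOn ⟨hq.1, hqp.le⟩ ⟨hrI.1, hr.2⟩ (hq0.trans hr0.symm)

/-- Supporting lines. -/
theorem support (S : Setup b H N D) {r : ℝ} (hr : r ∈ Set.Ioo 0 b)
    (ha : StrictAntiOn D (Set.Ioc 0 r)) (ht : (H b - H r) * D r = N b - N r) {L : ℝ → ℝ}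
    (hL1 : ∀ p ∈ Set.Icc 0 b, H p ≤ H r → L (H p) = N p)
    (hL2 : ∀ h ∈ Set.Icc (H 0) (H b), H r < h → L h = ((H b - h) / (H b - H r)) * N r +
      (1 - (H b - h) / (H b - H r)) * N b) :
    ∀ z ∈ Set.Icc (H 0) (H b), H 0 < z → ∃ a ∈ Set.Ioc 0 r,
      ∀ x ∈ Set.Icc (H 0) (H b), L x ≤ L z + D a * (x - z) := by
  have hrb : H r < H b := S.H_mono ⟨hr.1.le, hr.2.le⟩ ⟨S.hb.le, le_rfl⟩ hr.2
  have hlin : ∀ h ∈ Set.Icc (H 0) (H b), H r ≤ h → L h = N r + D r * (h - H r) := by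
    intro h hh hle
    rcases hle.eq_or_lt with e | hlt
    · rw [← e, hL1 r ⟨hr.1.le, hr.2.le⟩ le_rfl]; ring
    · rw [hL2 h hh hlt]
      have hne : H b - H r ≠ 0 := by linarith
      have e : N b = N r + (H b - H r) * D r := by linarith
      rw [e]; field_simp; ring
  have hcurve : ∀ a ∈ Set.Ioc 0 r, ∀ q ∈ Set.Icc 0 r, N q ≤ N a + D a * (H q - H a) := by
    intro a ha' q hq
    rcases lt_trichotomy q a with h | h | h
    · rcases hq.1.eq_or_lt with h0 | h0
      all_goals
        have := S.tan_gt (c := D a) hq.1 h (ha'.2.trans hr.2.le) (fun x hx =>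
          ha ⟨hq.1.trans_lt hx.1, hx.2.le.trans ha'.2⟩ ha' hx.2)
        linarith
    · rw [h]; linarith
    · have := S.tan_lt (c := D a) ha'.1.le h (hq.2.trans hr.2.le) (fun x hx =>
          ha ha' ⟨ha'.1.trans hx.1, hx.2.le.trans hq.2⟩ hx.1)
      linarith
  have hall : ∀ a ∈ Set.Ioc 0 r, ∀ x ∈ Set.Icc (H 0) (H b), L x ≤ N a + D a * (x - H a) := by
    intro a ha' x hx
    rcases le_or_gt x (H r) with h | h
    · obtain ⟨q, hq, rfl⟩ := S.H_surj hx
      rw [hL1 q hq h]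
      exact hcurve a ha' q ⟨hq.1, (S.H_mono.le_iff_le hq ⟨hr.1.le, hr.2.le⟩).1 h⟩
    · rw [hlin x hx h.le]
      have h1 := hcurve a ha' r ⟨hr.1.le, le_rfl⟩
      have h2 : D r ≤ D a := ha.antitoneOn ha' ⟨hr.1, le_rfl⟩ ha'.2
      nlinarith
  intro z hz hz0
  rcases le_or_gt z (H r) with h | h
  · obtain ⟨a, ha', rfl⟩ := S.H_surj hz
    have har : a ≤ r := (S.H_mono.le_iff_le ha' ⟨hr.1.le, hr.2.le⟩).1 h
    have ha0 : 0 < a := (S.H_mono.lt_iff_lt ⟨le_rfl, S.hb.le⟩ ha').1 hz0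
    refine ⟨a, ⟨ha0, har⟩, fun x hx => ?_⟩
    rw [hL1 a ha' h]
    exact hall a ⟨ha0, har⟩ x hx
  · refine ⟨r, ⟨hr.1, le_rfl⟩, fun x hx => ?_⟩
    have := hall r ⟨hr.1, le_rfl⟩ x hx
    rw [hlin z hz h.le]
    linarith

theorem concl (S : Setup b H N D) {r : ℝ} (hr : r ∈ Set.Ioo 0 b)
    (ha : StrictAntiOn D (Set.Ioc 0 r)) (ht : (H b - H r) * D r = N b - N r) {L : ℝ → ℝ}
    (hL1 : ∀ p ∈ Set.Icc 0 b, H p ≤ H r → L (H p) = N p)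
    (hL2 : ∀ h ∈ Set.Icc (H 0) (H b), H r < h → L h = ((H b - h) / (H b - H r)) * N r +
      (1 - (H b - h) / (H b - H r)) * N b) :
    ((∀ p ∈ Set.Ioo 0 b, 0 < D p) → StrictMonoOn L (Set.Icc (H 0) (H b))) ∧
    ((∀ p ∈ Set.Ioo 0 b, D p < 0) → StrictAntiOn L (Set.Icc (H 0) (H b))) ∧
    ConcaveOn ℝ (Set.Icc (H 0) (H b)) L := by
  have sup := S.support hr ha ht hL1 hL2
  refine ⟨fun hD x hx z hz hxz => ?_, fun hD => ?_, convex_Icc _ _, ?_⟩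
  · obtain ⟨a, ha', h⟩ := sup z hz (hx.1.trans_lt hxz)
    have := hD a ⟨ha'.1, ha'.2.trans_lt hr.2⟩
    have := h x hx
    nlinarith
  · have hgen : ∀ x ∈ Set.Icc (H 0) (H b), ∀ z ∈ Set.Icc (H 0) (H b), H 0 < x → x < z →
        L z < L x := by
      intro x hx z hz h0 hxz
      obtain ⟨a, ha', h⟩ := sup x hx h0
      have := hD a ⟨ha'.1, ha'.2.trans_lt hr.2⟩
      have := h z hz
      nlinarith
    intro x hx z hz hxz
    rcases hx.1.eq_or_lt with e | h0
    · subst e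
      have h0r : H 0 < H r := S.H_mono ⟨le_rfl, S.hb.le⟩ ⟨hr.1.le, hr.2.le⟩ hr.1
      have hrb : H r < H b := S.H_mono ⟨hr.1.le, hr.2.le⟩ ⟨S.hb.le, le_rfl⟩ hr.2
      obtain ⟨w, hw1, hw2⟩ := exists_between (lt_min h0r hxz)
      have hwr := hw2.trans_le (min_le_left _ _)
      have hwz := hw2.trans_le (min_le_right _ _)
      have hwI : w ∈ Set.Icc (H 0) (H b) := ⟨hw1.le, (hwr.trans hrb).le⟩
      have h1 := hgen w hwI z hz hw1 hwz
      obtain ⟨q, hq, rfl⟩ := S.H_surj hwI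
      have hq0 : 0 < q := (S.H_mono.lt_iff_lt ⟨le_rfl, S.hb.le⟩ hq).1 hw1
      have h2 := S.tan_lt (c := 0) le_rfl hq0 hq.2 (fun x hx => hD x ⟨hx.1, hx.2.trans_le hq.2⟩)
      rw [hL1 q hq hwr.le] at h1
      rw [hL1 0 ⟨le_rfl, S.hb.le⟩ h0r.le]
      linarith
    · exact hgen x hx z hz h0 hxz
  · intro x hx y hy s t hs ht' hst
    simp only [smul_eq_mul]
    have hz : s * x + t * y ∈ Set.Icc (H 0) (H b) := convex_Icc _ _ hx hy hs ht' hst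
    rcases hz.1.eq_or_lt with e | h0
    · -- degenerate case: the combination sits at the left endpoint
      have h1 : s * (x - H 0) + t * (y - H 0) = 0 := by
        have : H 0 = (s + t) * H 0 := by rw [hst, one_mul]
        linarith
      have h2 := mul_nonneg hs (sub_nonneg.2 hx.1)
      have h3 := mul_nonneg ht' (sub_nonneg.2 hy.1)
      have h4 : s * (x - H 0) = 0 := by linarith
      have h5 : t * (y - H 0) = 0 := by linarith
      have h6 : s * L x = s * L (H 0) := by
        rcases mul_eq_zero.1 h4 with h | h
        · rw [h]; ring
        · rw [sub_eq_zero.1 h]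
      have h7 : t * L y = t * L (H 0) := by
        rcases mul_eq_zero.1 h5 with h | h
        · rw [h]; ring
        · rw [sub_eq_zero.1 h]
      rw [← e, h6, h7, ← add_mul, hst, one_mul]
    · obtain ⟨a, -, h⟩ := sup _ hz h0
      have h1 := mul_le_mul_of_nonneg_left (h x hx) hs
      have h2 := mul_le_mul_of_nonneg_left (h y hy) ht'
      have ht : t = 1 - s := by linarith
      subst ht
      nlinarith

end Setup

noncomputable def Hm (m p : ℝ) : ℝ := -(m * (p * log p) + (1 - m * p) * log (1 - m * p))

noncomputable def Nm (m α p : ℝ) : ℝ := (m * p ^ α + (1 - m * p) ^ α) ^ (1 / α)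

noncomputable def Dm (m α p : ℝ) : ℝ :=
  (m * p ^ α + (1 - m * p) ^ α) ^ (1 / α - 1) *
    ((p ^ (α - 1) - (1 - m * p) ^ (α - 1)) / (log (1 - m * p) - log p))

noncomputable def sig (m p : ℝ) : ℝ := log (1 - m * p) - log p

theorem dom {m p : ℝ} (hm : 1 < m) (hp : p ∈ Set.Ioo 0 (1 / (m + 1))) : p < 1 - m * p := by
  have := hp.2
  rw [lt_div_iff₀ (by linarith)] at this
  linarith

theorem sig_pos {m p : ℝ} (hm : 1 < m) (hp : p ∈ Set.Ioo 0 (1 / (m + 1))) : 0 < sig m p :=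
  sub_pos.2 (log_lt_log hp.1 (dom hm hp))

theorem sig_anti {m : ℝ} (hm : 1 < m) : StrictAntiOn (sig m) (Set.Ioo 0 (1 / (m + 1))) := by
  intro p hp q hq hpq
  have h1 := log_lt_log hp.1 hpq
  have h2 : log (1 - m * q) < log (1 - m * p) :=
    log_lt_log (hq.1.trans (dom hm hq)) (by nlinarith)
  simp only [sig]; linarith

theorem setup {m α : ℝ} (hm : 1 < m) (hα : 0 < α) :
    Setup (1 / (m + 1)) (Hm m) (Nm m α) (Dm m α) where
  hb := by positivity
  cH := by
    unfold Hm
    have h1 := Real.continuous_mul_log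
    have h2 : Continuous fun p : ℝ => (1 - m * p) * log (1 - m * p) :=
      h1.comp (by fun_prop : Continuous fun p : ℝ => 1 - m * p)
    exact ((continuous_const.mul h1).add h2).neg
  cN := by
    unfold Nm
    refine Continuous.rpow_const ?_ (fun x => Or.inr (by positivity))
    refine (continuous_const.mul (continuous_id.rpow_const fun x => Or.inr hα.le)).add ?_
    exact (by fun_prop : Continuous fun p : ℝ => 1 - m * p).rpow_const fun x => Or.inr hα.le
  der := by
    intro p hp
    have hp0 := hp.1
    have hd := dom hm hp
    have hy : 0 < 1 - m * p := hp0.trans hd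
    have hs := sig_pos hm hp
    have hlin : HasDerivAt (fun p : ℝ => 1 - m * p) (-m) p := by
      simpa using ((hasDerivAt_id p).const_mul m).const_sub 1
    refine ⟨m * sig m p, by positivity, ?_, ?_⟩
    · have h1 := (Real.hasDerivAt_mul_log hp0.ne').const_mul m
      have h2 := (Real.hasDerivAt_mul_log hy.ne').comp p hlin
      have := (h1.add h2).neg
      refine HasDerivAt.congr_deriv (f := Hm m) this ?_
      simp only [sig]; ring
    · have hS : 0 < m * p ^ α + (1 - m * p) ^ α := by positivity
      have h1 := ((hasDerivAt_id p).rpow_const (p := α) (Or.inl hp0.ne')).const_mul m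
      have h2 := hlin.rpow_const (p := α) (Or.inl hy.ne')
      have := (h1.add h2).rpow_const (p := 1 / α) (Or.inl hS.ne')
      refine HasDerivAt.congr_deriv (f := Nm m α) this ?_
      have hs' : log (1 - m * p) - log p ≠ 0 := hs.ne'
      simp only [sig, Dm, id, Pi.add_apply]
      generalize (m * p ^ α + (1 - m * p) ^ α) ^ (1 / α - 1) = X
      field_simp
      ring

theorem Dm_eq {m α p : ℝ} (hm : 1 < m) (hα : 0 < α) (hp : p ∈ Set.Ioo 0 (1 / (m + 1))) :
    Dm m α p = Ef m α (sig m p) := by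
  have hp0 := hp.1
  have hy : 0 < 1 - m * p := hp0.trans (dom hm hp)
  have e1 : ∀ c, exp (c * sig m p) = (1 - m * p) ^ c / p ^ c := by
    intro c
    rw [rpow_def_of_pos hy, rpow_def_of_pos hp0, ← exp_sub]
    simp only [sig]; congr 1; ring
  simp only [Ef, e1, Dm]
  have e2 : m + (1 - m * p) ^ α / p ^ α = (m * p ^ α + (1 - m * p) ^ α) / p ^ α := by
    field_simp
  have hS : 0 < m * p ^ α + (1 - m * p) ^ α := by positivity
  have e3 : (p ^ α) ^ (1 / α - 1) = (p ^ (α - 1))⁻¹ := by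
    rw [← rpow_mul hp0.le, ← rpow_neg hp0.le]; congr 1; field_simp; ring
  rw [e2, div_rpow hS.le (by positivity), e3, show -(1 - α) = α - 1 by ring]
  have hs' : log (1 - m * p) - log p ≠ 0 := (sig_pos hm hp).ne'
  simp only [sig]
  generalize (m * p ^ α + (1 - m * p) ^ α) ^ (1 / α - 1) = X
  have : 0 < p ^ (α - 1) := by positivity
  field_simp

theorem sig_tendsto {m : ℝ} : Filter.Tendsto (sig m) (nhdsWithin 0 (Set.Ioi 0)) Filter.atTop := by
  unfold sig
  have h1 : Filter.Tendsto (fun p : ℝ => log (1 - m * p)) (nhdsWithin 0 (Set.Ioi 0)) (nhds 0) := by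
    have : ContinuousAt (fun p : ℝ => log (1 - m * p)) 0 :=
      ContinuousAt.log (by fun_prop) (by simp)
    have h := this.tendsto
    simp only [mul_zero, sub_zero, log_one] at h
    exact h.mono_left nhdsWithin_le_nhds
  have h2 : Filter.Tendsto (fun p : ℝ => -log p) (nhdsWithin 0 (Set.Ioi 0)) Filter.atTop :=
    Filter.tendsto_neg_atBot_atTop.comp Real.tendsto_log_nhdsGT_zero
  exact h1.add_atTop h2

theorem Hm_zero (m : ℝ) : Hm m 0 = 0 := by simp [Hm]

theorem Nm_zero (m : ℝ) {α : ℝ} (hα : 0 < α) : Nm m α 0 = 1 := by simp [Nm, hα.ne']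

theorem Hm_b {m : ℝ} (hm : 1 < m) : Hm m (1 / (m + 1)) = log (m + 1) := by
  have e : 1 - m * (1 / (m + 1)) = 1 / (m + 1) := by field_simp; ring
  simp only [Hm, e]
  rw [one_div, log_inv]
  have : m + 1 ≠ 0 := by positivity
  field_simp
  ring

theorem Nm_b {m α : ℝ} (hm : 1 < m) (hα : 0 < α) : Nm m α (1 / (m + 1)) = (m + 1) ^ (1 / α - 1) := by
  have e : 1 - m * (1 / (m + 1)) = 1 / (m + 1) := by field_simp; ring
  have hp : 0 < m + 1 := by linarith
  simp only [Nm, e]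
  have e2 : m * (1 / (m + 1)) ^ α + (1 / (m + 1)) ^ α = (m + 1) ^ (1 - α) := by
    rw [rpow_sub hp, rpow_one, div_rpow zero_le_one hp.le, one_rpow]; field_simp
  rw [e2, ← rpow_mul hp.le]
  congr 1; field_simp

theorem Dm_pos {m α p : ℝ} (hm : 1 < m) (hα : 0 < α) (hα1 : α < 1)
    (hp : p ∈ Set.Ioo 0 (1 / (m + 1))) : 0 < Dm m α p := by
  rw [Dm_eq hm hα hp]
  have hs := sig_pos hm hp
  have : exp (-(1 - α) * sig m p) < 1 := exp_lt_one_iff.2 (by nlinarith)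
  exact mul_pos (by positivity) (div_pos (by linarith) hs)

theorem Dm_neg {m α p : ℝ} (hm : 1 < m) (hα1 : 1 < α)
    (hp : p ∈ Set.Ioo 0 (1 / (m + 1))) : Dm m α p < 0 := by
  rw [Dm_eq hm (by linarith) hp]
  have hs := sig_pos hm hp
  have : 1 < exp (-(1 - α) * sig m p) := one_lt_exp_iff.2 (by nlinarith)
  exact mul_neg_of_pos_of_neg (by positivity) (div_neg_of_neg_of_pos (by linarith) hs)

theorem Ef_lower {m α s : ℝ} (hm : 1 < m) (hα : 0 < α) (hα1 : α < 1) (hs : 0 < s) :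
    (1 - α) ^ 2 / 2 * s ≤ Ef m α s := by
  have h1 : exp ((1 - α) * s) ≤ (m + exp (α * s)) ^ (1 / α - 1) := by
    have : exp ((1 - α) * s) = (exp (α * s)) ^ (1 / α - 1) := by
      rw [← exp_mul]; congr 1; field_simp
    rw [this]
    refine rpow_le_rpow (exp_pos _).le (by linarith) ?_
    rw [sub_nonneg, le_div_iff₀ hα]; linarith
  have hx : 0 < (1 - α) * s := mul_pos (by linarith) hs
  have h2 : 0 < 1 - exp (-(1 - α) * s) := by
    have : exp (-(1 - α) * s) < 1 := exp_lt_one_iff.2 (by nlinarith)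
    linarith
  have h3 := Real.quadratic_le_exp_of_nonneg hx.le
  have h4 : exp ((1 - α) * s) * exp (-(1 - α) * s) = 1 := by
    rw [← exp_add, ← add_mul]; simp
  unfold Ef
  rw [← mul_div_assoc, le_div_iff₀ hs]
  have h5 := mul_le_mul_of_nonneg_right h1 h2.le
  nlinarith

theorem Ef_lower' {m α s : ℝ} (hm : 1 < m) (hα1 : 1 < α) (hs : 0 < s) :
    -(1 / s) ≤ Ef m α s := by
  have hα : 0 < α := by linarith
  have h1 : (m + exp (α * s)) ^ (1 / α - 1) ≤ exp ((1 - α) * s) := by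
    have : exp ((1 - α) * s) = (exp (α * s)) ^ (1 / α - 1) := by
      rw [← exp_mul]; congr 1; field_simp
    rw [this]
    refine rpow_le_rpow_of_nonpos (exp_pos _) (by linarith) ?_
    rw [sub_nonpos, div_le_iff₀ hα]; linarith
  have h2 : 0 < exp (-(1 - α) * s) - 1 := by
    have : 1 < exp (-(1 - α) * s) := one_lt_exp_iff.2 (by nlinarith)
    linarith
  have h4 : exp ((1 - α) * s) * exp (-(1 - α) * s) = 1 := by
    rw [← exp_add, ← add_mul]; simp
  unfold Ef
  rw [← mul_div_assoc, ← neg_div, div_le_div_iff_of_pos_right hs]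
  have h5 := mul_le_mul_of_nonneg_right h1 h2.le
  have h6 := exp_pos ((1 - α) * s)
  nlinarith

open Filter Topology in
theorem pos_near_zero {m α : ℝ} (hm : 1 < m) (hα : 0 < α) (hα1 : α ≠ 1) :
    ∃ p ∈ Set.Ioo 0 (1 / (m + 1)), Nm m α (1 / (m + 1)) - Nm m α p <
      (Hm m (1 / (m + 1)) - Hm m p) * Dm m α p := by
  have S := setup (α := α) hm hα
  set b := 1 / (m + 1) with hb
  have hlog : 0 < log (m + 1) := log_pos (by linarith)
  have tH : Tendsto (fun p => Hm m b - Hm m p) (𝓝[>] 0) (𝓝 (log (m + 1))) := by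
    have : Tendsto (fun p => Hm m b - Hm m p) (𝓝 0) (𝓝 (Hm m b - Hm m 0)) := (continuous_const.sub S.cH : Continuous fun p => Hm m b - Hm m p).tendsto 0
    simp only [Hm_zero, sub_zero, hb, Hm_b hm] at this
    rw [hb, Hm_b hm]
    exact this.mono_left nhdsWithin_le_nhds
  have tN : Tendsto (fun p => Nm m α b - Nm m α p) (𝓝[>] 0) (𝓝 ((m + 1) ^ (1 / α - 1) - 1)) := by
    have : Tendsto (fun p => Nm m α b - Nm m α p) (𝓝 0) (𝓝 (Nm m α b - Nm m α 0)) := (continuous_const.sub S.cN : Continuous fun p => Nm m α b - Nm m α p).tendsto 0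
    simp only [Nm_zero m hα, hb, Nm_b hm hα] at this
    rw [hb, Nm_b hm hα]
    exact this.mono_left nhdsWithin_le_nhds
  have hI : ∀ᶠ p in 𝓝[>] (0:ℝ), p ∈ Set.Ioo 0 b := Ioo_mem_nhdsGT S.hb
  have hHpos : ∀ p ∈ Set.Ioo 0 b, 0 < Hm m b - Hm m p := fun p hp =>
    sub_pos.2 (S.H_mono ⟨hp.1.le, hp.2.le⟩ ⟨S.hb.le, le_rfl⟩ hp.2)
  rcases lt_or_gt_of_ne hα1 with h1 | h1
  · have hc : 0 < (1 - α) ^ 2 / 2 := by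
      have : 0 < 1 - α := by linarith
      positivity
    have t := tH.pos_mul_atTop hlog ((sig_tendsto (m := m)).const_mul_atTop hc)
    have e1 := t.eventually_gt_atTop ((m + 1) ^ (1 / α - 1) - 1 + 1)
    have e2 := tN.eventually (gt_mem_nhds (lt_add_one _))
    obtain ⟨p, hp, h2, h3⟩ := (hI.and (e1.and e2)).exists
    refine ⟨p, hp, h3.trans (h2.trans_le ?_)⟩
    rw [Dm_eq hm hα hp]
    exact mul_le_mul_of_nonneg_left (Ef_lower hm hα h1 (sig_pos hm hp)) (hHpos p hp).le
  · have t := tH.mul (tendsto_inv_atTop_zero.comp (sig_tendsto (m := m))).neg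
    rw [neg_zero, mul_zero] at t
    have hlt : (m + 1) ^ (1 / α - 1) - 1 < 0 := by
      rw [sub_neg]
      refine rpow_lt_one_of_one_lt_of_neg (by linarith) ?_
      rw [sub_neg, div_lt_iff₀ hα]; linarith
    have e := tN.eventually_lt t hlt
    obtain ⟨p, hp, h2⟩ := (hI.and e).exists
    refine ⟨p, hp, h2.trans_le ?_⟩
    rw [Dm_eq hm hα hp]
    refine mul_le_mul_of_nonneg_left ?_ (hHpos p hp).le
    have := Ef_lower' hm h1 (sig_pos hm hp)
    simpa using this

theorem sig_surj {m s : ℝ} (hm : 1 < m) (hs : 0 < s) :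
    1 / (m + exp s) ∈ Set.Ioo 0 (1 / (m + 1)) ∧ sig m (1 / (m + exp s)) = s := by
  have h1 : 1 < exp s := one_lt_exp_iff.2 hs
  refine ⟨⟨by positivity, one_div_lt_one_div_of_lt (by linarith) (by linarith)⟩, ?_⟩
  have e : 1 - m * (1 / (m + exp s)) = exp s / (m + exp s) := by field_simp; ring
  simp only [sig, e]
  rw [log_div (by positivity) (by positivity), log_div (by positivity) (by positivity), log_exp]
  simp

theorem Dm_mono {m α : ℝ} (hm : 1 < m) (hα : 0 < α) (hα1 : α ≠ 1) :
    ∃ p0 ∈ Set.Ioo 0 (1 / (m + 1)), StrictAntiOn (Dm m α) (Set.Ioc 0 p0) ∧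
      StrictMonoOn (Dm m α) (Set.Ico p0 (1 / (m + 1))) := by
  obtain ⟨s0, hs0, h1, h2⟩ := Ef_mono hm hα hα1
  obtain ⟨hp0, hs⟩ := sig_surj hm hs0
  set p0 := 1 / (m + exp s0)
  refine ⟨p0, hp0, ?_, ?_⟩
  · intro p hp q hq hpq
    have hp' : p ∈ Set.Ioo 0 (1 / (m + 1)) := ⟨hp.1, hp.2.trans_lt hp0.2⟩
    have hq' : q ∈ Set.Ioo 0 (1 / (m + 1)) := ⟨hq.1, hq.2.trans_lt hp0.2⟩
    rw [Dm_eq hm hα hp', Dm_eq hm hα hq']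
    refine h2 ?_ ?_ (sig_anti hm hp' hq' hpq)
    · rw [Set.mem_Ici, ← hs]; exact (sig_anti hm).antitoneOn hq' hp0 hq.2
    · rw [Set.mem_Ici, ← hs]; exact (sig_anti hm).antitoneOn hp' hp0 hp.2
  · intro p hp q hq hpq
    have hp' : p ∈ Set.Ioo 0 (1 / (m + 1)) := ⟨hp0.1.trans_le hp.1, hp.2⟩
    have hq' : q ∈ Set.Ioo 0 (1 / (m + 1)) := ⟨hp0.1.trans_le hq.1, hq.2⟩
    rw [Dm_eq hm hα hp', Dm_eq hm hα hq']
    refine h1 ⟨sig_pos hm hq', ?_⟩ ⟨sig_pos hm hp', ?_⟩ (sig_anti hm hp' hq' hpq)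
    · rw [← hs]; exact (sig_anti hm).antitoneOn hp0 hq' hq.1
    · rw [← hs]; exact (sig_anti hm).antitoneOn hp0 hp' hp.1

theorem Dm_cont {m α : ℝ} (hm : 1 < m) (hα : 0 < α) :
    ContinuousOn (Dm m α) (Set.Ioo 0 (1 / (m + 1))) := by
  have h1 : ContinuousOn (sig m) (Set.Ioo 0 (1 / (m + 1))) := by
    unfold sig
    refine ContinuousOn.sub (ContinuousOn.log (by fun_prop) ?_) (ContinuousOn.log (by fun_prop) ?_)
    · intro p hp; exact (hp.1.trans (dom hm hp)).ne'
    · intro p hp; exact hp.1.ne'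
  have h2 : ContinuousOn (Ef m α) (Set.Ioi 0) := fun s hs =>
    (Ef_deriv hm hα hs).continuousAt.continuousWithinAt
  exact (h2.comp h1 fun p hp => sig_pos hm hp).congr fun p hp => Dm_eq hm hα hp

theorem sum_vVec (n : ℕ) (hn : 3 ≤ n) (p : ℝ) (f : ℝ → ℝ) :
    ∑ i, f (vVec n p i) = ((n : ℝ) - 1) * f p + f (1 - ((n : ℝ) - 1) * p) := by
  obtain ⟨k, rfl⟩ : ∃ k, n = k + 1 := ⟨n - 1, by omega⟩
  rw [Fin.sum_univ_succ]
  simp [vVec]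
  ring

theorem Hv_eq (n : ℕ) (hn : 3 ≤ n) : Hv n = Hm ((n : ℝ) - 1) := by
  funext p
  have := sum_vVec n hn p (fun x => x * log x)
  simp only [Hv, shannonEntropy, Hm, this]

theorem lNorm_eq (n : ℕ) (hn : 3 ≤ n) (α p : ℝ) :
    lNorm α (vVec n p) = Nm ((n : ℝ) - 1) α p := by
  have := sum_vVec n hn p (fun x => x ^ α)
  simp only [lNorm, Nm, this]

theorem stmt8 (n : ℕ) (hn : 3 ≤ n) (α : ℝ)
    (hα : α ∈ Set.Ico (1 / 2 : ℝ) 1 ∪ Set.Ioi 1) :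
    (∃! pstar : ℝ, pstar ∈ Set.Ioo (0 : ℝ) (1 / (n : ℝ)) ∧ TangencyEq n α pstar) ∧
    (∀ pstar ∈ Set.Ioo (0 : ℝ) (1 / (n : ℝ)), TangencyEq n α pstar →
      ∀ L : ℝ → ℝ,
        (∀ p ∈ Set.Icc (0 : ℝ) (1 / (n : ℝ)), Hv n p ≤ Hv n pstar →
          L (Hv n p) = lNorm α (vVec n p)) →
        (∀ h ∈ Set.Icc (0 : ℝ) (Real.log n), Hv n pstar < h →
          L h = ((Real.log n - h) / (Real.log n - Hv n pstar)) * lNorm α (vVec n pstar) +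
            (1 - (Real.log n - h) / (Real.log n - Hv n pstar)) * (n : ℝ) ^ (1 / α - 1)) →
        (α < 1 → StrictMonoOn L (Set.Icc 0 (Real.log n))) ∧
        (1 < α → StrictAntiOn L (Set.Icc 0 (Real.log n))) ∧
        ConcaveOn ℝ (Set.Icc 0 (Real.log n)) L) := by
  have hm : (1 : ℝ) < (n : ℝ) - 1 := by
    have : (3 : ℝ) ≤ n := by exact_mod_cast hn
    linarith
  have hα0 : 0 < α := by
    rcases hα with h | h
    · linarith [h.1]
    · linarith [Set.mem_Ioi.1 h]
  have hα1 : α ≠ 1 := by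
    rcases hα with h | h
    · exact h.2.ne
    · exact (Set.mem_Ioi.1 h).ne'
  have hn1 : (n : ℝ) - 1 + 1 = n := by ring
  have hD : ∀ p, Dva n α p = Dm ((n : ℝ) - 1) α p := fun p => rfl
  have S := setup (α := α) hm hα0
  have hHb := Hm_b hm
  have hNb := Nm_b hm hα0
  have hH0 := Hm_zero ((n : ℝ) - 1)
  obtain ⟨p0, hp0, hanti, hmono⟩ := Dm_mono hm hα0 hα1
  have hEU := S.exists_unique hp0 hanti hmono (Dm_cont hm hα0) (pos_near_zero hm hα0 hα1)
  have hpos := fun (h : α < 1) p hp => Dm_pos (p := p) hm hα0 h hp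
  have hneg := fun (h : 1 < α) p hp => Dm_neg (p := p) hm h hp
  simp only [TangencyEq, hD, Hv_eq n hn, lNorm_eq n hn]
  rw [hn1] at *
  rw [← hHb, ← hNb]
  refine ⟨hEU, ?_⟩
  intro r hr ht L hL1 hL2
  have hlt := S.root_lt hp0 hmono hr ht
  rw [← hH0] at hL2 ⊢
  obtain ⟨c1, c2, c3⟩ := S.concl hr
    (hanti.mono fun x hx => ⟨hx.1, hx.2.trans hlt.le⟩) ht hL1 hL2
  exact ⟨fun h => c1 (hpos h), fun h => c2 (hneg h), c3⟩
end

section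
/- Let n ≥ 2 be an integer and α ∈ (0,1) ∪ (1,∞). For every finite joint source with X-alphabet of size n, setting h = ∑_{y∈Y} q_y·H(p_y), one has ∑_{y∈Y} q_y·‖p_y‖_α ≥ L_min^α(h). -/
open Real

/-- `L_min^α(h) = λ·m^(1/α−1) + (1−λ)·(m+1)^(1/α−1)` where `m = ⌊e^h⌋` and
`λ = (ln(m+1) − h)/(ln(m+1) − ln m)`. -/
noncomputable def Lmin (α h : ℝ) : ℝ :=
  ((Real.log ((⌊Real.exp h⌋₊ : ℝ) + 1) - h) /
      (Real.log ((⌊Real.exp h⌋₊ : ℝ) + 1) - Real.log (⌊Real.exp h⌋₊ : ℝ))) *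
    (⌊Real.exp h⌋₊ : ℝ) ^ (1 / α - 1) +
  (1 - (Real.log ((⌊Real.exp h⌋₊ : ℝ) + 1) - h) /
      (Real.log ((⌊Real.exp h⌋₊ : ℝ) + 1) - Real.log (⌊Real.exp h⌋₊ : ℝ))) *
    ((⌊Real.exp h⌋₊ : ℝ) + 1) ^ (1 / α - 1)


open Filter Topology

lemma aux_second (h h' : ℝ → ℝ) (d : ℝ) (hmin : IsLocalMin h 0)
    (h1 : ∀ᶠ e in 𝓝 (0:ℝ), HasDerivAt h (h' e) e) (h2 : HasDerivAt h' d 0) :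
    h' 0 = 0 ∧ 0 ≤ d := by
  have h0 : h' 0 = 0 := hmin.hasDerivAt_eq_zero h1.self_of_nhds
  refine ⟨h0, ?_⟩
  by_contra hd
  push Not at hd
  have e1 : deriv h =ᶠ[𝓝 0] h' := h1.mono fun e he => he.deriv
  have hm : IsLocalMin (fun x => - h x) 0 := by
    apply isLocalMin_of_deriv_deriv_pos
    · have e2 : deriv (fun x => - h x) =ᶠ[𝓝 0] fun x => - h' x :=
        h1.mono fun e he => he.neg.deriv
      rw [e2.deriv_eq, h2.fun_neg.deriv]; linarith
    · rw [h1.self_of_nhds.fun_neg.deriv, h0]; simp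
    · exact h1.self_of_nhds.fun_neg.continuousAt
  have e3 : h =ᶠ[𝓝 0] fun _ => h 0 := by
    filter_upwards [hmin, hm] with x a b
    linarith
  have e4 : ∀ᶠ e in 𝓝 (0:ℝ), h' e = 0 := by
    filter_upwards [e3.eventually_nhds, h1] with x a b
    have a' : h =ᶠ[𝓝 x] fun _ => h 0 := a
    have := a'.deriv_eq
    rw [b.deriv] at this
    simpa using this
  have e5 : h' =ᶠ[𝓝 0] fun _ => (0:ℝ) := e4
  have := e5.deriv_eq
  rw [h2.deriv] at this
  simp at this
  linarith

lemma aux_core (x y J : ℝ) (hx : 0 < x) (hyx : y < x) (hy : y ≠ 0) (hJ : 1 ≤ J) :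
    y * J * (1 - exp y) ^ 2 / (J + exp (y - x)) + (exp y - 1 - y)
      + J * exp x * (exp y - 1 - y * exp y) < 0 := by
  have hE : 0 < exp y := exp_pos y
  have hX : 0 < exp x := exp_pos x
  have key : y * (exp y - 1) < (y * exp y - exp y + 1) * (J * exp (x - y) + 1) := by
    have hpos : 0 < y * exp y - exp y + 1 := by
      have := add_one_lt_exp (x := -y) (by simpa using hy)
      have h2 : exp (-y) * exp y = 1 := by rw [← exp_add]; simp
      nlinarith
    rcases lt_or_gt_of_ne hy with hy | hy
    · have h1 : exp (-y) < J * exp (x - y) := by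
        have : exp (-y) < exp (x - y) := exp_lt_exp.2 (by linarith)
        nlinarith [exp_pos (x - y)]
      have h2 : y * (exp y - 1) < (y * exp y - exp y + 1) * (exp (-y) + 1) := by
        have h2 : exp (-y) * exp y = 1 := by rw [← exp_add]; simp
        have h3 : -y < sinh (-y) := self_lt_sinh_iff.2 (by linarith)
        rw [sinh_eq, neg_neg] at h3
        have : (y * exp y - exp y + 1) * (exp (-y) + 1) = 
          y * (exp (-y) * exp y) + y * exp y - (exp (-y) * exp y) - exp y + exp (-y) + 1 := by ring
        rw [this, h2]
        linarith
      nlinarith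
    · have h1 : 1 < J * exp (x - y) := by
        have : 1 < exp (x - y) := by rw [← exp_zero]; exact exp_lt_exp.2 (by linarith)
        nlinarith
      have h2 : y * (exp y - 1) < (y * exp y - exp y + 1) * 2 := by
        have h3 : y / 2 * cosh (y/2) > sinh (y/2) := by
          have hmono : StrictMonoOn (fun t => t * cosh t - sinh t) (Set.Ici 0) := by
            apply strictMonoOn_of_deriv_pos (convex_Ici 0) (by fun_prop)
            intro t ht
            simp at ht
            have : HasDerivAt (fun t => t * cosh t - sinh t) (1 * cosh t + t * sinh t - cosh t) t :=
              ((hasDerivAt_id t).mul (hasDerivAt_cosh t)).sub (hasDerivAt_sinh t)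
            rw [this.deriv]
            have := sinh_pos_iff.2 ht
            have := mul_pos ht this
            linarith
          have := hmono (a := 0) (b := y/2) (by simp) (by simp; linarith) (by linarith)
          simp at this
          linarith
        rw [sinh_eq, cosh_eq] at h3
        have e1 : exp y = exp (y/2) * exp (y/2) := by rw [← exp_add]; ring_nf
        have e2 : exp (y/2) * exp (-(y/2)) = 1 := by rw [← exp_add]; simp
        have e3 := exp_pos (y/2)
        have := mul_lt_mul_of_pos_right h3 e3
        have l : (exp (y / 2) - exp (-(y / 2))) / 2 * exp (y / 2) = (exp y - 1)/2 := by
          rw [e1, ← e2]; ring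
        have l2 : y / 2 * ((exp (y / 2) + exp (-(y / 2))) / 2) * exp (y / 2) = y/2*(exp y + 1)/2 := by
          rw [e1, ← e2]; ring
        rw [l, l2] at this
        linarith
      nlinarith
  rw [exp_sub] at key ⊢
  set E := exp y
  set X := exp x
  have hD : 0 < J * X + E := by positivity
  have k2 : y * (E - 1) * E < (y * E - E + 1) * (J * X + E) := by
    have := mul_lt_mul_of_pos_right key hE
    have e : (y * E - E + 1) * (J * (X / E) + 1) * E = (y * E - E + 1) * (J * X + E) := by
      field_simp
    rwa [e] at this
  have e : y * J * (1 - E) ^ 2 / (J + E / X) + (E - 1 - y)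
      + J * X * (E - 1 - y * E) = 
      (J * X + 1) / (J * X + E) * (y * (E - 1) * E - (y * E - E + 1) * (J * X + E)) := by
    field_simp
    ring
  rw [e]
  apply mul_neg_of_pos_of_neg
  · positivity
  · linarith

/-- objective -/
noncomputable def auxF {n : ℕ} (α s : ℝ) (p : Fin n → ℝ) : ℝ :=
  (∑ i, p i ^ α) ^ (1 / α) + s * ∑ i, p i * Real.log (p i)

lemma aux_d1 {n : ℕ} (α s : ℝ) (hα : 0 < α) (p v : Fin n → ℝ) (e : ℝ)
    (hS : 0 < ∑ i, (p i + e * v i) ^ α)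
    (hp : ∀ i, (p i = 0 ∧ v i = 0) ∨ 0 < p i + e * v i) :
    HasDerivAt (fun e => auxF α s (fun i => p i + e * v i))
      ((∑ i, (p i + e * v i) ^ α) ^ (1 / α - 1) * (∑ i, v i * (p i + e * v i) ^ (α - 1))
        + s * ∑ i, v i * (Real.log (p i + e * v i) + 1)) e := by
  have hl : ∀ i, HasDerivAt (fun e => p i + e * v i) (v i) e := fun i => by
    simpa using ((hasDerivAt_id e).mul_const (v i)).const_add (p i)
  have hA : HasDerivAt (fun e => ∑ i, (p i + e * v i) ^ α)
      (∑ i, v i * α * (p i + e * v i) ^ (α - 1)) e := by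
    apply HasDerivAt.fun_sum
    intro i _
    rcases hp i with h | h
    · simp only [h.1, h.2, mul_zero, add_zero, zero_mul]; exact hasDerivAt_const _ _
    · exact (hl i).rpow_const (Or.inl h.ne')
  have hB : HasDerivAt (fun e => ∑ i, (p i + e * v i) * Real.log (p i + e * v i))
      (∑ i, v i * (Real.log (p i + e * v i) + 1)) e := by
    apply HasDerivAt.fun_sum
    intro i _
    rcases hp i with h | h
    · simp only [h.1, h.2, mul_zero, add_zero, zero_mul]; exact hasDerivAt_const _ _
    · refine ((hl i).fun_mul ((hl i).log h.ne')).congr_deriv ?_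
      have h' := h.ne'
      generalize p i + e * v i = t at *
      field_simp
  unfold auxF
  refine ((hA.rpow_const (p := 1 / α) (Or.inl hS.ne')).fun_add (hB.const_mul s)).congr_deriv ?_
  congr 1
  have : ∑ i, v i * α * (p i + e * v i) ^ (α - 1) = α * ∑ i, v i * (p i + e * v i) ^ (α - 1) := by
    rw [Finset.mul_sum]; exact Finset.sum_congr rfl fun i _ => by ring
  rw [this]
  generalize ∑ i, v i * (p i + e * v i) ^ (α - 1) = t at *
  field_simp

lemma aux_d2 {n : ℕ} (α s : ℝ) (hα : 0 < α) (p v : Fin n → ℝ)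
    (hS : 0 < ∑ i, (p i) ^ α)
    (hp : ∀ i, (p i = 0 ∧ v i = 0) ∨ 0 < p i) :
    HasDerivAt (fun e => ((∑ i, (p i + e * v i) ^ α) ^ (1 / α - 1) *
        (∑ i, v i * (p i + e * v i) ^ (α - 1))
        + s * ∑ i, v i * (Real.log (p i + e * v i) + 1)))
      ((1 - α) * ((∑ i, (p i) ^ α) ^ (1 / α - 1) / (∑ i, (p i) ^ α)) *
          (∑ i, v i * p i ^ (α - 1)) ^ 2
        + ∑ i, v i ^ 2 * ((∑ i, (p i) ^ α) ^ (1 / α - 1) * (α - 1) * p i ^ (α - 1) + s) / p i) 0 := by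
  have hl : ∀ i, HasDerivAt (fun e => p i + e * v i) (v i) 0 := fun i => by
    simpa using ((hasDerivAt_id (0:ℝ)).mul_const (v i)).const_add (p i)
  have hA : HasDerivAt (fun e => ∑ i, (p i + e * v i) ^ α)
      (∑ i, v i * α * (p i + 0 * v i) ^ (α - 1)) 0 := by
    apply HasDerivAt.fun_sum
    intro i _
    rcases hp i with h | h
    · simp only [h.1, h.2, mul_zero, add_zero, zero_mul]; exact hasDerivAt_const _ _
    · exact (hl i).rpow_const (Or.inl (by simpa using h.ne'))
  have hC : HasDerivAt (fun e => ∑ i, v i * (p i + e * v i) ^ (α - 1))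
      (∑ i, v i * (v i * (α - 1) * (p i + 0 * v i) ^ (α - 1 - 1))) 0 := by
    apply HasDerivAt.fun_sum
    intro i _
    rcases hp i with h | h
    · simp only [h.1, h.2, mul_zero, add_zero, zero_mul]; exact hasDerivAt_const _ _
    · exact ((hl i).rpow_const (Or.inl (by simpa using h.ne'))).const_mul _
  have hB : HasDerivAt (fun e => ∑ i, v i * (Real.log (p i + e * v i) + 1))
      (∑ i, v i * (v i / (p i + 0 * v i))) 0 := by
    apply HasDerivAt.fun_sum
    intro i _
    rcases hp i with h | h
    · simp only [h.1, h.2, mul_zero, add_zero, zero_mul]; exact hasDerivAt_const _ _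
    · exact (((hl i).log (by simpa using h.ne')).add_const 1).const_mul _
  have hT := ((hA.rpow_const (p := 1 / α - 1) (Or.inl (by simpa using hS.ne'))).fun_mul hC).fun_add
    (hB.const_mul s)
  refine hT.congr_deriv ?_
  simp only [zero_mul, add_zero]
  have e1 : ∑ i, v i * α * (p i) ^ (α - 1) = α * ∑ i, v i * (p i) ^ (α - 1) := by
    rw [Finset.mul_sum]; exact Finset.sum_congr rfl fun i _ => by ring
  rw [e1, rpow_sub_one hS.ne' (1 / α - 1)]
  set S := ∑ i, (p i) ^ α
  set A := S ^ (1 / α - 1)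
  have e2 : ∑ i, v i ^ 2 * (A * (α - 1) * p i ^ (α - 1) + s) / p i
     = A * ∑ i, v i * (v i * (α - 1) * (p i) ^ (α - 1 - 1)) + s * ∑ i, v i * (v i / p i) := by
    rw [Finset.mul_sum, Finset.mul_sum, ← Finset.sum_add_distrib]
    refine Finset.sum_congr rfl fun i _ => ?_
    rcases hp i with h | h
    · simp [h.2]
    · rw [rpow_sub_one h.ne' (α - 1)]
      field_simp
  rw [e2]
  field_simp
  ring

/-- first and second order conditions at a minimizer -/
lemma aux_cond {n : ℕ} (α s : ℝ) (hα : 0 < α) (p v : Fin n → ℝ)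
    (hp : IsProbVec p) (hmin : ∀ p' : Fin n → ℝ, IsProbVec p' → auxF α s p ≤ auxF α s p')
    (hS : 0 < ∑ i, (p i) ^ α)
    (hv : ∑ i, v i = 0) (hpv : ∀ i, p i = 0 → v i = 0) :
    ∑ i, v i * ((∑ i, (p i) ^ α) ^ (1 / α - 1) * p i ^ (α - 1) + s * Real.log (p i)) = 0 ∧
    0 ≤ (1 - α) * ((∑ i, (p i) ^ α) ^ (1 / α - 1) / (∑ i, (p i) ^ α)) *
          (∑ i, v i * p i ^ (α - 1)) ^ 2
        + ∑ i, v i ^ 2 * ((∑ i, (p i) ^ α) ^ (1 / α - 1) * (α - 1) * p i ^ (α - 1) + s) / p i := by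
  have hp' : ∀ i, (p i = 0 ∧ v i = 0) ∨ 0 < p i := fun i => by
    rcases (hp.1 i).eq_or_lt with h | h
    · exact Or.inl ⟨h.symm, hpv i h.symm⟩
    · exact Or.inr h
  have ev : ∀ᶠ e in 𝓝 (0:ℝ), ∀ i, (p i = 0 ∧ v i = 0) ∨ 0 < p i + e * v i := by
    rw [eventually_all]
    intro i
    rcases hp' i with h | h
    · exact Eventually.of_forall fun _ => Or.inl h
    · have : ContinuousAt (fun e => p i + e * v i) 0 := by fun_prop
      filter_upwards [this.eventually (lt_mem_nhds (a := 0) (by simpa using h))] with e he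
      exact Or.inr he
  have evS : ∀ᶠ e in 𝓝 (0:ℝ), 0 < ∑ i, (p i + e * v i) ^ α := by
    have : ContinuousAt (fun e => ∑ i, (p i + e * v i) ^ α) 0 := by
      apply Continuous.continuousAt
      refine continuous_finsetSum _ fun i _ => ?_
      exact Continuous.rpow_const (by fun_prop) (fun _ => Or.inr hα.le)
    exact this.eventually (lt_mem_nhds (a := 0) (by simpa using hS))
  have hlm : IsLocalMin (fun e => auxF α s (fun i => p i + e * v i)) 0 := by
    filter_upwards [ev] with e he
    simp only [zero_mul, add_zero]
    apply hmin
    refine ⟨fun i => ?_, ?_⟩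
    · rcases he i with h | h
      · simp [h.1, h.2]
      · exact h.le
    · rw [Finset.sum_add_distrib, ← Finset.mul_sum, hv, hp.2]; simp
  have := aux_second _ _ _ hlm
    ((ev.and evS).mono fun e he => aux_d1 α s hα p v e he.2 he.1) (aux_d2 α s hα p v hS hp')
  refine ⟨?_, this.2⟩
  have h1 := this.1
  simp only [zero_mul, add_zero] at h1
  rw [← h1, Finset.mul_sum, Finset.mul_sum, ← Finset.sum_add_distrib]
  have : ∑ i, v i * ((∑ i, (p i) ^ α) ^ (1 / α - 1) * p i ^ (α - 1) + s * Real.log (p i))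
    = ∑ i, v i * ((∑ i, (p i) ^ α) ^ (1 / α - 1) * p i ^ (α - 1) + s * Real.log (p i)) + s * ∑ i, v i := by
    rw [hv]; ring
  rw [this, Finset.mul_sum, ← Finset.sum_add_distrib]
  refine Finset.sum_congr rfl fun i _ => by ring

lemma aux_pair (α s A a b : ℝ) (hA : 0 < A) (hα : α ≠ 1) (ha : 0 < a) (hab : a < b)
    (h : A * a ^ (α - 1) + s * Real.log a = A * b ^ (α - 1) + s * Real.log b) :
    ∃ x y : ℝ, 0 < x ∧ y = (1 - α) * x ∧ y ≠ 0 ∧ a = b * exp (-x) ∧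
      a ^ (α - 1) = b ^ (α - 1) * exp y ∧ s * x = A * b ^ (α - 1) * (exp y - 1) ∧
      A * (α - 1) * a ^ (α - 1) + s < 0 ∧ 0 < A * (α - 1) * b ^ (α - 1) + s := by
  have hb : 0 < b := ha.trans hab
  have hx : 0 < Real.log b - Real.log a := sub_pos.2 (Real.log_lt_log ha hab)
  obtain ⟨x, hxd⟩ : ∃ x, x = Real.log b - Real.log a := ⟨_, rfl⟩
  obtain ⟨y, hyd⟩ : ∃ y, y = (1 - α) * x := ⟨_, rfl⟩
  have hy : y ≠ 0 := by
    rw [hyd, hxd]; exact mul_ne_zero (sub_ne_zero.2 hα.symm) hx.ne'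
  rw [← hxd] at hx
  have e1 : a ^ (α - 1) = b ^ (α - 1) * exp y := by
    rw [rpow_def_of_pos ha, rpow_def_of_pos hb, ← exp_add]
    congr 1
    rw [hyd, hxd]; ring
  have hr : 0 < b ^ (α - 1) := by positivity
  have e2 : s * x = A * b ^ (α - 1) * (exp y - 1) := by
    rw [e1] at h; rw [hxd]; linarith
  have hAr : 0 < A * b ^ (α - 1) := by positivity
  refine ⟨x, y, hx, hyd, hy, ?_, e1, e2, ?_, ?_⟩
  · rw [hxd, neg_sub, exp_sub, exp_log ha, exp_log hb]; field_simp
  · have h1 : exp y - 1 - y * exp y < 0 := by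
      have := add_one_lt_exp (x := -y) (by simpa using hy)
      have h2 : exp (-y) * exp y = 1 := by rw [← exp_add]; simp
      nlinarith [exp_pos y]
    have h2 := mul_neg_of_pos_of_neg hAr h1
    rw [e1]
    have : (A * (α - 1) * (b ^ (α - 1) * exp y) + s) * x = 
      A * b ^ (α - 1) * (exp y - 1 - y * exp y) := by
      rw [add_mul, e2, hyd]; ring
    by_contra hc
    push Not at hc
    have := mul_nonneg hc hx.le
    linarith
  · have h1 : 0 < exp y - 1 - y := by
      have := add_one_lt_exp hy
      linarith
    have h2 := mul_pos hAr h1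
    have : (A * (α - 1) * b ^ (α - 1) + s) * x = 
      A * b ^ (α - 1) * (exp y - 1 - y) := by
      rw [add_mul, e2, hyd]; ring
    by_contra hc
    push Not at hc
    have := mul_nonpos_of_nonpos_of_nonneg hc hx.le
    linarith

lemma aux_sum {n : ℕ} (p : Fin n → ℝ) (r X Y : ℝ) (l : Fin n) (hl : p l ≠ r) :
    ∑ i, (if p i = r then X else if i = l then Y else 0)
      = ((Finset.univ.filter (fun i => p i = r)).card : ℝ) * X + Y := by
  have : ∀ i, (if p i = r then X else if i = l then Y else 0) =
      (if p i = r then X else 0) + (if i = l then Y else 0) := by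
    intro i
    by_cases h : p i = r
    · have : i ≠ l := fun h' => hl (h' ▸ h)
      simp [h, this]
    · simp [h]
  simp_rw [this]
  rw [Finset.sum_add_distrib]
  simp [Finset.sum_ite]

lemma aux_min {n : ℕ} (α s : ℝ) (hα : 0 < α) (hα1 : α ≠ 1) (p : Fin n → ℝ)
    (hp : IsProbVec p)
    (hmin : ∀ p' : Fin n → ℝ, IsProbVec p' → auxF α s p ≤ auxF α s p') :
    ∃ j : ℕ, 1 ≤ j ∧ auxF α s p = (j : ℝ) ^ (1 / α - 1) - s * Real.log j := by
  have hne : Nonempty (Fin n) := by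
    by_contra h
    rw [not_nonempty_iff] at h
    have := hp.2
    simp at this
  obtain ⟨i0, hi0⟩ := Finite.exists_max p
  obtain ⟨r, hr⟩ : ∃ r, r = p i0 := ⟨_, rfl⟩
  rw [← hr] at hi0
  have hr0 : 0 < r := by
    by_contra h
    push Not at h
    have : ∑ i, p i ≤ 0 := Finset.sum_nonpos fun i _ => (hi0 i).trans h
    rw [hp.2] at this
    linarith
  have hS : 0 < ∑ i, (p i) ^ α := by
    apply Finset.sum_pos' (fun i _ => rpow_nonneg (hp.1 i) _)
    exact ⟨i0, Finset.mem_univ _, by rw [← hr]; positivity⟩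
  have cond := fun v => aux_cond α s hα p v hp hmin hS
  have hA : 0 < (∑ i, (p i) ^ α) ^ (1 / α - 1) := by positivity
  obtain ⟨S, hSd⟩ : ∃ S, S = ∑ i, (p i) ^ α := ⟨_, rfl⟩
  rw [← hSd] at hS hA
  obtain ⟨A, hAd⟩ : ∃ A, A = S ^ (1 / α - 1) := ⟨_, rfl⟩
  rw [← hAd] at hA
  simp only [← hSd, ← hAd] at cond
  -- first order condition
  have fo : ∀ i j, 0 < p i → 0 < p j → 
      A * p i ^ (α - 1) + s * Real.log (p i) = A * p j ^ (α - 1) + s * Real.log (p j) := by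
    intro i j hi hj
    have := (cond (fun k => (if k = i then 1 else 0) - (if k = j then 1 else 0))
      (by simp [Finset.sum_sub_distrib])
      (by
        intro k hk
        have h1 : k ≠ i := fun h => by rw [← h] at hi; linarith
        have h2 : k ≠ j := fun h => by rw [← h] at hj; linarith
        simp [h1, h2])).1
    simp [sub_mul, Finset.sum_sub_distrib] at this
    linarith
  have lt_case : ∀ i, 0 < p i → p i ≠ r → A * (α - 1) * p i ^ (α - 1) + s < 0 := by
    intro i hi hir
    obtain ⟨x, y, -, -, -, -, -, -, h, -⟩ := aux_pair α s A (p i) r hA hα1 hi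
      (lt_of_le_of_ne (hi0 i) hir) (by rw [hr]; exact fo i i0 hi (hr ▸ hr0))
    exact h
  have uniq : ∀ i j, 0 < p i → p i ≠ r → 0 < p j → p j ≠ r → i = j := by
    intro i j hi hir hj hjr
    by_contra hij
    rcases lt_trichotomy (p i) (p j) with h | h | h
    · obtain ⟨x, y, -, -, -, -, -, -, -, h⟩ := aux_pair α s A _ _ hA hα1 hi h (fo i j hi hj)
      linarith [lt_case j hj hjr]
    · have := (cond (fun k => (if k = i then 1 else 0) - (if k = j then 1 else 0))
        (by simp [Finset.sum_sub_distrib])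
        (by
          intro k hk
          have h1 : k ≠ i := fun h => by rw [← h] at hi; linarith
          have h2 : k ≠ j := fun h => by rw [← h] at hj; linarith
          simp [h1, h2])).2
      have sq : ∀ k, ((if k = i then (1:ℝ) else 0) - (if k = j then 1 else 0)) ^ 2 = 
         (if k = i then 1 else 0) + (if k = j then 1 else 0) := by
        intro k
        by_cases h1 : k = i
        · have h2 : k ≠ j := fun h => hij (h1.symm.trans h)
          simp [h1, hij]
        · simp [h1]
      simp only [sq, mul_div_assoc] at this
      simp [sub_mul, add_mul, Finset.sum_sub_distrib, Finset.sum_add_distrib, h] at this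
      have h3 := lt_case j hj hjr
      have h4 := div_neg_of_neg_of_pos h3 hj
      linarith
    · obtain ⟨x, y, -, -, -, -, -, -, -, h⟩ := aux_pair α s A _ _ hA hα1 hj h (fo j i hj hi)
      linarith [lt_case i hi hir]
  obtain ⟨J, hJ⟩ : ∃ J, J = (Finset.univ.filter (fun i => p i = r)).card := ⟨_, rfl⟩
  have hJ1 : 1 ≤ J := by
    rw [hJ]
    exact Finset.card_pos.2 ⟨i0, by simp [hr]⟩
  have hJ1' : (1:ℝ) ≤ J := by exact_mod_cast hJ1
  by_cases hex : ∃ l, 0 < p l ∧ p l ≠ r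
  · exfalso
    obtain ⟨l, hl, hlr⟩ := hex
    have hz : ∀ i, i ≠ l → p i ≠ r → p i = 0 := by
      intro i h1 h2
      by_contra h3
      exact h1 (uniq i l (lt_of_le_of_ne (hp.1 i) (Ne.symm h3)) h2 hl hlr)
    obtain ⟨x, y, hx, hyd, hy, hu, hu', hs, -, -⟩ := aux_pair α s A (p l) r hA hα1 hl
      (lt_of_le_of_ne (hi0 l) hlr) (by rw [hr]; exact fo l i0 hl (hr ▸ hr0))
    have hyx : y < x := by rw [hyd]; nlinarith
    have hSe : S = J * r ^ α + (p l) ^ α := by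
      rw [hSd, hJ, ← aux_sum p r _ _ l hlr]
      refine Finset.sum_congr rfl fun i _ => ?_
      by_cases h1 : p i = r
      · simp [h1]
      · by_cases h2 : i = l
        · subst h2; simp [h1]
        · simp [h2, hz i h2 h1, hα.ne', hr0.ne]
    have h2 := (cond (fun i => if p i = r then 1 else if i = l then -(J:ℝ) else 0)
      (by rw [aux_sum p r _ _ l hlr, ← hJ]; ring)
      (by
        intro k hk
        have h1 : p k ≠ r := by rw [hk]; exact hr0.ne
        have h2 : k ≠ l := fun h => by rw [← h] at hl; linarith
        simp [h1, h2])).2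
    have s1 : ∑ i, (if p i = r then 1 else if i = l then -(J:ℝ) else 0) * p i ^ (α - 1)
      = J * r ^ (α - 1) + -(J:ℝ) * (p l) ^ (α - 1) := by
      rw [hJ, ← aux_sum p r _ _ l hlr]
      refine Finset.sum_congr rfl fun i _ => ?_
      by_cases h1 : p i = r
      · simp [h1]
      · by_cases h2 : i = l
        · subst h2; simp [h1]
        · simp [h2, h1]
    have s2 : ∑ i, (if p i = r then 1 else if i = l then -(J:ℝ) else 0) ^ 2 *
        (A * (α - 1) * p i ^ (α - 1) + s) / p i
      = J * ((A * (α - 1) * r ^ (α - 1) + s) / r) + 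
        (-(J:ℝ)) ^ 2 * (A * (α - 1) * (p l) ^ (α - 1) + s) / p l := by
      nth_rw 2 [hJ]
      rw [← aux_sum p r _ _ l hlr]
      refine Finset.sum_congr rfl fun i _ => ?_
      by_cases h1 : p i = r
      · simp [h1]
      · by_cases h2 : i = l
        · subst h2; simp [h1]
        · simp [h2, h1]
    rw [s1, s2] at h2
    have core := aux_core x y J hx hyx hy hJ1'
    have hra : r ^ α = r * r ^ (α - 1) := by
      rw [rpow_sub_one hr0.ne']; field_simp
    have hua : (p l) ^ α = p l * (p l) ^ (α - 1) := by
      rw [rpow_sub_one hl.ne']; field_simp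
    have hrho : 0 < r ^ (α - 1) := by positivity
    rw [hSe, hra, hua, hu', hu] at h2
    rw [exp_sub] at core
    rw [exp_neg] at h2
    generalize r ^ (α - 1) = ρ at *
    have hE := exp_pos y
    have hX := exp_pos x
    generalize exp y = E at *
    generalize exp x = X at *
    have hJ0 : (0:ℝ) < J := by linarith
    generalize (J:ℝ) = K at *
    have hs' : s = A * ρ * (E - 1) / x := by field_simp; linarith
    have hα' : α = 1 - y / x := by rw [hyd]; field_simp; ring
    have hid : (1 - α) * (A / (K * (r * ρ) + r * X⁻¹ * (ρ * E))) * (K * ρ + -K * (ρ * E)) ^ 2 +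
      (K * ((A * (α - 1) * ρ + s) / r) + (-K) ^ 2 * (A * (α - 1) * (ρ * E) + s) / (r * X⁻¹))
      = (A * ρ * K / (x * r)) * (y * K * (1 - E) ^ 2 / (K + E / X) + (E - 1 - y) +
        K * X * (E - 1 - y * E)) := by
      rw [hs', hα']
      have : 0 < K * X + E := by positivity
      have hd : K * (r * ρ) + r * X⁻¹ * (ρ * E) = r * ρ * (K + E / X) := by field_simp
      have hd2 : 0 < K + E / X := by positivity
      rw [hd]
      generalize K + E / X = D at *
      field_simp
      ring
    rw [hid] at h2
    have := mul_neg_of_pos_of_neg (a := A * ρ * K / (x * r)) (by positivity) core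
    linarith
  · push Not at hex
    have hz : ∀ i, p i ≠ r → p i = 0 := by
      intro i h2
      by_contra h3
      exact h2 (hex i (lt_of_le_of_ne (hp.1 i) (Ne.symm h3)))
    have gen : ∀ g : ℝ → ℝ, g 0 = 0 → ∑ i, g (p i) = J * g r := by
      intro g hg
      have : ∀ i, g (p i) = if p i = r then g r else 0 := by
        intro i
        by_cases h : p i = r
        · simp [h]
        · simp [hz i h, hg, hr0.ne]
      simp_rw [this]
      simp [Finset.sum_ite, hJ]
    have h1 : (J:ℝ) * r = 1 := by rw [← hp.2]; exact (gen id rfl).symm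
    have hJ0 : (0:ℝ) < J := by linarith
    have hrJ : r = (J:ℝ)⁻¹ := by field_simp; linarith
    refine ⟨J, hJ1, ?_⟩
    unfold auxF
    rw [gen (fun t => t ^ α) (by simp [hα.ne']), gen (fun t => t * Real.log t) (by simp)]
    rw [← mul_assoc (J:ℝ) r, h1, hrJ, Real.log_inv]
    have : (J:ℝ) * (J:ℝ)⁻¹ ^ α = (J:ℝ) ^ (1 - α) := by
      rw [rpow_sub hJ0, inv_rpow hJ0.le, rpow_one]; rfl
    rw [this, ← rpow_mul hJ0.le]
    have : (1 - α) * (1 / α) = 1 / α - 1 := by field_simp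
    rw [this]; ring

lemma aux_exists {n : ℕ} (α s : ℝ) (hα : 0 < α) (p0 : Fin n → ℝ) (hp0 : IsProbVec p0) :
    ∃ p : Fin n → ℝ, IsProbVec p ∧ ∀ p' : Fin n → ℝ, IsProbVec p' → auxF α s p ≤ auxF α s p' := by
  have hc : Continuous (fun p : Fin n → ℝ => auxF α s p) := by
    unfold auxF
    refine Continuous.add (Continuous.rpow_const ?_ (fun _ => Or.inr (by positivity)))
      (continuous_const.mul ?_)
    · exact continuous_finsetSum _ fun i _ =>
        Continuous.rpow_const (continuous_apply i) (fun _ => Or.inr hα.le)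
    · exact continuous_finsetSum _ fun i _ =>
        Real.continuous_mul_log.comp (continuous_apply i)
  obtain ⟨p, hp, hm⟩ := (isCompact_stdSimplex ℝ (Fin n)).exists_isMinOn ⟨p0, hp0⟩ hc.continuousOn
  exact ⟨p, hp, fun p' hp' => hm hp'⟩

lemma aux_chord (c : ℝ) (k j : ℕ) (hk : 1 ≤ k) (hj : 1 ≤ j) (s : ℝ)
    (hs : s * (Real.log ((k:ℝ) + 1) - Real.log k) = ((k:ℝ) + 1) ^ c - (k:ℝ) ^ c) :
    (k:ℝ) ^ c - s * Real.log k ≤ (j:ℝ) ^ c - s * Real.log j := by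
  have hk0 : (0:ℝ) < k := by exact_mod_cast hk
  have hj0 : (0:ℝ) < j := by exact_mod_cast hj
  have hconv : ConvexOn ℝ Set.univ (fun t => exp (c * t)) := by
    have := convexOn_exp.comp_linearMap (LinearMap.mulLeft ℝ c)
    simpa [Function.comp_def] using this
  have hl : 0 < Real.log ((k:ℝ) + 1) - Real.log k :=
    sub_pos.2 (Real.log_lt_log hk0 (by linarith))
  have e : ∀ t : ℝ, 0 < t → t ^ c = exp (c * Real.log t) := fun t ht => by
    rw [rpow_def_of_pos ht, mul_comm]
  have hs' : s = (exp (c * Real.log ((k:ℝ)+1)) - exp (c * Real.log k)) /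
      (Real.log ((k:ℝ) + 1) - Real.log k) := by
    rw [eq_div_iff hl.ne', hs, e _ hk0, e _ (by linarith)]
  rw [e _ hk0, e _ hj0]
  rcases lt_trichotomy j k with h | h | h
  · have h' : Real.log j < Real.log k := Real.log_lt_log hj0 (by exact_mod_cast h)
    have := hconv.slope_mono_adjacent (Set.mem_univ (Real.log j))
      (Set.mem_univ (Real.log ((k:ℝ)+1))) h' (sub_pos.1 hl)
    rw [← hs', div_le_iff₀ (by linarith)] at this
    linarith
  · rw [h]
  · rcases (Nat.succ_le_of_lt h).eq_or_lt with h2 | h2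
    · have : (j:ℝ) = k + 1 := by rw [← h2]; push_cast; ring
      rw [this, ← e _ hk0, ← e _ (by linarith)]
      linarith
    · have h' : Real.log ((k:ℝ)+1) < Real.log j :=
        Real.log_lt_log (by linarith) (by exact_mod_cast h2)
      have := hconv.slope_mono_adjacent (Set.mem_univ (Real.log k))
        (Set.mem_univ (Real.log j)) (sub_pos.1 hl) h'
      rw [← hs', le_div_iff₀ (by linarith)] at this
      have h3 : s * (Real.log ((k:ℝ) + 1) - Real.log k) =
          exp (c * Real.log ((k:ℝ)+1)) - exp (c * Real.log k) := by
        rw [hs, e _ hk0, e _ (by linarith)]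
      linarith

theorem stmt9 (n : ℕ) (hn : 2 ≤ n) (α : ℝ) (hα : α ∈ Set.Ioo (0 : ℝ) 1 ∪ Set.Ioi 1)
    (m : ℕ) (hm : 0 < m) (q : Fin m → ℝ) (p : Fin m → Fin n → ℝ)
    (hq0 : ∀ y, 0 ≤ q y) (hq1 : ∑ y, q y = 1) (hp : ∀ y, IsProbVec (p y)) :
    Lmin α (∑ y, q y * shannonEntropy (p y)) ≤ ∑ y, q y * lNorm α (p y) := by
  have hα0 : 0 < α := by
    rcases hα with h | h
    · exact h.1
    · exact lt_trans one_pos h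
  have hα1 : α ≠ 1 := by
    rcases hα with h | h
    · exact h.2.ne
    · exact ne_of_gt h
  obtain ⟨h, hh⟩ : ∃ h, h = ∑ y, q y * shannonEntropy (p y) := ⟨_, rfl⟩
  have hh0 : 0 ≤ h := by
    rw [hh]
    refine Finset.sum_nonneg fun y _ => mul_nonneg (hq0 y) ?_
    unfold shannonEntropy
    rw [neg_nonneg]
    refine Finset.sum_nonpos fun i _ => mul_nonpos_of_nonneg_of_nonpos ((hp y).1 i) ?_
    refine Real.log_nonpos ((hp y).1 i) ?_
    rw [← (hp y).2]
    exact Finset.single_le_sum (fun j _ => (hp y).1 j) (Finset.mem_univ i)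
  rw [← hh]
  obtain ⟨k, hk⟩ : ∃ k, k = ⌊Real.exp h⌋₊ := ⟨_, rfl⟩
  have hk1 : 1 ≤ k := by
    rw [hk]
    exact Nat.le_floor (by simpa using hh0)
  have hk0 : (0:ℝ) < k := by exact_mod_cast hk1
  have hl : 0 < Real.log ((k:ℝ) + 1) - Real.log k :=
    sub_pos.2 (Real.log_lt_log hk0 (by linarith))
  unfold Lmin
  rw [← hk]
  obtain ⟨s, hs⟩ : ∃ s, s = (((k:ℝ) + 1) ^ (1 / α - 1) - (k:ℝ) ^ (1 / α - 1)) /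
      (Real.log ((k:ℝ) + 1) - Real.log k) := ⟨_, rfl⟩
  have hs' : s * (Real.log ((k:ℝ) + 1) - Real.log k) =
      ((k:ℝ) + 1) ^ (1 / α - 1) - (k:ℝ) ^ (1 / α - 1) := by
    rw [hs]; field_simp
  have key : ∀ y, (k:ℝ) ^ (1 / α - 1) - s * Real.log k + s * shannonEntropy (p y)
      ≤ lNorm α (p y) := by
    intro y
    obtain ⟨p', hp', hm'⟩ := aux_exists α s hα0 (p y) (hp y)
    obtain ⟨j, hj, hj'⟩ := aux_min α s hα0 hα1 p' hp' hm'
    have h1 := hm' (p y) (hp y)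
    have h2 := aux_chord (1 / α - 1) k j hk1 hj s hs'
    rw [hj'] at h1
    unfold auxF at h1
    unfold shannonEntropy lNorm
    linarith
  have h3 : ∑ y, q y * ((k:ℝ) ^ (1 / α - 1) - s * Real.log k + s * shannonEntropy (p y))
      ≤ ∑ y, q y * lNorm α (p y) :=
    Finset.sum_le_sum fun y _ => mul_le_mul_of_nonneg_left (key y) (hq0 y)
  have h4 : ∑ y, q y * ((k:ℝ) ^ (1 / α - 1) - s * Real.log k + s * shannonEntropy (p y))
      = (k:ℝ) ^ (1 / α - 1) - s * Real.log k + s * h := by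
    simp_rw [mul_add]
    rw [Finset.sum_add_distrib, ← Finset.sum_mul, hq1, hh, Finset.mul_sum, one_mul]
    congr 1
    exact Finset.sum_congr rfl fun y _ => by ring
  rw [h4] at h3
  refine le_trans (le_of_eq ?_) h3
  rw [hs]
  field_simp
  ring
end
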